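/- Let w_ε := ε^{-2}(u_ε − q ln(1/ε))₊^p and κ(w_ε) := ∫_Ω w_ε dx. Then lim_{ε→0} κ(w_ε) = 2π q(x*)√(det K_H(x*)), where x* ∈ Ω̄ is the minimum point of q²√(det K_H) to which A_ε concentrates. -/

import Mathlib

open MeasureTheory Real Filter Topology Set

noncomputable section

/-- The bilinear form `(K_H(x) a | b)` associated with the matrix
`K_H(x) = (k²+|x|²)⁻¹ [[k²+x₂², -x₁x₂],[-x₁x₂, k²+x₁²]]`. -/
def KHform (k : ℝ) (x a b : ℝ × ℝ) : ℝ :=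
  (k ^ 2 + x.1 ^ 2 + x.2 ^ 2)⁻¹ *
    ((k ^ 2 + x.2 ^ 2) * a.1 * b.1 - x.1 * x.2 * a.1 * b.2
      - x.1 * x.2 * a.2 * b.1 + (k ^ 2 + x.1 ^ 2) * a.2 * b.2)

/-- `K_H(x)` applied to a vector `a`. -/
def KHvec (k : ℝ) (x a : ℝ × ℝ) : ℝ × ℝ :=
  ((k ^ 2 + x.1 ^ 2 + x.2 ^ 2)⁻¹ * ((k ^ 2 + x.2 ^ 2) * a.1 - x.1 * x.2 * a.2),
   (k ^ 2 + x.1 ^ 2 + x.2 ^ 2)⁻¹ * (-(x.1 * x.2) * a.1 + (k ^ 2 + x.1 ^ 2) * a.2))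

/-- `det K_H(x) = k²/(k²+|x|²)`. -/
def detKH (k : ℝ) (x : ℝ × ℝ) : ℝ := k ^ 2 / (k ^ 2 + x.1 ^ 2 + x.2 ^ 2)

/-- Gradient of a scalar function on `ℝ²`. -/
def grad (u : ℝ × ℝ → ℝ) (x : ℝ × ℝ) : ℝ × ℝ :=
  (fderiv ℝ u x (1, 0), fderiv ℝ u x (0, 1))

/-- Divergence of a vector field on `ℝ²`. -/
def div2 (F : ℝ × ℝ → ℝ × ℝ) (x : ℝ × ℝ) : ℝ :=
  fderiv ℝ (fun y => (F y).1) x (1, 0) + fderiv ℝ (fun y => (F y).2) x (0, 1)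

/-- The operator `L_H u = -div (K_H(x) ∇u)`. -/
def LH (k : ℝ) (u : ℝ × ℝ → ℝ) (x : ℝ × ℝ) : ℝ :=
  - div2 (fun y => KHvec k y (grad u y)) x

/-- Positive part `t₊ = max (t, 0)`. -/
def pPart (t : ℝ) : ℝ := max t 0

/-- Clockwise rotation through `π/2`: `a^⊥`. -/
def perp2 (a : ℝ × ℝ) : ℝ × ℝ := (a.2, -a.1)

/-- Euclidean distance in the plane. -/
def dE (a b : ℝ × ℝ) : ℝ := Real.sqrt ((a.1 - b.1) ^ 2 + (a.2 - b.2) ^ 2)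

/-- Euclidean diameter of a planar set. -/
def diamE (S : Set (ℝ × ℝ)) : ℝ := sSup {d | ∃ a ∈ S, ∃ b ∈ S, d = dE a b}

/-- Euclidean distance between two planar sets. -/
def distE (A B : Set (ℝ × ℝ)) : ℝ := sInf {d | ∃ a ∈ A, ∃ b ∈ B, d = dE a b}

/-- The function `q² √(det K_H)`. -/
def Qfun (k : ℝ) (q : ℝ × ℝ → ℝ) (x : ℝ × ℝ) : ℝ := q x ^ 2 * Real.sqrt (detKH k x)

/-- Surrogate for membership in `H(Ω) = H¹₀(Ω)` (with equivalent norm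
`‖u‖² = ∫_Ω (K_H ∇u|∇u)`). -/
def MemH (k : ℝ) (Ω : Set (ℝ × ℝ)) (u : ℝ × ℝ → ℝ) : Prop :=
  ContinuousOn u (closure Ω) ∧ ContDiffOn ℝ 1 u Ω ∧ (∀ x ∈ frontier Ω, u x = 0) ∧
    IntegrableOn (fun x => KHform k x (grad u x) (grad u x)) Ω

/-- The energy functional `I_ε`. -/
def Ieps (k p ε : ℝ) (q : ℝ × ℝ → ℝ) (Ω : Set (ℝ × ℝ)) (u : ℝ × ℝ → ℝ) : ℝ :=
  (1 / 2) * (∫ x in Ω, KHform k x (grad u x) (grad u x))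
    - (1 / ((p + 1) * ε ^ 2)) * ∫ x in Ω, pPart (u x - q x * Real.log (1 / ε)) ^ (p + 1)

/-- The mountain pass value `c_ε = inf_{γ ∈ P_ε} max_{t ∈ [0,1]} I_ε(γ(t))`, where
`P_ε` is the collection of paths in `H(Ω)` (continuous for the `H`-norm) joining `0`
to a point with negative energy. -/
def ceps (k p : ℝ) (q : ℝ × ℝ → ℝ) (Ω : Set (ℝ × ℝ)) (ε : ℝ) : ℝ :=
  sInf {c | ∃ γ : ℝ → ℝ × ℝ → ℝ,
    (∀ t ∈ Icc (0:ℝ) 1, MemH k Ω (γ t)) ∧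
    (∀ t ∈ Icc (0:ℝ) 1, ∀ δ > 0, ∃ η > 0, ∀ s ∈ Icc (0:ℝ) 1, |s - t| < η →
      (∫ x in Ω, KHform k x (grad (fun y => γ s y - γ t y) x)
        (grad (fun y => γ s y - γ t y) x)) < δ) ∧
    γ 0 = (fun _ => 0) ∧ Ieps k p ε q Ω (γ 1) < 0 ∧
    c = sSup ((fun t => Ieps k p ε q Ω (γ t)) '' Icc (0:ℝ) 1)}

/-- The Nehari manifold `N_ε`. -/
def Nehari (k p ε : ℝ) (q : ℝ × ℝ → ℝ) (Ω : Set (ℝ × ℝ)) : Set (ℝ × ℝ → ℝ) :=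
  {u | MemH k Ω u ∧ ¬ Set.EqOn u 0 Ω ∧
    (∫ x in Ω, KHform k x (grad u x) (grad u x))
      = (1 / ε ^ 2) * ∫ x in Ω, pPart (u x - q x * Real.log (1 / ε)) ^ p * u x}

/-- `u` is a (classical) solution of `L_H u = ε⁻²(u - q ln(1/ε))₊ᵖ` in `Ω`, `u = 0` on `∂Ω`. -/
def IsSolution (k p ε : ℝ) (q : ℝ × ℝ → ℝ) (Ω : Set (ℝ × ℝ)) (u : ℝ × ℝ → ℝ) : Prop :=
  ContinuousOn u (closure Ω) ∧ ContDiffOn ℝ 2 u Ω ∧ (∀ x ∈ frontier Ω, u x = 0) ∧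
    ∀ x ∈ Ω, LH k u x = (1 / ε ^ 2) * pPart (u x - q x * Real.log (1 / ε)) ^ p

/-- `u` is a mountain pass solution: a solution at the mountain pass level `c_ε`. -/
def IsMPSolution (k p ε : ℝ) (q : ℝ × ℝ → ℝ) (Ω : Set (ℝ × ℝ)) (u : ℝ × ℝ → ℝ) : Prop :=
  IsSolution k p ε q Ω u ∧ MemH k Ω u ∧ Ieps k p ε q Ω u = ceps k p q Ω ε

/-- The vortex core `A_ε = {x ∈ Ω : u(x) > q(x) ln(1/ε)}`. -/
def vcore (q : ℝ × ℝ → ℝ) (Ω : Set (ℝ × ℝ)) (ε : ℝ) (u : ℝ × ℝ → ℝ) : Set (ℝ × ℝ) :=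
  {x ∈ Ω | q x * Real.log (1 / ε) < u x}


/- Part 1 -/
noncomputable section

lemma den_pos {k : ℝ} (hk : 0 < k) (x : ℝ × ℝ) : 0 < k ^ 2 + x.1 ^ 2 + x.2 ^ 2 := by positivity

lemma KHform_self (k : ℝ) (x a : ℝ × ℝ) : KHform k x a a =
    (k ^ 2 + x.1 ^ 2 + x.2 ^ 2)⁻¹ * (k ^ 2 * (a.1 ^ 2 + a.2 ^ 2) + (x.2 * a.1 - x.1 * a.2) ^ 2) := by
  unfold KHform; ring

lemma KHform_nonneg {k : ℝ} (hk : 0 < k) (x a : ℝ × ℝ) : 0 ≤ KHform k x a a := by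
  rw [KHform_self]; positivity

lemma KHform_comm (k : ℝ) (x a b : ℝ × ℝ) : KHform k x a b = KHform k x b a := by
  unfold KHform; ring

lemma KHform_smul_left (k : ℝ) (x a b : ℝ × ℝ) (c : ℝ) :
    KHform k x (c • a) b = c * KHform k x a b := by
  unfold KHform; simp; ring

lemma KHform_smul_right (k : ℝ) (x a b : ℝ × ℝ) (c : ℝ) :
    KHform k x a (c • b) = c * KHform k x a b := by
  unfold KHform; simp; ring

lemma KHform_add_left (k : ℝ) (x a b c : ℝ × ℝ) :
    KHform k x (a + b) c = KHform k x a c + KHform k x b c := by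
  unfold KHform; simp; ring

lemma KHform_add_right (k : ℝ) (x a b c : ℝ × ℝ) :
    KHform k x a (b + c) = KHform k x a b + KHform k x a c := by
  unfold KHform; simp; ring

lemma KHform_sub_left (k : ℝ) (x a b c : ℝ × ℝ) :
    KHform k x (a - b) c = KHform k x a c - KHform k x b c := by
  unfold KHform; simp; ring

lemma KHform_sub_right (k : ℝ) (x a b c : ℝ × ℝ) :
    KHform k x a (b - c) = KHform k x a b - KHform k x a c := by
  unfold KHform; simp; ring

lemma KHform_zero_left (k : ℝ) (x a : ℝ × ℝ) : KHform k x 0 a = 0 := by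
  unfold KHform; simp

lemma KHform_zero_right (k : ℝ) (x a : ℝ × ℝ) : KHform k x a 0 = 0 := by
  unfold KHform; simp

lemma KHform_abs_le {k : ℝ} (hk : 0 < k) (x a b : ℝ × ℝ) :
    |KHform k x a b| ≤ KHform k x a a + KHform k x b b := by
  have h1 := KHform_nonneg hk x (a - b)
  have h2 := KHform_nonneg hk x (a + b)
  have h3 := KHform_nonneg hk x a
  have h4 := KHform_nonneg hk x b
  simp only [KHform_add_left, KHform_add_right, KHform_sub_left, KHform_sub_right] at h1 h2
  rw [KHform_comm k x b a] at h1 h2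
  rw [abs_le]; constructor <;> linarith

lemma KHform_lower {k R : ℝ} (hk : 0 < k) (x a : ℝ × ℝ) (hx : x.1 ^ 2 + x.2 ^ 2 ≤ R) :
    k ^ 2 / (k ^ 2 + R) * (a.1 ^ 2 + a.2 ^ 2) ≤ KHform k x a a := by
  rw [KHform_self]
  have h0 := den_pos hk x
  have : k ^ 2 / (k ^ 2 + R) * (a.1 ^ 2 + a.2 ^ 2) ≤
    (k ^ 2 + x.1 ^ 2 + x.2 ^ 2)⁻¹ * (k ^ 2 * (a.1 ^ 2 + a.2 ^ 2)) := by
    rw [div_eq_mul_inv, mul_comm (k^2), mul_assoc]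
    apply mul_le_mul_of_nonneg_right _ (by positivity)
    apply inv_anti₀ h0; linarith
  refine this.trans ?_
  apply mul_le_mul_of_nonneg_left _ (by positivity)
  nlinarith [sq_nonneg (x.2 * a.1 - x.1 * a.2)]

lemma KHform_continuousOn {k : ℝ} (hk : 0 < k) {V : Set (ℝ × ℝ)} {f g : ℝ × ℝ → ℝ × ℝ}
    (hf : ContinuousOn f V) (hg : ContinuousOn g V) :
    ContinuousOn (fun x => KHform k x (f x) (g x)) V := by
  unfold KHform
  have : ∀ x ∈ V, k ^ 2 + x.1 ^ 2 + x.2 ^ 2 ≠ 0 := fun x _ => (den_pos hk x).ne'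
  fun_prop (disch := assumption)

/-- test functions -/
def TestFn (V : Set (ℝ × ℝ)) (φ : ℝ × ℝ → ℝ) : Prop :=
  ContDiff ℝ 1 φ ∧ HasCompactSupport φ ∧ tsupport φ ⊆ V

lemma grad_continuousOn {V : Set (ℝ × ℝ)} (hV : IsOpen V) {f : ℝ × ℝ → ℝ}
    (hf : ContDiffOn ℝ 1 f V) : ContinuousOn (grad f) V := by
  have h := hf.continuousOn_fderiv_of_isOpen hV le_rfl
  unfold grad
  exact (h.clm_apply continuousOn_const).prodMk (h.clm_apply continuousOn_const)

lemma grad_continuous {f : ℝ × ℝ → ℝ} (hf : ContDiff ℝ 1 f) : Continuous (grad f) := by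
  rw [← continuousOn_univ]; exact grad_continuousOn isOpen_univ hf.contDiffOn

lemma grad_contDiffOn {V : Set (ℝ × ℝ)} (hV : IsOpen V) {f : ℝ × ℝ → ℝ}
    (hf : ContDiffOn ℝ 2 f V) : ContDiffOn ℝ 1 (grad f) V := by
  have h : ContDiffOn ℝ 1 (fderiv ℝ f) V := hf.fderiv_of_isOpen hV (by norm_num)
  unfold grad
  exact (h.clm_apply contDiffOn_const).prodMk (h.clm_apply contDiffOn_const)

lemma grad_zero_of_notMem {φ : ℝ × ℝ → ℝ} {x : ℝ × ℝ} (hx : x ∉ tsupport φ) : grad φ x = 0 := by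
  unfold grad
  have : fderiv ℝ φ x = 0 := by
    have := support_fderiv_subset ℝ (f := φ)
    by_contra h
    exact hx (this h)
  simp [this]

lemma KHvec_contDiffOn {k : ℝ} (hk : 0 < k) {V : Set (ℝ × ℝ)} {g : ℝ × ℝ → ℝ × ℝ}
    (hg : ContDiffOn ℝ 1 g V) : ContDiffOn ℝ 1 (fun x => KHvec k x (g x)) V := by
  unfold KHvec
  have : ∀ x ∈ V, k ^ 2 + x.1 ^ 2 + x.2 ^ 2 ≠ 0 := fun x _ => (den_pos hk x).ne'
  have h1 : ContDiffOn ℝ 1 (fun x => (g x).1) V := contDiff_fst.comp_contDiffOn hg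
  have h2 : ContDiffOn ℝ 1 (fun x => (g x).2) V := contDiff_snd.comp_contDiffOn hg
  have h3 : ContDiffOn ℝ 1 (fun x : ℝ × ℝ => (k ^ 2 + x.1 ^ 2 + x.2 ^ 2)⁻¹) V :=
    ContDiffOn.inv (by fun_prop) this
  have h4 : ContDiffOn ℝ 1 (fun x : ℝ × ℝ => (k ^ 2 + x.2 ^ 2)) V := by fun_prop
  have h5 : ContDiffOn ℝ 1 (fun x : ℝ × ℝ => (k ^ 2 + x.1 ^ 2)) V := by fun_prop
  have h6 : ContDiffOn ℝ 1 (fun x : ℝ × ℝ => x.1 * x.2) V := by fun_prop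
  exact (h3.mul ((h4.mul h1).sub (h6.mul h2))).prodMk (h3.mul ((h6.neg.mul h1).add (h5.mul h2)))

/-- A function continuous on open `V` times a compactly supported function. -/
lemma continuous_mul_of_tsupport {V : Set (ℝ × ℝ)} (hV : IsOpen V) {f φ : ℝ × ℝ → ℝ}
    (hf : ContinuousOn f V) (hφ : Continuous φ) (h : tsupport φ ⊆ V) :
    Continuous (fun x => f x * φ x) := by
  rw [continuous_iff_continuousAt]
  intro x
  by_cases hx : x ∈ tsupport φ
  · exact (hf.continuousAt (hV.mem_nhds (h hx))).mul hφ.continuousAt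
  · have : (fun x => f x * φ x) =ᶠ[𝓝 x] fun _ => 0 := by
      filter_upwards [(isClosed_tsupport φ).isOpen_compl.mem_nhds hx] with y hy
      rw [image_eq_zero_of_notMem_tsupport hy, mul_zero]
    exact continuousAt_const.congr this.symm

lemma integrable_mul_of_tsupport {V : Set (ℝ × ℝ)} (hV : IsOpen V) {f φ : ℝ × ℝ → ℝ}
    (hf : ContinuousOn f V) (hφ : Continuous φ) (hc : HasCompactSupport φ) (h : tsupport φ ⊆ V) :
    Integrable (fun x => f x * φ x) :=
  (continuous_mul_of_tsupport hV hf hφ h).integrable_of_hasCompactSupport hc.mul_left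

lemma fderiv_apply_tsupport {φ : ℝ × ℝ → ℝ} (v : ℝ × ℝ) :
    tsupport (fun x => fderiv ℝ φ x v) ⊆ tsupport φ :=
  tsupport_fderiv_apply_subset ℝ v

lemma setIntegral_eq_of_tsupport {V : Set (ℝ × ℝ)} {f : ℝ × ℝ → ℝ}
    (h : ∀ x, x ∉ V → f x = 0) : ∫ x in V, f x = ∫ x, f x :=
  setIntegral_eq_integral_of_forall_compl_eq_zero h

/-- Integration by parts. -/
lemma ibp {k : ℝ} (hk : 0 < k) {V : Set (ℝ × ℝ)} (hV : IsOpen V) {f φ : ℝ × ℝ → ℝ}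
    (hf : ContDiffOn ℝ 2 f V) (hφ : TestFn V φ) :
    ∫ x in V, KHform k x (grad f x) (grad φ x) = ∫ x in V, LH k f x * φ x := by
  obtain ⟨h1, hc, hs⟩ := hφ
  set F := fun y => KHvec k y (grad f y) with hF
  have hFC : ContDiffOn ℝ 1 F V := KHvec_contDiffOn hk (grad_contDiffOn hV hf)
  have hF1 : ContDiffOn ℝ 1 (fun y => (F y).1) V := contDiff_fst.comp_contDiffOn hFC
  have hF2 : ContDiffOn ℝ 1 (fun y => (F y).2) V := contDiff_snd.comp_contDiffOn hFC
  have key : ∀ (g : ℝ × ℝ → ℝ) (v : ℝ × ℝ), ContDiffOn ℝ 1 g V →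
      (∫ x, g x * fderiv ℝ φ x v = - ∫ x, fderiv ℝ g x v * φ x) ∧
      Integrable (fun x => g x * fderiv ℝ φ x v) ∧ Integrable (fun x => fderiv ℝ g x v * φ x) := by
    intro g v hg
    have i1 : Integrable (fun x => g x * fderiv ℝ φ x v) :=
      integrable_mul_of_tsupport hV hg.continuousOn
        ((h1.continuous_fderiv one_ne_zero).clm_apply continuous_const)
        (hc.fderiv_apply ℝ v) ((fderiv_apply_tsupport v).trans hs)
    have i2 : Integrable (fun x => fderiv ℝ g x v * φ x) :=
      integrable_mul_of_tsupport hV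
        ((hg.continuousOn_fderiv_of_isOpen hV le_rfl).clm_apply continuousOn_const)
        h1.continuous hc hs
    have i3 : Integrable (fun x => g x * φ x) :=
      integrable_mul_of_tsupport hV hg.continuousOn h1.continuous hc hs
    refine ⟨?_, i1, i2⟩
    refine integral_bilinear_hasFDerivAt_right_eq_neg_left_of_integrable
      (B := ContinuousLinearMap.mul ℝ ℝ) (f' := fderiv ℝ g) (g' := fderiv ℝ φ)
      (by simpa using i2) (by simpa using i1) (by simpa using i3) ?_ ?_
    · intro x hx
      exact ((hg.differentiableOn one_ne_zero).differentiableAt (hV.mem_nhds (hs hx))).hasFDerivAt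
    · intro x _
      exact (h1.differentiable one_ne_zero x).hasFDerivAt
  obtain ⟨e1, a1, b1⟩ := key _ (1, 0) hF1
  obtain ⟨e2, a2, b2⟩ := key _ (0, 1) hF2
  rw [setIntegral_eq_of_tsupport, setIntegral_eq_of_tsupport]
  · have l1 : ∀ x, KHform k x (grad f x) (grad φ x) =
        (F x).1 * fderiv ℝ φ x (1, 0) + (F x).2 * fderiv ℝ φ x (0, 1) := by
      intro x; simp only [KHform, KHvec, hF, grad]; ring
    have l2 : ∀ x, LH k f x * φ x = - (fderiv ℝ (fun y => (F y).1) x (1, 0) * φ x +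
        fderiv ℝ (fun y => (F y).2) x (0, 1) * φ x) := by
      intro x; simp only [LH, div2, hF]; ring
    simp_rw [l1, l2]
    rw [integral_neg, integral_add a1 a2, integral_add b1 b2, e1, e2]; ring
  · intro x hx; rw [image_eq_zero_of_notMem_tsupport (fun h => hx (hs h)), mul_zero]
  · intro x hx; rw [grad_zero_of_notMem (fun h => hx (hs h)), KHform_zero_right]

end

/- Part 2 -/
noncomputable section

lemma TestFn.mono {V W : Set (ℝ × ℝ)} {φ : ℝ × ℝ → ℝ} (h : TestFn V φ) (hVW : V ⊆ W) : TestFn W φ :=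
  ⟨h.1, h.2.1, h.2.2.trans hVW⟩

lemma TestFn.of_eq_zero {V S : Set (ℝ × ℝ)} {φ : ℝ × ℝ → ℝ} (h : ContDiff ℝ 1 φ) (hS : IsCompact S)
    (hSV : S ⊆ V) (h0 : ∀ x, x ∉ S → φ x = 0) : TestFn V φ := by
  have : tsupport φ ⊆ S := by
    apply closure_minimal _ hS.isClosed
    intro x hx; by_contra hxS; exact hx (h0 x hxS)
  exact ⟨h, hS.of_isClosed_subset (isClosed_tsupport φ) this, this.trans hSV⟩

lemma TestFn.add {V : Set (ℝ × ℝ)} {φ ψ : ℝ × ℝ → ℝ} (h : TestFn V φ) (h' : TestFn V ψ) :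
    TestFn V (fun x => φ x + ψ x) :=
  TestFn.of_eq_zero (h.1.add h'.1) (h.2.1.isCompact.union h'.2.1.isCompact) (union_subset h.2.2 h'.2.2)
    (fun x hx => by
      rw [mem_union, not_or] at hx
      rw [image_eq_zero_of_notMem_tsupport hx.1, image_eq_zero_of_notMem_tsupport hx.2, add_zero])

lemma TestFn.const_mul {V : Set (ℝ × ℝ)} {φ : ℝ × ℝ → ℝ} (h : TestFn V φ) (c : ℝ) :
    TestFn V (fun x => c * φ x) :=
  TestFn.of_eq_zero (contDiff_const.mul h.1) h.2.1.isCompact h.2.2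
    (fun x hx => by rw [image_eq_zero_of_notMem_tsupport hx, mul_zero])

lemma TestFn.eq_zero {V : Set (ℝ × ℝ)} {φ : ℝ × ℝ → ℝ} (h : TestFn V φ) {x : ℝ × ℝ} (hx : x ∉ V) :
    φ x = 0 := image_eq_zero_of_notMem_tsupport (fun h' => hx (h.2.2 h'))

lemma TestFn.grad_eq_zero {V : Set (ℝ × ℝ)} {φ : ℝ × ℝ → ℝ} (h : TestFn V φ) {x : ℝ × ℝ} (hx : x ∉ V) :
    grad φ x = 0 := grad_zero_of_notMem (fun h' => hx (h.2.2 h'))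

lemma TestFn.diff {V : Set (ℝ × ℝ)} {φ : ℝ × ℝ → ℝ} (h : TestFn V φ) (x : ℝ × ℝ) :
    DifferentiableAt ℝ φ x := h.1.differentiable one_ne_zero x

lemma grad_add {f g : ℝ × ℝ → ℝ} {x : ℝ × ℝ} (hf : DifferentiableAt ℝ f x)
    (hg : DifferentiableAt ℝ g x) : grad (fun y => f y + g y) x = grad f x + grad g x := by
  unfold grad; rw [fderiv_fun_add hf hg]; simp

lemma grad_sub {f g : ℝ × ℝ → ℝ} {x : ℝ × ℝ} (hf : DifferentiableAt ℝ f x)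
    (hg : DifferentiableAt ℝ g x) : grad (fun y => f y - g y) x = grad f x - grad g x := by
  unfold grad; rw [fderiv_fun_sub hf hg]; simp

lemma grad_const_mul {f : ℝ × ℝ → ℝ} {x : ℝ × ℝ} (hf : DifferentiableAt ℝ f x) (c : ℝ) :
    grad (fun y => c * f y) x = c • grad f x := by
  unfold grad; rw [fderiv_const_mul hf]; simp

lemma grad_mul_const {f : ℝ × ℝ → ℝ} {x : ℝ × ℝ} (hf : DifferentiableAt ℝ f x) (c : ℝ) :
    grad (fun y => f y * c) x = c • grad f x := by
  simp_rw [mul_comm _ c]; exact grad_const_mul hf c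

lemma grad_mul {f g : ℝ × ℝ → ℝ} {x : ℝ × ℝ} (hf : DifferentiableAt ℝ f x)
    (hg : DifferentiableAt ℝ g x) :
    grad (fun y => f y * g y) x = f x • grad g x + g x • grad f x := by
  unfold grad; rw [fderiv_fun_mul hf hg]; simp

lemma grad_comp {f : ℝ × ℝ → ℝ} {H : ℝ → ℝ} {h' : ℝ} {x : ℝ × ℝ} (hf : DifferentiableAt ℝ f x)
    (hH : HasDerivAt H h' (f x)) : grad (fun y => H (f y)) x = h' • grad f x := by
  have := (hH.comp_hasFDerivAt x hf.hasFDerivAt).fderiv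
  unfold grad
  change (fderiv ℝ (H ∘ f) x _, fderiv ℝ (H ∘ f) x _) = _
  rw [this]; simp

lemma grad_congr {f g : ℝ × ℝ → ℝ} {x : ℝ × ℝ} (h : f =ᶠ[𝓝 x] g) : grad f x = grad g x := by
  unfold grad; rw [h.fderiv_eq]

/-- Energy form. -/
def En (k : ℝ) (V : Set (ℝ × ℝ)) (f g : ℝ × ℝ → ℝ) : ℝ :=
  ∫ x in V, KHform k x (grad f x) (grad g x)

lemma TestFn.integrable_form {k : ℝ} (hk : 0 < k) {V : Set (ℝ × ℝ)} {φ ψ : ℝ × ℝ → ℝ}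
    (h : TestFn V φ) (h' : TestFn V ψ) :
    Integrable (fun x => KHform k x (grad φ x) (grad ψ x)) := by
  have hc : Continuous (fun x => KHform k x (grad φ x) (grad ψ x)) := by
    rw [← continuousOn_univ]
    exact KHform_continuousOn hk (grad_continuous h.1).continuousOn (grad_continuous h'.1).continuousOn
  apply hc.integrable_of_hasCompactSupport
  apply HasCompactSupport.of_support_subset_isCompact h.2.1.isCompact
  intro x hx
  by_contra hx'
  apply hx
  simp only [grad_zero_of_notMem hx', KHform_zero_left]

lemma TestFn.memH {k : ℝ} (hk : 0 < k) {V : Set (ℝ × ℝ)} (hV : IsOpen V) {φ : ℝ × ℝ → ℝ}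
    (h : TestFn V φ) : MemH k V φ := by
  refine ⟨h.1.continuous.continuousOn, h.1.contDiffOn, ?_, (h.integrable_form hk h).integrableOn⟩
  intro x hx
  apply h.eq_zero
  rw [hV.frontier_eq] at hx; exact hx.2

lemma compT {V : Set (ℝ × ℝ)} (hV : IsOpen V) {f : ℝ × ℝ → ℝ} (hf : ContDiffOn ℝ 1 f V)
    {H H' : ℝ → ℝ} (hH : ∀ t, HasDerivAt H (H' t) t) (hH' : Continuous H') {δ : ℝ}
    (h0 : ∀ t ≤ δ, H t = 0) (hc : IsCompact {x ∈ V | δ ≤ f x}) :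
    TestFn V (V.indicator (fun x => H (f x))) ∧
    ∀ x ∈ V, grad (V.indicator (fun x => H (f x))) x = H' (f x) • grad f x := by
  have hHC : ContDiff ℝ 1 H := by
    rw [contDiff_one_iff_deriv]
    refine ⟨fun t => (hH t).differentiableAt, ?_⟩
    have : deriv H = H' := by ext t; exact (hH t).deriv
    rwa [this]
  have hz : ∀ x, x ∉ {x ∈ V | δ ≤ f x} → V.indicator (fun x => H (f x)) x = 0 := by
    intro x hx
    by_cases hxV : x ∈ V
    · rw [indicator_of_mem hxV]
      apply h0
      by_contra hh
      exact hx ⟨hxV, (not_le.mp hh).le⟩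
    · exact indicator_of_notMem hxV _
  have heq : ∀ x ∈ V, V.indicator (fun x => H (f x)) =ᶠ[𝓝 x] fun x => H (f x) := by
    intro x hx
    filter_upwards [hV.mem_nhds hx] with y hy
    exact indicator_of_mem hy _
  refine ⟨TestFn.of_eq_zero ?_ hc (fun x hx => hx.1) hz, ?_⟩
  · rw [contDiff_iff_contDiffAt]
    intro x
    by_cases hx : x ∈ {x ∈ V | δ ≤ f x}
    · refine ContDiffAt.congr_of_eventuallyEq ?_ (heq x hx.1)
      exact hHC.contDiffAt.comp x (hf.contDiffAt (hV.mem_nhds hx.1))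
    · refine ContDiffAt.congr_of_eventuallyEq (contDiffAt_const (c := (0:ℝ))) ?_
      filter_upwards [hc.isClosed.isOpen_compl.mem_nhds hx] with y hy
      exact hz y hy
  · intro x hx
    rw [grad_congr (heq x hx)]
    exact grad_comp ((hf.differentiableOn one_ne_zero).differentiableAt (hV.mem_nhds hx)) (hH _)

/-- `C¹` truncation. -/
def Gd (δ t : ℝ) : ℝ := (max (t - δ) 0) ^ 2 / max t δ
def Gd' (δ t : ℝ) : ℝ := 1 - δ ^ 2 / (max t δ) ^ 2

lemma Gd_of_le {δ t : ℝ} (h : t ≤ δ) : Gd δ t = 0 := by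
  unfold Gd; rw [max_eq_right (by linarith)]; simp

lemma Gd_of_ge {δ t : ℝ} (h : δ ≤ t) : Gd δ t = (t - δ) ^ 2 / t := by
  unfold Gd; rw [max_eq_left (by linarith), max_eq_left h]

lemma Gd'_of_le {δ t : ℝ} (hδ : 0 < δ) (h : t ≤ δ) : Gd' δ t = 0 := by
  unfold Gd'; rw [max_eq_right h, div_self (by positivity), sub_self]

lemma Gd'_continuous {δ : ℝ} (hδ : 0 < δ) : Continuous (Gd' δ) := by
  unfold Gd'
  have : ∀ t : ℝ, (max t δ) ^ 2 ≠ 0 := fun t => by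
    have : 0 < max t δ := lt_max_of_lt_right hδ
    positivity
  fun_prop (disch := assumption)

lemma Gd_continuous {δ : ℝ} (hδ : 0 < δ) : Continuous (Gd δ) := by
  unfold Gd
  have : ∀ t : ℝ, (max t δ) ≠ 0 := fun t => by
    have : 0 < max t δ := lt_max_of_lt_right hδ
    positivity
  fun_prop (disch := assumption)

lemma Gd_hasDerivAt {δ : ℝ} (hδ : 0 < δ) (t : ℝ) : HasDerivAt (Gd δ) (Gd' δ t) t := by
  have key : ∀ y, y ≠ δ → HasDerivAt (Gd δ) (Gd' δ y) y := by
    intro y hy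
    rcases lt_or_gt_of_ne hy with h | h
    · rw [Gd'_of_le hδ h.le]
      refine (hasDerivAt_const y (0:ℝ)).congr_of_eventuallyEq ?_
      filter_upwards [gt_mem_nhds h] with z hz
      exact Gd_of_le hz.le
    · have hy0 : y ≠ 0 := by linarith
      have h1 : HasDerivAt (fun y => (y - δ) ^ 2 / y) (Gd' δ y) y := by
        convert! ((((hasDerivAt_id y).sub_const δ).pow 2).div (hasDerivAt_id y) hy0) using 1
        unfold Gd'; rw [max_eq_left h.le]; simp; field_simp; ring
      refine h1.congr_of_eventuallyEq ?_
      filter_upwards [lt_mem_nhds h] with z hz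
      exact Gd_of_ge hz.le
  by_cases ht : t = δ
  · subst ht
    exact hasDerivAt_of_hasDerivAt_of_ne key (Gd_continuous hδ).continuousAt
      (Gd'_continuous hδ).continuousAt
  · exact key t ht

lemma Gd_nonneg {δ : ℝ} (hδ : 0 < δ) (t : ℝ) : 0 ≤ Gd δ t := by
  have : 0 < max t δ := lt_max_of_lt_right hδ
  unfold Gd; positivity

lemma Gd_le {δ : ℝ} (hδ : 0 < δ) (t : ℝ) : Gd δ t ≤ max t 0 := by
  rcases le_or_gt t δ with h | h
  · rw [Gd_of_le h]; exact le_max_right _ _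
  · rw [Gd_of_ge h.le]
    refine le_trans ?_ (le_max_left _ _)
    rw [div_le_iff₀ (by linarith)]; nlinarith

lemma Gd_ge {δ : ℝ} (hδ : 0 < δ) (t : ℝ) : t - 2 * δ ≤ Gd δ t := by
  rcases le_or_gt t δ with h | h
  · rw [Gd_of_le h]; linarith
  · rw [Gd_of_ge h.le, le_div_iff₀ (by linarith)]; nlinarith

lemma Gd'_nonneg {δ : ℝ} (hδ : 0 < δ) (t : ℝ) : 0 ≤ Gd' δ t := by
  have h : 0 < max t δ := lt_max_of_lt_right hδ
  unfold Gd'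
  rw [sub_nonneg, div_le_one (by positivity)]
  have := le_max_right t δ
  gcongr

lemma Gd'_le (δ t : ℝ) : Gd' δ t ≤ 1 := by
  unfold Gd'; have : 0 ≤ δ ^ 2 / (max t δ) ^ 2 := by positivity
  linarith

lemma Gd'_tendsto {t : ℝ} {d : ℕ → ℝ} (hd : ∀ n, 0 < d n) (hd0 : Tendsto d atTop (𝓝 0)) :
    Tendsto (fun n => Gd' (d n) t) atTop (𝓝 (if 0 < t then 1 else 0)) := by
  split_ifs with h
  · have h1 : Tendsto (fun n => 1 - (d n) ^ 2 / t ^ 2) atTop (𝓝 (1 - 0 ^ 2 / t ^ 2)) :=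
      tendsto_const_nhds.sub ((hd0.pow 2).div_const _)
    simp only [ne_eq, OfNat.ofNat_ne_zero, not_false_eq_true, zero_pow, zero_div, sub_zero] at h1
    refine h1.congr' ?_
    filter_upwards [hd0.eventually (gt_mem_nhds h)] with n hn
    unfold Gd'; rw [max_eq_left hn.le]
  · refine tendsto_const_nhds.congr (fun n => ?_)
    rw [Gd'_of_le (hd n) (by linarith [hd n])]

lemma Gd_tendsto {t : ℝ} {d : ℕ → ℝ} (hd : ∀ n, 0 < d n) (hd0 : Tendsto d atTop (𝓝 0)) :
    Tendsto (fun n => Gd (d n) t) atTop (𝓝 (max t 0)) := by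
  have h1 : Tendsto (fun n => max t 0 - 2 * d n) atTop (𝓝 (max t 0 - 2 * 0)) :=
      tendsto_const_nhds.sub (hd0.const_mul _)
  rw [mul_zero, sub_zero] at h1
  refine tendsto_of_tendsto_of_tendsto_of_le_of_le h1 tendsto_const_nhds ?_ ?_
  · intro n
    rcases le_total t 0 with h | h
    · simp only [max_eq_right h]; have := Gd_nonneg (hd n) t; have := hd n; linarith
    · simp only [max_eq_left h]; exact Gd_ge (hd n) t
  · intro n; exact Gd_le (hd n) t

lemma compact_superlevel {Ω : Set (ℝ × ℝ)} (hΩo : IsOpen Ω)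
    (hΩb : Bornology.IsBounded Ω) {u g : ℝ × ℝ → ℝ} (hu : ContinuousOn u (closure Ω))
    (hg : ContinuousOn g (closure Ω)) (h : ∀ x ∈ frontier Ω, u x < g x) :
    IsCompact {x ∈ Ω | g x ≤ u x} := by
  have hc : IsCompact (closure Ω) := hΩb.isCompact_closure
  have : {x ∈ Ω | g x ≤ u x} = closure Ω ∩ (fun x => u x - g x) ⁻¹' Ici 0 := by
    ext x
    simp only [mem_setOf_eq, mem_inter_iff, mem_preimage, mem_Ici, sub_nonneg]
    constructor
    · rintro ⟨h1, h2⟩; exact ⟨subset_closure h1, h2⟩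
    · rintro ⟨h1, h2⟩
      refine ⟨?_, h2⟩
      by_contra hx
      have : x ∈ frontier Ω := by rw [hΩo.frontier_eq]; exact ⟨h1, hx⟩
      exact absurd (h x this) (not_lt.mpr h2)
  rw [this]
  exact hc.of_isClosed_subset ((hu.sub hg).preimage_isClosed_of_isClosed hc.isClosed isClosed_Ici)
    inter_subset_left

end

/- Part 3 -/
noncomputable section

lemma isOpen_pos {V : Set (ℝ × ℝ)} (hV : IsOpen V) {f : ℝ × ℝ → ℝ} (hf : ContinuousOn f V) :
    IsOpen {x ∈ V | 0 < f x} := by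
  have := hf.isOpen_inter_preimage hV isOpen_Ioi (t := Ioi (0:ℝ))
  exact this

lemma dct_A {A : Set (ℝ × ℝ)} (hA : IsOpen A) {F : ℝ × ℝ → ℝ} (hF : IntegrableOn F A)
    {c : ℕ → ℝ × ℝ → ℝ} (hc : ∀ n, ContinuousOn (c n) A) (h1 : ∀ n, ∀ x ∈ A, |c n x| ≤ 1)
    (ht : ∀ x ∈ A, Tendsto (fun n => c n x) atTop (𝓝 1)) :
    Tendsto (fun n => ∫ x in A, c n x * F x) atTop (𝓝 (∫ x in A, F x)) := by
  refine tendsto_integral_of_dominated_convergence (fun x => |F x|) ?_ hF.abs ?_ ?_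
  · intro n
    exact ((hc n).aestronglyMeasurable hA.measurableSet).mul hF.aestronglyMeasurable
  · intro n
    refine (ae_restrict_iff' hA.measurableSet).mpr (Eventually.of_forall fun x hx => ?_)
    rw [norm_mul, Real.norm_eq_abs, Real.norm_eq_abs]
    exact mul_le_of_le_one_left (abs_nonneg _) (h1 n x hx)
  · refine (ae_restrict_iff' hA.measurableSet).mpr (Eventually.of_forall fun x hx => ?_)
    simpa using (ht x hx).mul_const (F x)

lemma setIntegral_sub_zero {A V : Set (ℝ × ℝ)} (hV : MeasurableSet V) (hAV : A ⊆ V) {F : ℝ × ℝ → ℝ}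
    (h : ∀ x ∈ V, x ∉ A → F x = 0) : ∫ x in V, F x = ∫ x in A, F x :=
  (setIntegral_eq_of_subset_of_forall_sdiff_eq_zero hV hAV (fun x hx => h x hx.1 hx.2))

lemma limit_id {k : ℝ} (hk : 0 < k) {V : Set (ℝ × ℝ)} (hV : IsOpen V) {g f : ℝ × ℝ → ℝ}
    (hg : ContDiffOn ℝ 2 g V) (hf : ContDiffOn ℝ 1 f V)
    (hcomp : ∀ δ > 0, IsCompact {x ∈ V | δ ≤ f x})
    (hi : IntegrableOn (fun x => KHform k x (grad g x) (grad f x)) {x ∈ V | 0 < f x})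
    (hi2 : IntegrableOn (fun x => LH k g x * max (f x) 0) V) :
    ∫ x in {x ∈ V | 0 < f x}, KHform k x (grad g x) (grad f x) =
      ∫ x in V, LH k g x * max (f x) 0 := by
  set A := {x ∈ V | 0 < f x} with hAdef
  have hA : IsOpen A := isOpen_pos hV hf.continuousOn
  have hAV : A ⊆ V := fun x hx => hx.1
  set d : ℕ → ℝ := fun n => 1 / ((n : ℝ) + 1) with hd
  have hdp : ∀ n, 0 < d n := fun n => Nat.one_div_pos_of_nat
  have hd0 : Tendsto d atTop (𝓝 0) := tendsto_one_div_add_atTop_nhds_zero_nat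
  have hT := fun n => compT hV hf (Gd_hasDerivAt (hdp n)) (Gd'_continuous (hdp n))
    (fun t ht => Gd_of_le ht) (hcomp _ (hdp n))
  have e : ∀ n, ∫ x in A, Gd' (d n) (f x) * KHform k x (grad g x) (grad f x) =
      ∫ x in A, (LH k g x * Gd (d n) (f x)) := by
    intro n
    have := ibp hk hV hg (hT n).1
    have c1 : ∫ x in V, KHform k x (grad g x) (grad (V.indicator fun x => Gd (d n) (f x)) x) =
        ∫ x in V, Gd' (d n) (f x) * KHform k x (grad g x) (grad f x) :=
      setIntegral_congr_fun hV.measurableSet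
        (fun x hx => by simp only [(hT n).2 x hx, KHform_smul_right])
    have c2 : ∫ x in V, LH k g x * (V.indicator fun x => Gd (d n) (f x)) x =
        ∫ x in V, LH k g x * Gd (d n) (f x) :=
      setIntegral_congr_fun hV.measurableSet (fun x hx => by simp only [indicator_of_mem hx])
    rw [c1, c2] at this
    rw [setIntegral_sub_zero hV.measurableSet hAV, setIntegral_sub_zero hV.measurableSet hAV] at this
    · exact this
    · intro x hx hxA
      rw [Gd_of_le, mul_zero]
      by_contra h
      exact hxA ⟨hx, (hdp n).trans (not_le.mp h)⟩
    · intro x hx hxA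
      rw [Gd'_of_le (hdp n), zero_mul]
      by_contra h
      exact hxA ⟨hx, (hdp n).trans (not_le.mp h)⟩
  have t1 : Tendsto (fun n => ∫ x in A, Gd' (d n) (f x) * KHform k x (grad g x) (grad f x)) atTop
      (𝓝 (∫ x in A, KHform k x (grad g x) (grad f x))) := by
    apply dct_A hA hi
    · intro n; exact (Gd'_continuous (hdp n)).comp_continuousOn (hf.continuousOn.mono hAV)
    · intro n x _; rw [abs_of_nonneg (Gd'_nonneg (hdp n) _)]; exact Gd'_le _ _
    · intro x hx; have := Gd'_tendsto (t := f x) hdp hd0; rwa [if_pos hx.2] at this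
  have t2 : Tendsto (fun n => ∫ x in A, Gd (d n) (f x) / f x * (LH k g x * max (f x) 0)) atTop
      (𝓝 (∫ x in A, LH k g x * max (f x) 0)) := by
    apply dct_A hA (hi2.mono_set hAV)
    · intro n; exact ((Gd_continuous (hdp n)).comp_continuousOn (hf.continuousOn.mono hAV)).div
        (hf.continuousOn.mono hAV) (fun x hx => hx.2.ne')
    · intro n x hx; rw [abs_of_nonneg (div_nonneg (Gd_nonneg (hdp n) _) hx.2.le)]
      rw [div_le_one hx.2]; exact (Gd_le (hdp n) _).trans_eq (max_eq_left hx.2.le)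
    · intro x hx; have := (Gd_tendsto (t := f x) hdp hd0).div_const (f x)
      rwa [max_eq_left hx.2.le, div_self hx.2.ne'] at this
  have e2 : ∀ n, ∫ x in A, Gd (d n) (f x) / f x * (LH k g x * max (f x) 0) =
      ∫ x in A, (LH k g x * Gd (d n) (f x)) := by
    intro n
    apply setIntegral_congr_fun hA.measurableSet
    intro x hx
    simp only [max_eq_left hx.2.le]
    have := hx.2.ne'
    field_simp
  rw [setIntegral_sub_zero hV.measurableSet hAV (F := fun x => LH k g x * max (f x) 0)]
  · simp_rw [e] at t1
    simp_rw [e2] at t2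
    exact tendsto_nhds_unique t1 t2
  · intro x hx hxA
    rw [max_eq_right, mul_zero]
    by_contra h
    exact hxA ⟨hx, (not_le.mp h)⟩

/-- limit of mixed energy -/
lemma limit_mixed {k : ℝ} {Ω V : Set (ℝ × ℝ)} (hΩ : IsOpen Ω) (hV : IsOpen V) (hVΩ : V ⊆ Ω)
    {g f : ℝ × ℝ → ℝ}
    (hg : ContDiffOn ℝ 1 g Ω) (hf : ContDiffOn ℝ 1 f V)
    (hgc : ∀ δ > 0, IsCompact {x ∈ Ω | δ ≤ g x})
    (hfc : ∀ δ > 0, IsCompact {x ∈ V | δ ≤ f x})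
    (hpos : ∀ x ∈ V, 0 < f x → 0 < g x)
    (hi : IntegrableOn (fun x => KHform k x (grad g x) (grad f x)) {x ∈ V | 0 < f x})
    {d : ℕ → ℝ} (hdp : ∀ n, 0 < d n) (hd0 : Tendsto d atTop (𝓝 0)) :
    Tendsto (fun n => En k Ω (Ω.indicator (fun x => Gd (d n) (g x)))
      (V.indicator (fun x => Gd (d n) (f x)))) atTop
      (𝓝 (∫ x in {x ∈ V | 0 < f x}, KHform k x (grad g x) (grad f x))) := by
  set A := {x ∈ V | 0 < f x} with hAdef
  have hA : IsOpen A := isOpen_pos hV hf.continuousOn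
  have hAV : A ⊆ V := fun x hx => hx.1
  have hT1 := fun n => compT hΩ hg (Gd_hasDerivAt (hdp n)) (Gd'_continuous (hdp n))
    (fun t ht => Gd_of_le ht) (hgc _ (hdp n))
  have hT2 := fun n => compT hV hf (Gd_hasDerivAt (hdp n)) (Gd'_continuous (hdp n))
    (fun t ht => Gd_of_le ht) (hfc _ (hdp n))
  have t1 : Tendsto (fun n => ∫ x in A, Gd' (d n) (g x) * Gd' (d n) (f x) *
      KHform k x (grad g x) (grad f x)) atTop
      (𝓝 (∫ x in A, KHform k x (grad g x) (grad f x))) := by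
    apply dct_A hA hi
    · intro n
      exact ((Gd'_continuous (hdp n)).comp_continuousOn (hg.continuousOn.mono (hAV.trans hVΩ))).mul
        ((Gd'_continuous (hdp n)).comp_continuousOn (hf.continuousOn.mono hAV))
    · intro n x _
      rw [abs_of_nonneg (mul_nonneg (Gd'_nonneg (hdp n) _) (Gd'_nonneg (hdp n) _))]
      exact mul_le_one₀ (Gd'_le _ _) (Gd'_nonneg (hdp n) _) (Gd'_le _ _)
    · intro x hx
      have h1 := Gd'_tendsto (t := f x) hdp hd0; rw [if_pos hx.2] at h1
      have h2 := Gd'_tendsto (t := g x) hdp hd0; rw [if_pos (hpos x hx.1 hx.2)] at h2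
      simpa using h2.mul h1
  refine t1.congr (fun n => ?_)
  unfold En
  rw [setIntegral_sub_zero hΩ.measurableSet (hAV.trans hVΩ)]
  · apply setIntegral_congr_fun hA.measurableSet
    intro x hx
    simp only [(hT2 n).2 x (hAV hx), (hT1 n).2 x (hVΩ (hAV hx)), KHform_smul_left, KHform_smul_right]
    ring
  · intro x _ hxA
    by_cases hxV : x ∈ V
    · rw [(hT2 n).2 x hxV, Gd'_of_le (hdp n), zero_smul, KHform_zero_right]
      by_contra h
      exact hxA ⟨hxV, (hdp n).trans (not_le.mp h)⟩
    · rw [(hT2 n).1.grad_eq_zero hxV, KHform_zero_right]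

lemma En_trunc_le {k : ℝ} (hk : 0 < k) {Ω V : Set (ℝ × ℝ)} (hΩ : IsOpen Ω) (hV : IsOpen V)
    (hVΩ : V ⊆ Ω) {f : ℝ × ℝ → ℝ} (hf : ContDiffOn ℝ 1 f V) {δ : ℝ} (hδ : 0 < δ)
    (hfc : IsCompact {x ∈ V | δ ≤ f x})
    (hi : IntegrableOn (fun x => KHform k x (grad f x) (grad f x)) {x ∈ V | 0 < f x}) :
    En k Ω (V.indicator (fun x => Gd δ (f x))) (V.indicator (fun x => Gd δ (f x))) ≤
      ∫ x in {x ∈ V | 0 < f x}, KHform k x (grad f x) (grad f x) := by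
  set A := {x ∈ V | 0 < f x} with hAdef
  have hA : IsOpen A := isOpen_pos hV hf.continuousOn
  have hAV : A ⊆ V := fun x hx => hx.1
  have hT2 := compT hV hf (Gd_hasDerivAt hδ) (Gd'_continuous hδ)
    (fun t ht => Gd_of_le ht) hfc
  unfold En
  rw [setIntegral_sub_zero hΩ.measurableSet (hAV.trans hVΩ)]
  · apply setIntegral_mono_on (hT2.1.integrable_form hk hT2.1).integrableOn hi hA.measurableSet
    intro x hx
    rw [hT2.2 x (hAV hx), KHform_smul_left, KHform_smul_right, ← mul_assoc]
    exact mul_le_of_le_one_left (KHform_nonneg hk _ _)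
      (mul_le_one₀ (Gd'_le _ _) (Gd'_nonneg hδ _) (Gd'_le _ _))
  · intro x _ hxA
    by_cases hxV : x ∈ V
    · rw [hT2.2 x hxV, Gd'_of_le hδ, zero_smul, KHform_zero_right]
      by_contra h
      exact hxA ⟨hxV, hδ.trans (not_le.mp h)⟩
    · rw [hT2.1.grad_eq_zero hxV, KHform_zero_right]

/-- Sobolev -/
lemma sobolev : ∃ C : ℝ, 0 < C ∧ ∀ g : ℝ × ℝ → ℝ, ContDiff ℝ 1 g → HasCompactSupport g →
    ∫ x, g x ^ 2 ≤ C * (∫ x, (|(grad g x).1| + |(grad g x).2|)) ^ 2 := by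
  set c := MeasureTheory.eLpNormLESNormFDerivOneConst (volume : Measure (ℝ × ℝ)) ((2 : NNReal) : ℝ) with hc
  refine ⟨(c : ℝ) ^ 2 + 1, by positivity, ?_⟩
  intro g hg hgc
  have hp : NNReal.HolderConjugate (Module.finrank ℝ (ℝ × ℝ)) 2 := by
    have : (Module.finrank ℝ (ℝ × ℝ) : NNReal) = 2 := by simp
    rw [this]
    rw [← NNReal.holderConjugate_coe_iff]
    exact Real.HolderConjugate.two_two
  have h := MeasureTheory.eLpNorm_le_eLpNorm_fderiv_one (μ := (volume : Measure (ℝ × ℝ))) hg hgc hp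
  have hgi : Integrable (fun x => (|(grad g x).1| + |(grad g x).2|)) := by
    have hcont := grad_continuous hg
    apply Continuous.integrable_of_hasCompactSupport (by fun_prop)
    apply HasCompactSupport.of_support_subset_isCompact hgc.isCompact
    intro x hx
    by_contra hx'
    apply hx
    simp [grad_zero_of_notMem hx']
  have hg2 : MemLp g 2 := hg.continuous.memLp_of_hasCompactSupport hgc
  have e1 : eLpNorm g 2 volume = ENNReal.ofReal (√(∫ x, g x ^ 2)) := by
    rw [hg2.eLpNorm_eq_integral_rpow_norm (by norm_num) (by norm_num)]
    congr 1
    rw [Real.sqrt_eq_rpow]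
    congr 1
    · congr 1; ext x; simp
    · simp
  have e2 : eLpNorm (fderiv ℝ g) 1 volume ≤
      ENNReal.ofReal (∫ x, (|(grad g x).1| + |(grad g x).2|)) := by
    rw [eLpNorm_one_eq_lintegral_enorm, ofReal_integral_eq_lintegral_ofReal hgi
      (Eventually.of_forall fun x => by positivity)]
    apply lintegral_mono
    intro x
    simp only
    rw [← ofReal_norm]
    apply ENNReal.ofReal_le_ofReal
    apply ContinuousLinearMap.opNorm_le_bound _ (by positivity)
    intro y
    have : fderiv ℝ g x y = y.1 * (grad g x).1 + y.2 * (grad g x).2 := by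
      have : y = y.1 • ((1:ℝ), (0:ℝ)) + y.2 • ((0:ℝ), (1:ℝ)) := by ext <;> simp
      conv_lhs => rw [this]
      rw [map_add, map_smul, map_smul]; rfl
    rw [this, Real.norm_eq_abs]
    have h1 : |y.1| ≤ ‖y‖ := norm_fst_le y
    have h2 : |y.2| ≤ ‖y‖ := norm_snd_le y
    calc _ ≤ |y.1 * (grad g x).1| + |y.2 * (grad g x).2| := abs_add_le _ _
      _ = |y.1| * |(grad g x).1| + |y.2| * |(grad g x).2| := by rw [abs_mul, abs_mul]
      _ ≤ ‖y‖ * |(grad g x).1| + ‖y‖ * |(grad g x).2| := by gcongr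
      _ = _ := by ring
  set J := ∫ x, (|(grad g x).1| + |(grad g x).2|) with hJ
  have hJ0 : 0 ≤ J := integral_nonneg fun x => by positivity
  have h3 : ENNReal.ofReal (√(∫ x, g x ^ 2)) ≤ ENNReal.ofReal (c * J) := by
    rw [← e1]
    refine h.trans ?_
    have h5 : ENNReal.ofReal ((c : ℝ) * J) = (c : ENNReal) * ENNReal.ofReal J := by
      rw [ENNReal.ofReal_mul (NNReal.coe_nonneg c), ENNReal.ofReal_coe_nnreal]
    rw [h5]
    gcongr
  rw [ENNReal.ofReal_le_ofReal_iff (by positivity)] at h3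
  have h4 : ∫ x, g x ^ 2 ≤ (c * J) ^ 2 := by
    rw [← Real.sqrt_le_sqrt_iff (by positivity), Real.sqrt_sq (by positivity)]; exact h3
  nlinarith [sq_nonneg J]

end

/- Part 4 -/
noncomputable section

lemma cauchy_schwarz {B : Set (ℝ × ℝ)} {F G : ℝ × ℝ → ℝ}
    (hF : IntegrableOn (fun x => F x ^ 2) B) (hG : IntegrableOn (fun x => G x ^ 2) B)
    (hFG : IntegrableOn (fun x => F x * G x) B) :
    (∫ x in B, F x * G x) ^ 2 ≤ (∫ x in B, F x ^ 2) * (∫ x in B, G x ^ 2) := by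
  have h : ∀ t : ℝ, 0 ≤ (∫ x in B, G x ^ 2) * (t * t) + (2 * ∫ x in B, F x * G x) * t +
      (∫ x in B, F x ^ 2) := by
    intro t
    have h0 : 0 ≤ ∫ x in B, (F x + t * G x) ^ 2 := integral_nonneg fun x => sq_nonneg _
    have h1 : ∫ x in B, (F x + t * G x) ^ 2 =
        ∫ x in B, ((G x ^ 2) * (t * t) + ((F x * G x) * (2 * t) + F x ^ 2)) := by
      congr 1; ext x; ring
    have hI : IntegrableOn (fun x => (F x * G x) * (2 * t) + F x ^ 2) B := (hFG.mul_const _).add hF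
    rw [h1, integral_add (hG.mul_const _) hI,
      integral_add (hFG.mul_const _) hF, integral_mul_const, integral_mul_const] at h0
    linarith
  have := discrim_le_zero h
  unfold discrim at this
  nlinarith

lemma cauchy_schwarz_K {k : ℝ} (hk : 0 < k) {B : Set (ℝ × ℝ)} {F G : ℝ × ℝ → ℝ × ℝ}
    (hF : IntegrableOn (fun x => KHform k x (F x) (F x)) B)
    (hG : IntegrableOn (fun x => KHform k x (G x) (G x)) B)
    (hFG : IntegrableOn (fun x => KHform k x (F x) (G x)) B) :
    (∫ x in B, KHform k x (F x) (G x)) ^ 2 ≤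
      (∫ x in B, KHform k x (F x) (F x)) * (∫ x in B, KHform k x (G x) (G x)) := by
  have h : ∀ t : ℝ, 0 ≤ (∫ x in B, KHform k x (G x) (G x)) * (t * t) +
      (2 * ∫ x in B, KHform k x (F x) (G x)) * t + (∫ x in B, KHform k x (F x) (F x)) := by
    intro t
    have h0 : 0 ≤ ∫ x in B, KHform k x (F x + t • G x) (F x + t • G x) :=
      integral_nonneg fun x => KHform_nonneg hk _ _
    have h1 : ∫ x in B, KHform k x (F x + t • G x) (F x + t • G x) =
        ∫ x in B, ((KHform k x (G x) (G x)) * (t * t) + ((KHform k x (F x) (G x)) * (2 * t) +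
          KHform k x (F x) (F x))) := by
      congr 1; ext x
      rw [KHform_add_left, KHform_add_right, KHform_add_right, KHform_smul_left, KHform_smul_left,
        KHform_smul_right, KHform_smul_right, KHform_comm k x (G x) (F x)]
      ring
    have hI : IntegrableOn (fun x => (KHform k x (F x) (G x)) * (2 * t) + KHform k x (F x) (F x)) B := (hFG.mul_const _).add hF
    rw [h1, integral_add (hG.mul_const _) hI,
      integral_add (hFG.mul_const _) hF, integral_mul_const, integral_mul_const] at h0
    linarith
  have := discrim_le_zero h
  unfold discrim at this
  nlinarith

lemma holder_pow {B : Set (ℝ × ℝ)} (hBf : volume B ≠ ⊤) {v : ℝ × ℝ → ℝ} (hv : ∀ x, 0 ≤ v x)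
    {a b : ℝ} (ha : 0 < a) (hab : a < b)
    (hm : AEStronglyMeasurable v (volume.restrict B))
    (hi : IntegrableOn (fun x => v x ^ b) B) :
    ∫ x in B, v x ^ a ≤ (∫ x in B, v x ^ b) ^ (a / b) * (volume.real B) ^ (1 - a / b) := by
  have hb : 0 < b := ha.trans hab
  have hconj : (b / a).HolderConjugate (1 - a / b)⁻¹ := by
    rw [Real.holderConjugate_iff]
    constructor
    · rw [lt_div_iff₀ ha]; linarith
    · rw [inv_div, inv_inv]; ring
  have hfin : IsFiniteMeasure (volume.restrict B) := ⟨by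
    rw [Measure.restrict_apply_univ]; exact lt_top_iff_ne_top.mpr hBf⟩
  have hma : AEStronglyMeasurable (fun x => v x ^ a) (volume.restrict B) :=
    (Real.continuous_rpow_const ha.le).comp_aestronglyMeasurable hm
  have hL : MemLp (fun x => v x ^ a) (ENNReal.ofReal (b / a)) (volume.restrict B) := by
    have hpos : 0 < b / a := by positivity
    rw [← integrable_norm_rpow_iff hma (by simpa using hpos) (by simp)]
    refine hi.congr (Eventually.of_forall fun x => ?_)
    simp only
    rw [Real.norm_of_nonneg (Real.rpow_nonneg (hv x) _), ENNReal.toReal_ofReal hpos.le,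
      ← Real.rpow_mul (hv x)]
    congr 1; field_simp
  have h := integral_mul_le_Lp_mul_Lq_of_nonneg (μ := volume.restrict B) hconj
    (f := fun x => v x ^ a) (g := fun _ => 1)
    (Eventually.of_forall fun x => Real.rpow_nonneg (hv x) _)
    (Eventually.of_forall fun x => zero_le_one) hL (memLp_const 1)
  simp only [mul_one, Real.one_rpow, integral_const, smul_eq_mul, one_div, inv_inv, inv_div] at h
  refine h.trans (le_of_eq ?_)
  congr 2
  · congr 1; ext x
    rw [← Real.rpow_mul (hv x)]
    congr 1; field_simp
  · simp [Measure.real]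

lemma hasDerivAt_maxpow {s : ℝ} (hs : 1 < s) (t : ℝ) :
    HasDerivAt (fun t : ℝ => (max t 0) ^ s) (s * (max t 0) ^ (s - 1)) t := by
  have c1 : Continuous (fun t : ℝ => (max t 0) ^ s) :=
    (Real.continuous_rpow_const (by linarith)).comp (by fun_prop)
  have c2 : Continuous (fun t : ℝ => s * (max t 0) ^ (s - 1)) :=
    continuous_const.mul ((Real.continuous_rpow_const (by linarith)).comp (by fun_prop))
  have key : ∀ y : ℝ, y ≠ 0 →
      HasDerivAt (fun t : ℝ => (max t 0) ^ s) (s * (max y 0) ^ (s - 1)) y := by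
    intro y hy
    rcases lt_or_gt_of_ne hy with h | h
    · rw [max_eq_right h.le, Real.zero_rpow (by linarith), mul_zero]
      refine (hasDerivAt_const y (0:ℝ)).congr_of_eventuallyEq ?_
      filter_upwards [gt_mem_nhds h] with z hz
      rw [max_eq_right hz.le, Real.zero_rpow (by linarith)]
    · rw [max_eq_left h.le]
      refine (Real.hasDerivAt_rpow_const (Or.inl hy)).congr_of_eventuallyEq ?_
      filter_upwards [lt_mem_nhds h] with z hz
      rw [max_eq_left hz.le]
  by_cases ht : t = 0
  · subst ht
    exact hasDerivAt_of_hasDerivAt_of_ne key c1.continuousAt c2.continuousAt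
  · exact key t ht

lemma maxpow_contOn {V : Set (ℝ × ℝ)} {f : ℝ × ℝ → ℝ} (hf : ContinuousOn f V) {s : ℝ} (hs : 0 ≤ s) :
    ContinuousOn (fun x => (max (f x) 0) ^ s) V :=
  (Real.continuous_rpow_const hs).comp_continuousOn (hf.sup continuousOn_const)

lemma maxpow_integrableOn {V : Set (ℝ × ℝ)} (hV : IsOpen V) {f : ℝ × ℝ → ℝ} (hf : ContinuousOn f V)
    (hc : IsCompact {x ∈ V | 0 ≤ f x}) {s : ℝ} (hs : 0 < s) {g : ℝ × ℝ → ℝ} (hg : ContinuousOn g V) :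
    IntegrableOn (fun x => (max (f x) 0) ^ s * g x) V := by
  have h1 : IntegrableOn (fun x => (max (f x) 0) ^ s * g x) {x ∈ V | 0 ≤ f x} :=
    (((maxpow_contOn hf hs.le).mul hg).mono (fun x hx => hx.1)).integrableOn_compact hc
  refine h1.of_forall_sdiff_eq_zero hV.measurableSet ?_
  rintro x ⟨hx, hx2⟩
  have : f x < 0 := by
    by_contra h; exact hx2 ⟨hx, not_lt.mp h⟩
  rw [max_eq_right this.le, Real.zero_rpow hs.ne', zero_mul]

lemma maxpow_integrableOn' {V : Set (ℝ × ℝ)} (hV : IsOpen V) {f : ℝ × ℝ → ℝ} (hf : ContinuousOn f V)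
    (hc : IsCompact {x ∈ V | 0 ≤ f x}) {s : ℝ} (hs : 0 < s) :
    IntegrableOn (fun x => (max (f x) 0) ^ s) V := by
  simpa using maxpow_integrableOn hV hf hc hs (g := fun _ => 1) continuousOn_const

lemma bounded_sq {Ω : Set (ℝ × ℝ)} (hΩb : Bornology.IsBounded Ω) :
    ∃ R : ℝ, 0 < R ∧ ∀ x ∈ Ω, x.1 ^ 2 + x.2 ^ 2 ≤ R := by
  obtain ⟨r, hr⟩ := hΩb.exists_norm_le
  refine ⟨2 * r ^ 2 + 1, by positivity, fun x hx => ?_⟩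
  have h1 : |x.1| ≤ r := (norm_fst_le x).trans (hr x hx)
  have h2 : |x.2| ≤ r := (norm_snd_le x).trans (hr x hx)
  have := sq_le_sq' (abs_le.mp h1).1 (abs_le.mp h1).2
  have := sq_le_sq' (abs_le.mp h2).1 (abs_le.mp h2).2
  linarith

/-- Weighted Sobolev inequality. -/
lemma sob_weighted {k : ℝ} (hk : 0 < k) {Ω : Set (ℝ × ℝ)} (hΩb : Bornology.IsBounded Ω) :
    ∃ C : ℝ, 0 < C ∧ ∀ V ⊆ Ω, IsOpen V → ∀ f : ℝ × ℝ → ℝ, ContDiffOn ℝ 1 f V →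
    IsCompact {x ∈ V | 0 ≤ f x} → ∀ s : ℝ, 1 < s →
    IntegrableOn (fun x => KHform k x (grad f x) (grad f x)) {x ∈ V | 0 < f x} →
    ∫ x in V, (max (f x) 0) ^ (2 * s) ≤ C * s ^ 2 * (∫ x in V, (max (f x) 0) ^ (2 * s - 2)) *
      ∫ x in {x ∈ V | 0 < f x}, KHform k x (grad f x) (grad f x) := by
  obtain ⟨C0, hC0, hS⟩ := sobolev
  obtain ⟨R, hR, hRb⟩ := bounded_sq hΩb
  set c := k ^ 2 / (k ^ 2 + R) with hc
  have hc0 : 0 < c := by positivity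
  refine ⟨C0 * (2 / c), by positivity, ?_⟩
  intro V hVΩ hV f hf hcomp s hs hi
  set A := {x ∈ V | 0 < f x} with hAdef
  have hA : IsOpen A := isOpen_pos hV hf.continuousOn
  have hAV : A ⊆ V := fun x hx => hx.1
  have hT := compT hV hf (hasDerivAt_maxpow hs)
    (continuous_const.mul ((Real.continuous_rpow_const (by linarith)).comp (by fun_prop)))
    (δ := 0) (fun t ht => by
      rw [max_eq_right ht, Real.zero_rpow (by linarith)]) hcomp
  set g := V.indicator (fun x => (max (f x) 0) ^ s) with hg
  have h1 := hS g hT.1.1 hT.1.2.1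
  have e1 : ∫ x, g x ^ 2 = ∫ x in V, (max (f x) 0) ^ (2 * s) := by
    rw [← setIntegral_eq_of_tsupport (V := V)]
    · apply setIntegral_congr_fun hV.measurableSet
      intro x hx
      simp only [hg, indicator_of_mem hx]
      rw [← Real.rpow_natCast, ← Real.rpow_mul (le_max_right _ _)]
      congr 1; push_cast; ring
    · intro x hx; simp [hg, indicator_of_notMem hx]
  have e2 : ∫ x, (|(grad g x).1| + |(grad g x).2|) =
      ∫ x in A, s * ((max (f x) 0) ^ (s - 1) * (|(grad f x).1| + |(grad f x).2|)) := by
    rw [← setIntegral_eq_of_tsupport (V := A)]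
    · apply setIntegral_congr_fun hA.measurableSet
      intro x hx
      simp only [hT.2 x hx.1, Prod.smul_fst, Prod.smul_snd, smul_eq_mul, abs_mul]
      rw [abs_of_pos (by linarith : 0 < s), abs_of_nonneg (Real.rpow_nonneg (le_max_right _ _) _)]
      ring
    · intro x hx
      by_cases hxV : x ∈ V
      · have : f x ≤ 0 := by
          by_contra h; exact hx ⟨hxV, not_le.mp h⟩
        rw [hT.2 x hxV]
        simp [max_eq_right this, Real.zero_rpow (by linarith : s - 1 ≠ 0)]
      · rw [hT.1.grad_eq_zero hxV]; simp
  rw [e1, e2, integral_const_mul] at h1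
  have hgc := (grad_continuousOn hV hf).mono hAV
  have hfA := hf.continuousOn.mono hAV
  have hdc : ContinuousOn (fun x => |(grad f x).1| + |(grad f x).2|) A :=
    (continuous_abs.comp_continuousOn (continuous_fst.comp_continuousOn hgc)).add
      (continuous_abs.comp_continuousOn (continuous_snd.comp_continuousOn hgc))
  have hsq : ∀ x ∈ A, (|(grad f x).1| + |(grad f x).2|) ^ 2 ≤
      (2 / c) * KHform k x (grad f x) (grad f x) := by
    intro x hx
    have h := KHform_lower hk x (grad f x) (hRb x (hVΩ hx.1))
    rw [← hc] at h
    have h2 : (|(grad f x).1| + |(grad f x).2|) ^ 2 ≤ 2 * ((grad f x).1 ^ 2 + (grad f x).2 ^ 2) := by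
      nlinarith [sq_nonneg (|(grad f x).1| - |(grad f x).2|), sq_abs (grad f x).1, sq_abs (grad f x).2]
    have h3 : 2 / c * KHform k x (grad f x) (grad f x) =  2 * (KHform k x (grad f x) (grad f x) / c) := by
      ring
    rw [h3]
    have : (grad f x).1 ^ 2 + (grad f x).2 ^ 2 ≤ KHform k x (grad f x) (grad f x) / c := by
      rw [le_div_iff₀ hc0]; linarith
    linarith
  have hpe : ∀ x, ((max (f x) 0) ^ (s - 1)) ^ 2 = (max (f x) 0) ^ (2 * s - 2) := by
    intro x
    rw [← Real.rpow_natCast, ← Real.rpow_mul (le_max_right _ _)]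
    congr 1; push_cast; ring
  have i1 : IntegrableOn (fun x => ((max (f x) 0) ^ (s - 1)) ^ 2) A := by
    simp_rw [hpe]
    exact (maxpow_integrableOn' hV hf.continuousOn hcomp (by linarith)).mono_set hAV
  have i2 : IntegrableOn (fun x => (|(grad f x).1| + |(grad f x).2|) ^ 2) A := by
    refine Integrable.mono' (hi.const_mul (2 / c))
      ((hdc.pow 2).aestronglyMeasurable hA.measurableSet) ?_
    refine (ae_restrict_iff' hA.measurableSet).mpr (Eventually.of_forall fun x hx => ?_)
    rw [Real.norm_of_nonneg (by positivity)]
    exact hsq x hx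
  have i3 : IntegrableOn (fun x => (max (f x) 0) ^ (s - 1) * (|(grad f x).1| + |(grad f x).2|)) A := by
    refine Integrable.mono' (i1.add i2)
      (((maxpow_contOn hfA (by linarith)).mul hdc).aestronglyMeasurable hA.measurableSet) ?_
    refine (ae_restrict_iff' hA.measurableSet).mpr (Eventually.of_forall fun x hx => ?_)
    have h0 : 0 ≤ (max (f x) 0) ^ (s - 1) := (Real.rpow_nonneg (le_max_right _ _) _)
    rw [Real.norm_of_nonneg (by positivity)]
    simp only [Pi.add_apply]
    nlinarith [sq_nonneg ((max (f x) 0) ^ (s - 1) - (|(grad f x).1| + |(grad f x).2|))]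
  have hcs := cauchy_schwarz i1 i2 i3
  have h4 : ∫ x in A, ((max (f x) 0) ^ (s - 1)) ^ 2 = ∫ x in V, (max (f x) 0) ^ (2 * s - 2) := by
    simp_rw [hpe]
    symm
    apply setIntegral_sub_zero hV.measurableSet hAV
    intro x hx hxA
    have : f x ≤ 0 := by
      by_contra h; exact hxA ⟨hx, not_le.mp h⟩
    rw [max_eq_right this, Real.zero_rpow (by linarith)]
  have h5 : ∫ x in A, (|(grad f x).1| + |(grad f x).2|) ^ 2 ≤
      (2 / c) * ∫ x in A, KHform k x (grad f x) (grad f x) := by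
    rw [← integral_const_mul]
    exact setIntegral_mono_on i2 (hi.const_mul _) hA.measurableSet hsq
  rw [h4] at hcs
  have h6 : 0 ≤ ∫ x in V, (max (f x) 0) ^ (2 * s - 2) :=
    integral_nonneg fun x => Real.rpow_nonneg (le_max_right _ _) _
  calc _ ≤ _ := h1
    _ = C0 * s ^ 2 * (∫ x in A, (max (f x) 0) ^ (s - 1) * (|(grad f x).1| + |(grad f x).2|)) ^ 2 := by ring
    _ ≤ C0 * s ^ 2 * ((∫ x in V, (max (f x) 0) ^ (2 * s - 2)) *
        ((2 / c) * ∫ x in A, KHform k x (grad f x) (grad f x))) := by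
      gcongr
      exact hcs.trans (by gcongr)
    _ = _ := by ring

end

/- Part 5 -/
noncomputable section

/-- Fixed data. -/
structure Dom (k p : ℝ) (q : ℝ × ℝ → ℝ) (Ω : Set (ℝ × ℝ)) : Prop where
  hk : 0 < k
  hp : 1 < p
  ho : IsOpen Ω
  hb : Bornology.IsBounded Ω
  hne : Ω.Nonempty
  hq1 : ContDiffOn ℝ 2 q Ω
  hqc : ContinuousOn q (closure Ω)
  hq3 : ∀ x ∈ closure Ω, 0 < q x
  hq4 : ∀ x ∈ Ω, LH k q x = 0

/-- The function `u - q ln(1/ε)`. -/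
def ff (q : ℝ × ℝ → ℝ) (ε : ℝ) (u : ℝ × ℝ → ℝ) (x : ℝ × ℝ) : ℝ := u x - q x * Real.log (1 / ε)

/-- The vorticity. -/
def ww (p : ℝ) (q : ℝ × ℝ → ℝ) (ε : ℝ) (u : ℝ × ℝ → ℝ) (x : ℝ × ℝ) : ℝ :=
  (1 / ε ^ 2) * (max (ff q ε u x) 0) ^ p

structure Ctx (k p : ℝ) (q : ℝ × ℝ → ℝ) (Ω : Set (ℝ × ℝ)) (ε : ℝ) (u : ℝ × ℝ → ℝ) : Prop
    extends Dom k p q Ω where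
  he : 0 < ε
  he1 : ε < 1
  hs : IsMPSolution k p ε q Ω u

namespace Dom
variable {k p : ℝ} {q : ℝ × ℝ → ℝ} {Ω : Set (ℝ × ℝ)}

lemma hqC1 (h : Dom k p q Ω) : ContDiffOn ℝ 1 q Ω := h.hq1.of_le (by norm_num)

lemma vol_ne_top (h : Dom k p q Ω) : volume Ω ≠ ⊤ := h.hb.measure_lt_top.ne

lemma qmin (h : Dom k p q Ω) : ∃ c0 > 0, ∀ x ∈ closure Ω, c0 ≤ q x := by
  obtain ⟨x, hx, hm⟩ := h.hb.isCompact_closure.exists_isMinOn h.hne.closure h.hqc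
  exact ⟨q x, h.hq3 x hx, fun y hy => hm hy⟩

lemma qmax (h : Dom k p q Ω) : ∃ c1 > 0, ∀ x ∈ closure Ω, q x ≤ c1 := by
  obtain ⟨x, hx, hm⟩ := h.hb.isCompact_closure.exists_isMaxOn h.hne.closure h.hqc
  exact ⟨q x, h.hq3 x hx, fun y hy => hm hy⟩

end Dom

lemma log_pos' {ε : ℝ} (he : 0 < ε) (he1 : ε < 1) : 0 < Real.log (1 / ε) :=
  Real.log_pos (by rw [lt_div_iff₀ he]; linarith)

namespace Ctx
variable {k p ε : ℝ} {q u : ℝ × ℝ → ℝ} {Ω : Set (ℝ × ℝ)}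

lemma L_pos (h : Ctx k p q Ω ε u) : 0 < Real.log (1 / ε) := log_pos' h.he h.he1

lemma u_cont (h : Ctx k p q Ω ε u) : ContinuousOn u (closure Ω) := h.hs.1.1
lemma u_C2 (h : Ctx k p q Ω ε u) : ContDiffOn ℝ 2 u Ω := h.hs.1.2.1
lemma u_C1 (h : Ctx k p q Ω ε u) : ContDiffOn ℝ 1 u Ω := h.u_C2.of_le (by norm_num)
lemma u_bd (h : Ctx k p q Ω ε u) : ∀ x ∈ frontier Ω, u x = 0 := h.hs.1.2.2.1
lemma u_eq (h : Ctx k p q Ω ε u) : ∀ x ∈ Ω, LH k u x = ww p q ε u x := h.hs.1.2.2.2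
lemma u_int (h : Ctx k p q Ω ε u) : IntegrableOn (fun x => KHform k x (grad u x) (grad u x)) Ω :=
  h.hs.2.1.2.2.2
lemma u_c (h : Ctx k p q Ω ε u) : Ieps k p ε q Ω u = ceps k p q Ω ε := h.hs.2.2

lemma f_C1 (h : Ctx k p q Ω ε u) : ContDiffOn ℝ 1 (ff q ε u) Ω :=
  h.u_C1.sub (h.hqC1.mul contDiffOn_const)

lemma f_cont (h : Ctx k p q Ω ε u) : ContinuousOn (ff q ε u) Ω := h.f_C1.continuousOn

lemma f_contc (h : Ctx k p q Ω ε u) : ContinuousOn (ff q ε u) (closure Ω) :=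
  h.u_cont.sub (h.hqc.mul continuousOn_const)

lemma compU (h : Ctx k p q Ω ε u) {δ : ℝ} (hδ : 0 < δ) : IsCompact {x ∈ Ω | δ ≤ u x} :=
  compact_superlevel h.ho h.hb h.u_cont continuousOn_const (fun x hx => by rw [h.u_bd x hx]; exact hδ)

lemma compF (h : Ctx k p q Ω ε u) {δ : ℝ} (hδ : 0 ≤ δ) : IsCompact {x ∈ Ω | δ ≤ ff q ε u x} := by
  refine compact_superlevel h.ho h.hb h.f_contc continuousOn_const (fun x hx => ?_)
  unfold ff
  rw [h.u_bd x hx]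
  have := mul_pos (h.hq3 x (frontier_subset_closure hx)) h.L_pos
  linarith

lemma int_of_cont (h : Ctx k p q Ω ε u) {F : ℝ × ℝ → ℝ} (hF : ContinuousOn F Ω) {V : Set (ℝ × ℝ)}
    (hV : V ⊆ Ω) : IntegrableOn F {x ∈ V | 0 < ff q ε u x} :=
  ((hF.mono (fun x hx => hx.1)).integrableOn_compact (h.compF le_rfl)).mono_set
    (fun x hx => ⟨hV hx.1, hx.2.le⟩)

lemma w_cont (h : Ctx k p q Ω ε u) : ContinuousOn (ww p q ε u) Ω :=
  continuousOn_const.mul (maxpow_contOn h.f_cont (by linarith [h.hp]))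

lemma w_nonneg (h : Ctx k p q Ω ε u) (x : ℝ × ℝ) : 0 ≤ ww p q ε u x := by
  unfold ww
  have := h.he
  have := Real.rpow_nonneg (le_max_right (ff q ε u x) 0) p
  positivity

lemma w_zero (h : Ctx k p q Ω ε u) {x : ℝ × ℝ} (hx : ff q ε u x ≤ 0) : ww p q ε u x = 0 := by
  unfold ww
  rw [max_eq_right hx, Real.zero_rpow (by linarith [h.hp]), mul_zero]

lemma w_pos (h : Ctx k p q Ω ε u) {x : ℝ × ℝ} (hx : 0 < ff q ε u x) : 0 < ww p q ε u x := by
  unfold ww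
  rw [max_eq_left hx.le]
  have := h.he
  positivity

lemma wg_int (h : Ctx k p q Ω ε u) {g : ℝ × ℝ → ℝ} (hg : ContinuousOn g Ω) {V : Set (ℝ × ℝ)}
    (hV : V ⊆ Ω) :
    IntegrableOn (fun x => ww p q ε u x * g x) V := by
  have := (maxpow_integrableOn h.ho h.f_cont (h.compF le_rfl) (by linarith [h.hp] : 0 < p) hg).const_mul
    (1 / ε ^ 2)
  refine IntegrableOn.mono_set ?_ hV
  refine this.congr (Eventually.of_forall fun x => ?_)
  simp only [ww]; ring

lemma grad_f (h : Ctx k p q Ω ε u) {x : ℝ × ℝ} (hx : x ∈ Ω) :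
    grad (ff q ε u) x = grad u x - Real.log (1 / ε) • grad q x := by
  have d1 : DifferentiableAt ℝ u x :=
    (h.u_C1.differentiableOn one_ne_zero).differentiableAt (h.ho.mem_nhds hx)
  have d2 : DifferentiableAt ℝ q x :=
    (h.hqC1.differentiableOn one_ne_zero).differentiableAt (h.ho.mem_nhds hx)
  unfold ff
  rw [grad_sub d1 (d2.mul_const _), grad_mul_const d2]

lemma K_cont (h : Ctx k p q Ω ε u) {f g : ℝ × ℝ → ℝ} (hf : ContDiffOn ℝ 1 f Ω)
    (hg : ContDiffOn ℝ 1 g Ω) : ContinuousOn (fun x => KHform k x (grad f x) (grad g x)) Ω :=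
  KHform_continuousOn h.hk (grad_continuousOn h.ho hf) (grad_continuousOn h.ho hg)

lemma id_uf (h : Ctx k p q Ω ε u) {V : Set (ℝ × ℝ)} (hV : IsOpen V) (hVΩ : V ⊆ Ω)
    (hc : ∀ δ > 0, IsCompact {x ∈ V | δ ≤ ff q ε u x}) :
    ∫ x in {x ∈ V | 0 < ff q ε u x}, KHform k x (grad u x) (grad (ff q ε u) x) =
      ∫ x in V, ww p q ε u x * max (ff q ε u x) 0 := by
  have hm : ContinuousOn (fun x => max (ff q ε u x) 0) Ω := h.f_cont.sup continuousOn_const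
  have hcg : ∀ x ∈ V, ww p q ε u x * max (ff q ε u x) 0 = LH k u x * max (ff q ε u x) 0 :=
    fun x hx => by rw [h.u_eq x (hVΩ hx)]
  rw [limit_id h.hk hV (h.u_C2.mono hVΩ) (h.f_C1.mono hVΩ) hc
    (h.int_of_cont (h.K_cont h.u_C1 h.f_C1) hVΩ)
    ((h.wg_int hm hVΩ).congr_fun hcg hV.measurableSet)]
  exact (setIntegral_congr_fun hV.measurableSet hcg).symm

lemma id_qf (h : Ctx k p q Ω ε u) {V : Set (ℝ × ℝ)} (hV : IsOpen V) (hVΩ : V ⊆ Ω)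
    (hc : ∀ δ > 0, IsCompact {x ∈ V | δ ≤ ff q ε u x}) :
    ∫ x in {x ∈ V | 0 < ff q ε u x}, KHform k x (grad q x) (grad (ff q ε u) x) = 0 := by
  have hcg : ∀ x ∈ V, (0:ℝ) = LH k q x * max (ff q ε u x) 0 :=
    fun x hx => by rw [h.hq4 x (hVΩ hx), zero_mul]
  rw [limit_id h.hk hV (h.hq1.mono hVΩ) (h.f_C1.mono hVΩ) hc
    (h.int_of_cont (h.K_cont h.hqC1 h.f_C1) hVΩ)
    (integrableOn_zero.congr_fun hcg hV.measurableSet)]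
  rw [← setIntegral_congr_fun hV.measurableSet hcg]; simp

lemma id_ff (h : Ctx k p q Ω ε u) {V : Set (ℝ × ℝ)} (hV : IsOpen V) (hVΩ : V ⊆ Ω)
    (hc : ∀ δ > 0, IsCompact {x ∈ V | δ ≤ ff q ε u x}) :
    ∫ x in {x ∈ V | 0 < ff q ε u x}, KHform k x (grad (ff q ε u) x) (grad (ff q ε u) x) =
      ∫ x in V, ww p q ε u x * max (ff q ε u x) 0 := by
  have hm : MeasurableSet {x ∈ V | 0 < ff q ε u x} :=
    (isOpen_pos hV (h.f_cont.mono hVΩ)).measurableSet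
  have e : ∀ x ∈ {x ∈ V | 0 < ff q ε u x}, KHform k x (grad (ff q ε u) x) (grad (ff q ε u) x) =
      KHform k x (grad u x) (grad (ff q ε u) x) -
        Real.log (1 / ε) * KHform k x (grad q x) (grad (ff q ε u) x) := by
    intro x hx
    conv_lhs => rw [h.grad_f (hVΩ hx.1), KHform_sub_left, KHform_smul_left]
    rw [h.grad_f (hVΩ hx.1)]
  rw [setIntegral_congr_fun hm e, integral_sub (h.int_of_cont (h.K_cont h.u_C1 h.f_C1) hVΩ)
    ((h.int_of_cont (h.K_cont h.hqC1 h.f_C1) hVΩ).const_mul _), integral_const_mul,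
    h.id_uf hV hVΩ hc, h.id_qf hV hVΩ hc]
  ring

/-- `∫ w q`. -/
def MM (p : ℝ) (q : ℝ × ℝ → ℝ) (Ω : Set (ℝ × ℝ)) (ε : ℝ) (u : ℝ × ℝ → ℝ) : ℝ :=
  ∫ x in Ω, ww p q ε u x * q x

/-- `∫ w v`. -/
def EE (p : ℝ) (q : ℝ × ℝ → ℝ) (V : Set (ℝ × ℝ)) (ε : ℝ) (u : ℝ × ℝ → ℝ) : ℝ :=
  ∫ x in V, ww p q ε u x * max (ff q ε u x) 0

lemma u_pos (h : Ctx k p q Ω ε u) {x : ℝ × ℝ} (hx : x ∈ Ω) (hf : 0 < ff q ε u x) : 0 < u x := by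
  have := mul_pos (h.hq3 x (subset_closure hx)) h.L_pos
  unfold ff at hf; linarith

lemma wu_split (h : Ctx k p q Ω ε u) :
    ∫ x in Ω, ww p q ε u x * max (u x) 0 = EE p q Ω ε u + Real.log (1 / ε) * MM p q Ω ε u := by
  unfold EE MM
  rw [← integral_const_mul, ← integral_add (h.wg_int (h.f_cont.sup continuousOn_const) subset_rfl)
    ((h.wg_int h.hqC1.continuousOn subset_rfl).const_mul _)]
  apply setIntegral_congr_fun h.ho.measurableSet
  intro x hx
  simp only
  rcases le_or_gt (ff q ε u x) 0 with hf | hf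
  · rw [h.w_zero hf]; ring
  · rw [max_eq_left hf.le, max_eq_left (h.u_pos hx hf).le]
    unfold ff; ring

lemma id_u (h : Ctx k p q Ω ε u) :
    ∫ x in {x ∈ Ω | 0 < u x}, KHform k x (grad u x) (grad u x) =
      EE p q Ω ε u + Real.log (1 / ε) * MM p q Ω ε u := by
  have hcg : ∀ x ∈ Ω, ww p q ε u x * max (u x) 0 = LH k u x * max (u x) 0 :=
    fun x hx => by rw [h.u_eq x hx]
  rw [← h.wu_split, limit_id h.hk h.ho h.u_C2 h.u_C1 (fun δ hδ => h.compU hδ)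
    (h.u_int.mono_set (fun x hx => hx.1)) ((h.wg_int (h.u_C1.continuousOn.sup continuousOn_const)
      subset_rfl).congr_fun hcg h.ho.measurableSet)]
  exact (setIntegral_congr_fun h.ho.measurableSet hcg).symm

lemma EE_pow (h : Ctx k p q Ω ε u) {V : Set (ℝ × ℝ)} :
    EE p q V ε u = (1 / ε ^ 2) * ∫ x in V, (max (ff q ε u x) 0) ^ (p + 1) := by
  unfold EE
  rw [← integral_const_mul]
  congr 1; ext x
  unfold ww
  rcases le_or_gt (ff q ε u x) 0 with hf | hf
  · rw [max_eq_right hf, Real.zero_rpow (by linarith [h.hp]), Real.zero_rpow (by linarith [h.hp])]; ring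
  · rw [max_eq_left hf.le, Real.rpow_add hf, Real.rpow_one]; ring

lemma EE_nonneg (h : Ctx k p q Ω ε u) (V : Set (ℝ × ℝ)) : 0 ≤ EE p q V ε u :=
  integral_nonneg fun x => mul_nonneg (h.w_nonneg x) (le_max_right _ _)

lemma MM_nonneg (h : Ctx k p q Ω ε u) : 0 ≤ MM p q Ω ε u :=
  setIntegral_nonneg h.ho.measurableSet fun x hx => mul_nonneg (h.w_nonneg x)
    (h.hq3 x (subset_closure hx)).le

/-- energy lower bound -/
lemma c_ge (h : Ctx k p q Ω ε u) :
    Real.log (1 / ε) * MM p q Ω ε u / 2 + (1 / 2 - 1 / (p + 1)) * EE p q Ω ε u ≤ ceps k p q Ω ε := by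
  rw [← h.u_c]
  have h1 : ∫ x in {x ∈ Ω | 0 < u x}, KHform k x (grad u x) (grad u x) ≤
      ∫ x in Ω, KHform k x (grad u x) (grad u x) :=
    setIntegral_mono_set h.u_int (Eventually.of_forall fun x => KHform_nonneg h.hk _ _)
      (HasSubset.Subset.eventuallyLE (fun x hx => hx.1))
  rw [h.id_u] at h1
  have h2 : (1 / ((p + 1) * ε ^ 2)) * ∫ x in Ω, pPart (u x - q x * Real.log (1 / ε)) ^ (p + 1) =
      1 / (p + 1) * EE p q Ω ε u := by
    rw [h.EE_pow]
    have : 1 / ((p + 1) * ε ^ 2) = 1 / (p + 1) * (1 / ε ^ 2) := by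
      rw [one_div_mul_one_div]
    rw [this, mul_assoc]; rfl
  unfold Ieps
  rw [h2]
  linarith

lemma c_ge' (h : Ctx k p q Ω ε u) : Real.log (1 / ε) * MM p q Ω ε u / 2 ≤ ceps k p q Ω ε := by
  have h1 := h.c_ge
  have h2 : 0 ≤ (1 / 2 - 1 / (p + 1)) := by
    rw [sub_nonneg]
    apply one_div_le_one_div_of_le (by norm_num); linarith [h.hp]
  have := mul_nonneg h2 (h.EE_nonneg Ω)
  linarith

end Ctx
end

/- Part 6 -/
noncomputable section

/-- The set defining `ceps`. -/
def cset (k p : ℝ) (q : ℝ × ℝ → ℝ) (Ω : Set (ℝ × ℝ)) (ε : ℝ) : Set ℝ :=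
  {c | ∃ γ : ℝ → ℝ × ℝ → ℝ,
    (∀ t ∈ Icc (0:ℝ) 1, MemH k Ω (γ t)) ∧
    (∀ t ∈ Icc (0:ℝ) 1, ∀ δ > 0, ∃ η > 0, ∀ s ∈ Icc (0:ℝ) 1, |s - t| < η →
      (∫ x in Ω, KHform k x (grad (fun y => γ s y - γ t y) x)
        (grad (fun y => γ s y - γ t y) x)) < δ) ∧
    γ 0 = (fun _ => 0) ∧ Ieps k p ε q Ω (γ 1) < 0 ∧
    c = sSup ((fun t => Ieps k p ε q Ω (γ t)) '' Icc (0:ℝ) 1)}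

lemma ceps_eq (k p : ℝ) (q : ℝ × ℝ → ℝ) (Ω : Set (ℝ × ℝ)) (ε : ℝ) :
    ceps k p q Ω ε = sInf (cset k p q Ω ε) := rfl

section
variable {k p : ℝ} {q : ℝ × ℝ → ℝ} {Ω : Set (ℝ × ℝ)}

lemma Ieps_le (h : Dom k p q Ω) {ε : ℝ} (he : 0 < ε) (φ : ℝ × ℝ → ℝ) :
    Ieps k p ε q Ω φ ≤ 1 / 2 * En k Ω φ φ := by
  unfold Ieps En
  have h1 : 0 ≤ ∫ x in Ω, pPart (φ x - q x * Real.log (1 / ε)) ^ (p + 1) :=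
    integral_nonneg fun x => Real.rpow_nonneg (le_max_right _ _) _
  have h2 : 0 ≤ 1 / ((p + 1) * ε ^ 2) := by have := h.hp; positivity
  have := mul_nonneg h2 h1
  linarith

lemma Ieps_zero (h : Dom k p q Ω) {ε : ℝ} (he : 0 < ε) (he1 : ε < 1) :
    Ieps k p ε q Ω (fun _ => 0) = 0 := by
  unfold Ieps
  have e1 : ∫ x in Ω, KHform k x (grad (fun _ => (0:ℝ)) x) (grad (fun _ => (0:ℝ)) x) = 0 := by
    have : ∀ x, grad (fun _ : ℝ × ℝ => (0:ℝ)) x = 0 := fun x => by unfold grad; simp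
    simp [this, KHform_zero_left]
  have e2 : ∫ x in Ω, pPart (0 - q x * Real.log (1 / ε)) ^ (p + 1) = 0 := by
    rw [setIntegral_congr_fun h.ho.measurableSet (g := fun _ => (0:ℝ)) ?_]
    · simp
    · intro x hx
      have := mul_pos (h.hq3 x (subset_closure hx)) (log_pos' he he1)
      simp only [pPart]
      rw [max_eq_right (by linarith), Real.zero_rpow (by linarith [h.hp])]
  rw [e1, e2]; simp

lemma cset_nonneg (h : Dom k p q Ω) {ε : ℝ} (he : 0 < ε) (he1 : ε < 1) :
    ∀ c ∈ cset k p q Ω ε, 0 ≤ c := by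
  rintro c ⟨γ, -, -, h0, -, rfl⟩
  by_cases hb : BddAbove ((fun t => Ieps k p ε q Ω (γ t)) '' Icc (0:ℝ) 1)
  · refine le_csSup hb ⟨0, by simp, ?_⟩
    simp only [h0]; exact Ieps_zero h he he1
  · rw [Real.sSup_of_not_bddAbove hb]

lemma En_comb {k : ℝ} (hk : 0 < k) {a b : ℝ × ℝ → ℝ} (ha : TestFn Ω a) (hb : TestFn Ω b) (s t : ℝ) :
    En k Ω (fun y => s * a y + t * b y) (fun y => s * a y + t * b y) =
      s ^ 2 * En k Ω a a + 2 * s * t * En k Ω a b + t ^ 2 * En k Ω b b := by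
  unfold En
  have e : ∀ x, KHform k x (grad (fun y => s * a y + t * b y) x) (grad (fun y => s * a y + t * b y) x) =
      (s ^ 2 * KHform k x (grad a x) (grad a x) + 2 * s * t * KHform k x (grad a x) (grad b x)) +
        t ^ 2 * KHform k x (grad b x) (grad b x) := by
    intro x
    rw [grad_add ((ha.diff x).const_mul s) ((hb.diff x).const_mul t), grad_const_mul (ha.diff x),
      grad_const_mul (hb.diff x)]
    simp only [KHform_add_left, KHform_add_right, KHform_smul_left, KHform_smul_right]
    rw [KHform_comm k x (grad b x) (grad a x)]; ring
  simp_rw [e]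
  have i1 := ((ha.integrable_form hk ha).integrableOn (s := Ω)).const_mul (s ^ 2)
  have i2 := ((ha.integrable_form hk hb).integrableOn (s := Ω)).const_mul (2 * s * t)
  have i3 := ((hb.integrable_form hk hb).integrableOn (s := Ω)).const_mul (t ^ 2)
  have i4 : IntegrableOn (fun x => s ^ 2 * KHform k x (grad a x) (grad a x) +
    2 * s * t * KHform k x (grad a x) (grad b x)) Ω := i1.add i2
  rw [integral_add i4 i3, integral_add i1 i2, integral_const_mul, integral_const_mul,
    integral_const_mul]

lemma path_bound (h : Dom k p q Ω) {ε : ℝ} (he : 0 < ε) (he1 : ε < 1)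
    {a b : ℝ × ℝ → ℝ} (ha : TestFn Ω a) (hb : TestFn Ω b) {α β : ℝ → ℝ} (hα : Continuous α)
    (hβ : Continuous β) (hα0 : α 0 = 0) (hβ0 : β 0 = 0) {B : ℝ}
    (hneg : Ieps k p ε q Ω (fun y => α 1 * a y + β 1 * b y) < 0)
    (hB : ∀ t ∈ Icc (0:ℝ) 1, Ieps k p ε q Ω (fun y => α t * a y + β t * b y) ≤ B) :
    (cset k p q Ω ε).Nonempty ∧ ceps k p q Ω ε ≤ B := by
  have hmem : sSup ((fun t => Ieps k p ε q Ω (fun y => α t * a y + β t * b y)) '' Icc (0:ℝ) 1) ∈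
      cset k p q Ω ε := by
    refine ⟨fun t y => α t * a y + β t * b y, ?_, ?_, ?_, hneg, rfl⟩
    · intro t _
      exact ((ha.const_mul _).add (hb.const_mul _)).memH h.hk h.ho
    · intro t _ δ hδ
      have hcont : Continuous (fun s => (α s - α t) ^ 2 * En k Ω a a +
          2 * (α s - α t) * (β s - β t) * En k Ω a b + (β s - β t) ^ 2 * En k Ω b b) := by fun_prop
      have h0 := hcont.continuousAt (x := t)
      rw [Metric.continuousAt_iff] at h0
      obtain ⟨η, hη, h1⟩ := h0 δ hδ
      refine ⟨η, hη, fun s _ hs => ?_⟩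
      have h2 := h1 (x := s) (by rw [Real.dist_eq]; exact hs)
      rw [Real.dist_eq] at h2
      simp only [sub_self] at h2
      have e : (fun y => (α s * a y + β s * b y) - (α t * a y + β t * b y)) =
          fun y => (α s - α t) * a y + (β s - β t) * b y := by ext y; ring
      simp only [e]
      change En k Ω _ _ < δ
      rw [En_comb h.hk ha hb]
      have := (abs_lt.mp h2).2
      linarith
    · ext y; simp [hα0, hβ0]
  refine ⟨⟨_, hmem⟩, ?_⟩
  rw [ceps_eq]
  refine (csInf_le ⟨0, fun c hc => cset_nonneg h he he1 c hc⟩ hmem).trans ?_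
  apply csSup_le ((nonempty_Icc.mpr zero_le_one).image _)
  rintro _ ⟨t, ht, rfl⟩
  exact hB t ht

lemma ray_bound (h : Dom k p q Ω) {ε : ℝ} (he : 0 < ε) (he1 : ε < 1)
    {φ : ℝ × ℝ → ℝ} (hφ : TestFn Ω φ) (hneg : Ieps k p ε q Ω φ < 0) :
    (cset k p q Ω ε).Nonempty ∧ ceps k p q Ω ε ≤ 1 / 2 * En k Ω φ φ := by
  refine path_bound h he he1 hφ hφ (α := fun t => t) (β := fun _ => 0) continuous_id continuous_const
    rfl rfl ?_ ?_
  · simpa using hneg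
  · intro t ht
    refine (Ieps_le h he _).trans ?_
    rw [En_comb h.hk hφ hφ]
    have h0 : 0 ≤ En k Ω φ φ := integral_nonneg fun x => KHform_nonneg h.hk _ _
    have : t ^ 2 ≤ 1 := pow_le_one₀ ht.1 ht.2
    nlinarith

lemma memH_diff {k : ℝ} (ho : IsOpen Ω) {u : ℝ × ℝ → ℝ} (hu : MemH k Ω u) {x : ℝ × ℝ} (hx : x ∈ Ω) :
    DifferentiableAt ℝ u x :=
  (hu.2.1.differentiableOn one_ne_zero).differentiableAt (ho.mem_nhds hx)

/-- Small-energy lower bound. -/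
lemma Ieps_small (h : Dom k p q Ω) {ε : ℝ} (he : 0 < ε) (he1 : ε < 1) :
    ∃ N0 > 0, ∀ φ, MemH k Ω φ → En k Ω φ φ ≤ N0 → En k Ω φ φ / 4 ≤ Ieps k p ε q Ω φ := by
  obtain ⟨C, hC, hS⟩ := sob_weighted h.hk h.hb
  obtain ⟨c0, hc0, hc0q⟩ := h.qmin
  have hp := h.hp
  have hL := log_pos' he he1
  set L := Real.log (1 / ε) with hLdef
  set m := volume.real Ω with hm
  have hm0 : 0 ≤ m := measureReal_nonneg
  -- X ≤ D N X^{(p-1)/(p+1)}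
  set D := C * ((p + 1) / 2) ^ 2 * m ^ (2 / (p + 1)) with hD
  have hD0 : 0 ≤ D := by positivity
  have key : ∀ φ, MemH k Ω φ → ∫ x in Ω, pPart (φ x - q x * L) ^ (p + 1) ≤
      (D * En k Ω φ φ) ^ ((p + 1) / 2) := by
    intro φ hφ
    set f := fun x => φ x - c0 * L with hf
    have hfC : ContDiffOn ℝ 1 f Ω := hφ.2.1.sub contDiffOn_const
    have hfcc : IsCompact {x ∈ Ω | 0 ≤ f x} := by
      have := compact_superlevel h.ho h.hb hφ.1 (continuousOn_const (c := c0 * L)) (fun x hx => by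
        rw [hφ.2.2.1 x hx]; positivity)
      simpa [hf, sub_nonneg] using this
    have hgf : ∀ x ∈ Ω, grad f x = grad φ x := fun x hx => by
      unfold grad; rw [hf, fderiv_sub_const]
    have hsub : {x ∈ Ω | 0 < f x} ⊆ Ω := fun x hx => hx.1
    have hms : MeasurableSet {x ∈ Ω | 0 < f x} := (isOpen_pos h.ho hfC.continuousOn).measurableSet
    have hi : IntegrableOn (fun x => KHform k x (grad f x) (grad f x)) {x ∈ Ω | 0 < f x} :=
      (hφ.2.2.2.mono_set hsub).congr_fun (fun x hx => by simp only; rw [hgf x hx.1]) hms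
    have h1 := hS Ω subset_rfl h.ho f hfC hfcc ((p + 1) / 2) (by linarith) hi
    have e1 : 2 * ((p + 1) / 2) = p + 1 := by ring
    have e2 : p + 1 - 2 = p - 1 := by ring
    rw [e1, e2] at h1
    set X := ∫ x in Ω, (max (f x) 0) ^ (p + 1) with hX
    have hX0 : 0 ≤ X := integral_nonneg fun x => Real.rpow_nonneg (le_max_right _ _) _
    have hN : ∫ x in {x ∈ Ω | 0 < f x}, KHform k x (grad f x) (grad f x) ≤ En k Ω φ φ := by
      rw [setIntegral_congr_fun hms (g := fun x => KHform k x (grad φ x) (grad φ x))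
        (fun x hx => by simp only; rw [hgf x hx.1])]
      exact setIntegral_mono_set hφ.2.2.2 (Eventually.of_forall fun x => KHform_nonneg h.hk _ _)
        (LE.le.eventuallyLE hsub)
    have hE0 : 0 ≤ En k Ω φ φ := integral_nonneg fun x => KHform_nonneg h.hk _ _
    have h2 := holder_pow h.vol_ne_top (v := fun x => max (f x) 0) (fun x => le_max_right _ _)
      (a := p - 1) (b := p + 1) (by linarith) (by linarith)
      ((hfC.continuousOn.sup continuousOn_const).aestronglyMeasurable h.ho.measurableSet)
      (maxpow_integrableOn' h.ho hfC.continuousOn hfcc (by linarith))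
    have e3 : 1 - (p - 1) / (p + 1) = 2 / (p + 1) := by field_simp; ring
    rw [e3, ← hX, ← hm] at h2
    have h3 : X ≤ D * En k Ω φ φ * X ^ ((p - 1) / (p + 1)) := by
      calc X ≤ _ := h1
        _ ≤ C * ((p + 1) / 2) ^ 2 * (X ^ ((p - 1) / (p + 1)) * m ^ (2 / (p + 1))) * En k Ω φ φ := by
          exact mul_le_mul (mul_le_mul_of_nonneg_left h2 (by positivity)) hN
            (integral_nonneg fun x => KHform_nonneg h.hk _ _) (by positivity)
        _ = _ := by rw [hD]; ring
    have h4 : X ≤ (D * En k Ω φ φ) ^ ((p + 1) / 2) := by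
      rcases hX0.eq_or_lt with h0 | hXp
      · rw [← h0]; positivity
      · have h5 : X ^ (2 / (p + 1)) ≤ D * En k Ω φ φ := by
          have : X = X ^ (2 / (p + 1)) * X ^ ((p - 1) / (p + 1)) := by
            rw [← Real.rpow_add hXp]
            have : 2 / (p + 1) + (p - 1) / (p + 1) = 1 := by field_simp; ring
            rw [this, Real.rpow_one]
          have hpos : 0 < X ^ ((p - 1) / (p + 1)) := Real.rpow_pos_of_pos hXp _
          rw [this] at h3
          have h6 : X ^ (2 / (p + 1)) * X ^ ((p - 1) / (p + 1)) ≤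
              D * En k Ω φ φ * X ^ ((p - 1) / (p + 1)) := by rwa [← this] at h3 ⊢
          exact le_of_mul_le_mul_right h6 hpos
        calc X = (X ^ (2 / (p + 1))) ^ ((p + 1) / 2) := by
              rw [← Real.rpow_mul hX0]
              have : 2 / (p + 1) * ((p + 1) / 2) = 1 := by field_simp
              rw [this, Real.rpow_one]
          _ ≤ _ := Real.rpow_le_rpow (by positivity) h5 (by positivity)
    refine le_trans ?_ h4
    have hi3 := maxpow_integrableOn' h.ho hfC.continuousOn hfcc (s := p + 1) (by linarith)
    have hle : ∀ x ∈ Ω, pPart (φ x - q x * L) ^ (p + 1) ≤ (max (f x) 0) ^ (p + 1) := by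
      intro x hx
      apply Real.rpow_le_rpow (le_max_right _ _) _ (by linarith)
      apply max_le_max_right
      simp only [hf]
      have := hc0q x (subset_closure hx)
      nlinarith
    apply setIntegral_mono_on _ hi3 h.ho.measurableSet hle
    refine Integrable.mono' hi3 ?_ ?_
    · exact (maxpow_contOn (f := fun x => φ x - q x * L) (hφ.2.1.continuousOn.sub
        (h.hqC1.continuousOn.mul continuousOn_const)) (by linarith)).aestronglyMeasurable
          h.ho.measurableSet
    · refine (ae_restrict_iff' h.ho.measurableSet).mpr (Eventually.of_forall fun x hx => ?_)
      have h0 : 0 ≤ pPart (φ x - q x * L) ^ (p + 1) := Real.rpow_nonneg (le_max_right _ _) _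
      rw [Real.norm_of_nonneg h0]
      exact hle x hx
  -- choose N0
  set c1 := 1 / ((p + 1) * ε ^ 2) with hc1
  have hc10 : 0 < c1 := by positivity
  have ht : Tendsto (fun N : ℝ => c1 * D ^ ((p + 1) / 2) * N ^ ((p - 1) / 2)) (𝓝 0)
      (𝓝 (c1 * D ^ ((p + 1) / 2) * 0 ^ ((p - 1) / 2))) :=
    ((Real.continuous_rpow_const (by linarith)).tendsto 0).const_mul _
  rw [Real.zero_rpow (by linarith), mul_zero] at ht
  obtain ⟨N0, hN0, hN⟩ := Metric.eventually_nhds_iff.mp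
    (ht.eventually (gt_mem_nhds (by norm_num : (0:ℝ) < 1 / 4)))
  refine ⟨N0 / 2, by positivity, fun φ hφ hE => ?_⟩
  have hE0 : 0 ≤ En k Ω φ φ := integral_nonneg fun x => KHform_nonneg h.hk _ _
  have h1 := hN (y := En k Ω φ φ) (by rw [Real.dist_eq, sub_zero, abs_of_nonneg hE0]; linarith)
  have h2 := key φ hφ
  have h3 : (D * En k Ω φ φ) ^ ((p + 1) / 2) =
      D ^ ((p + 1) / 2) * En k Ω φ φ ^ ((p - 1) / 2) * En k Ω φ φ := by
    rw [Real.mul_rpow hD0 hE0, mul_assoc]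
    congr 1
    have : (p + 1) / 2 = (p - 1) / 2 + 1 := by ring
    rw [this, Real.rpow_add_one' hE0 (by linarith)]
  have h4 : Ieps k p ε q Ω φ = 1 / 2 * En k Ω φ φ -
    c1 * ∫ x in Ω, pPart (φ x - q x * L) ^ (p + 1) := rfl
  rw [h4]
  have h5 : c1 * ∫ x in Ω, pPart (φ x - q x * L) ^ (p + 1) ≤ 1 / 4 * En k Ω φ φ := by
    calc _ ≤ c1 * (D ^ ((p + 1) / 2) * En k Ω φ φ ^ ((p - 1) / 2) * En k Ω φ φ) := by
          rw [← h3]; gcongr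
      _ = c1 * D ^ ((p + 1) / 2) * En k Ω φ φ ^ ((p - 1) / 2) * En k Ω φ φ := by ring
      _ ≤ _ := by gcongr
  linarith

end
end

/- Part 7 -/
noncomputable section
section
variable {k p : ℝ} {q : ℝ × ℝ → ℝ} {Ω : Set (ℝ × ℝ)}

lemma memH_int (hk : 0 < k) (ho : IsOpen Ω) {a b : ℝ × ℝ → ℝ} (ha : MemH k Ω a) (hb : MemH k Ω b) :
    IntegrableOn (fun x => KHform k x (grad a x) (grad b x)) Ω := by
  refine Integrable.mono' (ha.2.2.2.add hb.2.2.2) ((KHform_continuousOn hk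
    (grad_continuousOn ho ha.2.1) (grad_continuousOn ho hb.2.1)).aestronglyMeasurable ho.measurableSet)
    (Eventually.of_forall fun x => ?_)
  exact KHform_abs_le hk _ _ _

lemma memH_sub (hk : 0 < k) (ho : IsOpen Ω) {a b : ℝ × ℝ → ℝ} (ha : MemH k Ω a) (hb : MemH k Ω b) :
    MemH k Ω (fun x => a x - b x) := by
  refine ⟨ha.1.sub hb.1, ha.2.1.sub hb.2.1, fun x hx => by
    simp only [ha.2.2.1 x hx, hb.2.2.1 x hx, sub_zero],
    ?_⟩
  have : IntegrableOn (fun x => KHform k x (grad a x) (grad a x) - 2 * KHform k x (grad a x) (grad b x)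
    + KHform k x (grad b x) (grad b x)) Ω :=
    (ha.2.2.2.sub ((memH_int hk ho ha hb).const_mul 2)).add hb.2.2.2
  refine this.congr_fun (fun x hx => ?_) ho.measurableSet
  simp only
  rw [grad_sub (memH_diff ho ha hx) (memH_diff ho hb hx)]
  simp only [KHform_sub_left, KHform_sub_right]
  rw [KHform_comm k x (grad b x) (grad a x)]; ring

lemma En_split (hk : 0 < k) (ho : IsOpen Ω) {a b : ℝ × ℝ → ℝ} (ha : MemH k Ω a) (hb : MemH k Ω b) :
    |En k Ω a a - En k Ω b b| ≤ En k Ω (fun x => a x - b x) (fun x => a x - b x) +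
      2 * √(En k Ω (fun x => a x - b x) (fun x => a x - b x) * En k Ω b b) := by
  have hd := memH_sub hk ho ha hb
  have hcs := cauchy_schwarz_K hk hd.2.2.2 hb.2.2.2 (memH_int hk ho hd hb)
  have h1 : |∫ x in Ω, KHform k x (grad (fun x => a x - b x) x) (grad b x)| ≤
      √(En k Ω (fun x => a x - b x) (fun x => a x - b x) * En k Ω b b) :=
    Real.abs_le_sqrt hcs
  have h2 : En k Ω a a - En k Ω b b = En k Ω (fun x => a x - b x) (fun x => a x - b x) +
      2 * ∫ x in Ω, KHform k x (grad (fun x => a x - b x) x) (grad b x) := by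
    unfold En
    rw [← integral_sub ha.2.2.2 hb.2.2.2, ← integral_const_mul,
      ← integral_add hd.2.2.2 ((memH_int hk ho hd hb).const_mul 2)]
    apply setIntegral_congr_fun ho.measurableSet
    intro x hx
    simp only
    rw [grad_sub (memH_diff ho ha hx) (memH_diff ho hb hx)]
    simp only [KHform_sub_left, KHform_sub_right]
    rw [KHform_comm k x (grad b x) (grad a x)]; ring
  have h0 : 0 ≤ En k Ω (fun x => a x - b x) (fun x => a x - b x) :=
    integral_nonneg fun x => KHform_nonneg hk _ _
  rw [h2]
  refine (abs_add_le _ _).trans ?_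
  rw [abs_of_nonneg h0, abs_mul, abs_of_pos (by norm_num : (0:ℝ) < 2)]
  linarith

lemma c_pos (h : Dom k p q Ω) {ε : ℝ} (he : 0 < ε) (he1 : ε < 1) (hne : (cset k p q Ω ε).Nonempty) :
    0 < ceps k p q Ω ε := by
  obtain ⟨N0, hN0, hN⟩ := Ieps_small h he he1
  suffices ∀ c ∈ cset k p q Ω ε, N0 / 4 ≤ c by
    rw [ceps_eq]
    have := le_csInf hne this
    linarith
  rintro c ⟨γ, hγ, hcont, h0, hneg, rfl⟩
  set N := fun t => En k Ω (γ t) (γ t) with hNdef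
  have hNn : ∀ t, 0 ≤ N t := fun t => integral_nonneg fun x => KHform_nonneg h.hk _ _
  have hNc : ContinuousOn N (Icc 0 1) := by
    intro t ht
    have ht0 : Tendsto (fun s => En k Ω (fun x => γ s x - γ t x) (fun x => γ s x - γ t x))
        (𝓝[Icc 0 1] t) (𝓝 0) := by
      rw [Metric.tendsto_nhdsWithin_nhds]
      intro δ hδ
      obtain ⟨η, hη, h1⟩ := hcont t ht δ hδ
      refine ⟨η, hη, fun {s} hs hd => ?_⟩
      have hn : 0 ≤ En k Ω (fun x => γ s x - γ t x) (fun x => γ s x - γ t x) :=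
        integral_nonneg fun x => KHform_nonneg h.hk _ _
      rw [Real.dist_eq, sub_zero, abs_of_nonneg hn]
      exact h1 s hs hd
    have hb : Tendsto (fun s => En k Ω (fun x => γ s x - γ t x) (fun x => γ s x - γ t x) +
        2 * √(En k Ω (fun x => γ s x - γ t x) (fun x => γ s x - γ t x) * N t))
        (𝓝[Icc 0 1] t) (𝓝 (0 + 2 * √(0 * N t))) :=
      ht0.add ((Real.continuous_sqrt.continuousAt.tendsto.comp (ht0.mul_const _)).const_mul 2)
    simp only [zero_mul, Real.sqrt_zero, mul_zero, add_zero] at hb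
    rw [ContinuousWithinAt, tendsto_iff_dist_tendsto_zero]
    refine squeeze_zero' (Eventually.of_forall fun s => dist_nonneg) ?_ hb
    filter_upwards [self_mem_nhdsWithin] with s hs
    rw [Real.dist_eq]
    exact En_split h.hk h.ho (hγ s hs) (hγ t ht)
  have hN00 : N 0 = 0 := by
    have : ∀ x, grad (fun _ : ℝ × ℝ => (0:ℝ)) x = 0 := fun x => by unfold grad; simp
    simp [hNdef, h0, En, this, KHform_zero_left]
  have hN1 : N0 < N 1 := by
    by_contra hc
    have := hN (γ 1) (hγ 1 (by simp)) (not_lt.mp hc)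
    have := hNn 1
    simp only [hNdef] at this
    linarith
  obtain ⟨t, ht, htN⟩ := intermediate_value_Icc zero_le_one hNc
    (show N0 ∈ Icc (N 0) (N 1) from ⟨by rw [hN00]; exact hN0.le, hN1.le⟩)
  have hb : BddAbove ((fun t => Ieps k p ε q Ω (γ t)) '' Icc (0:ℝ) 1) := by
    obtain ⟨B, hB⟩ := (isCompact_Icc.bddAbove_image hNc)
    refine ⟨1 / 2 * B, ?_⟩
    rintro _ ⟨s, hs, rfl⟩
    have h1 := Ieps_le h he (γ s)
    have h2 : N s ≤ B := hB ⟨s, hs, rfl⟩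
    simp only [hNdef] at h2
    simp only
    linarith
  have h3 := hN (γ t) (hγ t ht) htN.le
  have h4 : En k Ω (γ t) (γ t) = N0 := htN
  rw [h4] at h3
  exact h3.trans (le_csSup hb ⟨t, ht, rfl⟩)

namespace Ctx
variable {ε : ℝ} {u : ℝ × ℝ → ℝ}

lemma vol_pos (h : Ctx k p q Ω ε u) : 0 < volume.real Ω := by
  have := h.ho.measure_pos volume h.hne
  exact ENNReal.toReal_pos this.ne' h.vol_ne_top

/-- zero gradient on the positive set forces nonpositivity -/
lemma nonpos_of_En (h : Ctx k p q Ω ε u) {g : ℝ × ℝ → ℝ} (hg : ContDiffOn ℝ 1 g Ω)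
    (hc : ∀ δ > 0, IsCompact {x ∈ Ω | δ ≤ g x})
    (hi : IntegrableOn (fun x => KHform k x (grad g x) (grad g x)) Ω)
    (h0 : ∫ x in {x ∈ Ω | 0 < g x}, KHform k x (grad g x) (grad g x) ≤ 0) :
    ∀ x ∈ Ω, g x ≤ 0 := by
  obtain ⟨C, hC, hS⟩ := sob_weighted h.hk h.hb
  by_contra hx
  push Not at hx
  obtain ⟨x, hx, hgx⟩ := hx
  set δ := g x / 2 with hδ
  have hδ0 : 0 < δ := by positivity
  set f := fun y => g y - δ with hf
  have hfC : ContDiffOn ℝ 1 f Ω := hg.sub contDiffOn_const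
  have hfc : IsCompact {x ∈ Ω | 0 ≤ f x} := by
    have := hc δ hδ0
    simpa [hf, sub_nonneg] using this
  have hgf : ∀ x, grad f x = grad g x := fun x => by
    unfold grad; rw [hf, fderiv_sub_const]
  have hsub : {x ∈ Ω | 0 < f x} ⊆ {x ∈ Ω | 0 < g x} := fun y hy => ⟨hy.1, by
    have := hy.2; simp only [hf] at this; linarith⟩
  have h1 := hS Ω subset_rfl h.ho f hfC hfc 2 (by norm_num)
    (by simp_rw [hgf]; exact hi.mono_set (fun y hy => hy.1))
  simp_rw [hgf] at h1
  have h2 : ∫ x in {x ∈ Ω | 0 < f x}, KHform k x (grad g x) (grad g x) ≤ 0 :=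
    (setIntegral_mono_set (hi.mono_set (fun y hy => hy.1))
      (Eventually.of_forall fun x => KHform_nonneg h.hk _ _) (LE.le.eventuallyLE hsub)).trans h0
  have h3 : 0 ≤ ∫ x in Ω, (max (f x) 0) ^ ((2:ℝ) * 2 - 2) :=
    integral_nonneg fun x => Real.rpow_nonneg (le_max_right _ _) _
  have h4 : ∫ x in Ω, (max (f x) 0) ^ ((2:ℝ) * 2) ≤ 0 :=
    h1.trans (mul_nonpos_of_nonneg_of_nonpos (by positivity) h2)
  have h5 : 0 < ∫ x in Ω, (max (f x) 0) ^ ((2:ℝ) * 2) := by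
    have hii := maxpow_integrableOn' h.ho hfC.continuousOn hfc (s := (2:ℝ) * 2) (by norm_num)
    rw [setIntegral_pos_iff_support_of_nonneg_ae
      (Eventually.of_forall fun x => Real.rpow_nonneg (le_max_right _ _) _) hii]
    have ho : IsOpen {y ∈ Ω | 0 < f y} := isOpen_pos h.ho hfC.continuousOn
    refine lt_of_lt_of_le (ho.measure_pos volume ⟨x, hx, ?_⟩) (measure_mono ?_)
    · simp only [hf]; linarith
    · intro y hy
      refine ⟨?_, hy.1⟩
      rw [Function.mem_support, max_eq_left hy.2.le]
      exact (Real.rpow_pos_of_pos hy.2 _).ne'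
  linarith

lemma core_nonempty (h : Ctx k p q Ω ε u) (hne : (cset k p q Ω ε).Nonempty) :
    ∃ x ∈ Ω, 0 < ff q ε u x := by
  by_contra hA
  push Not at hA
  have hE : EE p q Ω ε u = 0 := by
    unfold EE
    rw [setIntegral_congr_fun h.ho.measurableSet (g := fun _ => (0:ℝ))
      (fun x hx => by simp only; rw [h.w_zero (hA x hx), zero_mul])]
    simp
  have hM : MM p q Ω ε u = 0 := by
    unfold MM
    rw [setIntegral_congr_fun h.ho.measurableSet (g := fun _ => (0:ℝ))
      (fun x hx => by simp only; rw [h.w_zero (hA x hx), zero_mul])]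
    simp
  have h1 := h.id_u
  rw [hE, hM] at h1
  have hle : ∀ x ∈ Ω, u x ≤ 0 := h.nonpos_of_En h.u_C1 (fun δ hδ => h.compU hδ) h.u_int (by rw [h1]; simp)
  -- negative part
  have hC : ∀ δ > 0, IsCompact {x ∈ Ω | δ ≤ -u x} := fun δ hδ =>
    compact_superlevel h.ho h.hb h.u_cont.neg continuousOn_const
      (fun x hx => by rw [h.u_bd x hx]; simpa using hδ)
  have hgn : ∀ x, grad (fun y => -u y) x = (-1 : ℝ) • grad u x := fun x => by
    unfold grad; rw [fderiv_fun_neg]; simp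
  have hK : ∀ x, KHform k x (grad (fun y => -u y) x) (grad (fun y => -u y) x) =
      KHform k x (grad u x) (grad u x) := fun x => by
    rw [hgn, KHform_smul_left, KHform_smul_right]; ring
  have hK2 : ∀ x, KHform k x (grad u x) (grad (fun y => -u y) x) =
      - KHform k x (grad u x) (grad u x) := fun x => by
    rw [hgn, KHform_smul_right]; ring
  have hz : ∀ x ∈ Ω, (0:ℝ) = LH k u x * max (-u x) 0 := fun x hx => by
    rw [h.u_eq x hx, h.w_zero (hA x hx), zero_mul]
  have h2 := limit_id h.hk h.ho h.u_C2 h.u_C1.neg hC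
    (by simp_rw [hK2]; exact (h.u_int.mono_set (fun x hx => hx.1)).neg)
    (integrableOn_zero.congr_fun hz h.ho.measurableSet)
  rw [← setIntegral_congr_fun h.ho.measurableSet hz] at h2
  simp_rw [hK2] at h2
  rw [integral_neg] at h2
  simp only [integral_zero, neg_eq_zero] at h2
  have hge : ∀ x ∈ Ω, -u x ≤ 0 := h.nonpos_of_En h.u_C1.neg hC
    (by simp_rw [hK]; exact h.u_int) (by simp_rw [hK]; exact h2.le)
  have hu0 : ∀ x ∈ Ω, u x = 0 := fun x hx => le_antisymm (hle x hx) (by linarith [hge x hx])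
  have hI : Ieps k p ε q Ω u = 0 := by
    rw [← Ieps_zero h.toDom h.he h.he1]
    unfold Ieps
    congr 2
    · apply setIntegral_congr_fun h.ho.measurableSet
      intro x hx
      simp only
      rw [grad_congr (g := fun _ => 0)]
      filter_upwards [h.ho.mem_nhds hx] with y hy using hu0 y hy
    · apply setIntegral_congr_fun h.ho.measurableSet
      intro x hx
      simp only; rw [hu0 x hx]
  have := c_pos h.toDom h.he h.he1 hne
  rw [← h.u_c, hI] at this
  exact lt_irrefl _ this

end Ctx
end
end

/- Part 8 -/
noncomputable section
section
variable {k p : ℝ} {q : ℝ × ℝ → ℝ} {Ω : Set (ℝ × ℝ)}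

lemma pp_int (h : Dom k p q Ω) {ε : ℝ} (he : 0 < ε) (he1 : ε < 1) {φ : ℝ × ℝ → ℝ} (hφ : MemH k Ω φ) :
    IntegrableOn (fun x => pPart (φ x - q x * Real.log (1 / ε)) ^ (p + 1)) Ω := by
  have hL := log_pos' he he1
  refine maxpow_integrableOn' (f := fun x => φ x - q x * Real.log (1 / ε)) h.ho
    (hφ.2.1.continuousOn.sub (h.hqC1.continuousOn.mul continuousOn_const)) ?_ (by linarith [h.hp])
  have := compact_superlevel h.ho h.hb hφ.1 (h.hqc.mul (continuousOn_const (c := Real.log (1 / ε))))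
    (fun x hx => by
        rw [hφ.2.2.1 x hx]; exact mul_pos (h.hq3 x (frontier_subset_closure hx)) hL)
  simp only [sub_nonneg]
  exact this

lemma bern_sub {p x η : ℝ} (hp : 1 < p) (hx : 0 ≤ x) (hη : 0 ≤ η) :
    x ^ (p + 1) - (p + 1) * η * x ^ p ≤ (max (x - η) 0) ^ (p + 1) := by
  rcases hx.eq_or_lt with h0 | h0
  · rw [← h0, Real.zero_rpow (by linarith), Real.zero_rpow (by linarith)]
    simp only [mul_zero, sub_zero]
    exact Real.rpow_nonneg (le_max_right _ _) _
  · have e : x ^ (p + 1) = x ^ p * x := by rw [Real.rpow_add h0, Real.rpow_one]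
    have hxp : 0 < x ^ p := Real.rpow_pos_of_pos h0 _
    rcases le_or_gt η x with h1 | h1
    · rw [max_eq_left (by linarith)]
      have hb := one_add_mul_self_le_rpow_one_add (s := -(η / x)) (p := p + 1)
        (by rw [neg_le_neg_iff, div_le_one h0]; exact h1) (by linarith)
      have e2 : x - η = x * (1 + -(η / x)) := by field_simp; ring
      rw [e2, Real.mul_rpow hx (by
        have : η / x ≤ 1 := by rw [div_le_one h0]; exact h1
        linarith)]
      have hx1 : 0 < x ^ (p + 1) := Real.rpow_pos_of_pos h0 _
      calc x ^ (p + 1) - (p + 1) * η * x ^ p = x ^ (p + 1) * (1 + (p + 1) * -(η / x)) := by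
            rw [e]; field_simp; ring
        _ ≤ _ := by gcongr
    · refine le_trans ?_ (Real.rpow_nonneg (le_max_right _ _) _)
      rw [e]
      have : x - (p + 1) * η ≤ 0 := by nlinarith
      nlinarith

lemma bern_max {p s : ℝ} (hp : 1 < p) (hs : 0 ≤ s) :
    s ^ 2 / 2 - s ^ (p + 1) / (p + 1) ≤ 1 / 2 - 1 / (p + 1) := by
  have hb := one_add_mul_self_le_rpow_one_add (s := s ^ 2 - 1) (p := (p + 1) / 2)
    (by nlinarith [sq_nonneg s]) (by linarith)
  have e : (1 + (s ^ 2 - 1)) ^ ((p + 1) / 2) = s ^ (p + 1) := by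
    rw [add_sub_cancel, ← Real.rpow_natCast s 2, ← Real.rpow_mul hs]
    congr 1; push_cast; ring
  rw [e] at hb
  have hp1 : 0 < p + 1 := by linarith
  have : s ^ (p + 1) / (p + 1) ≥ (1 + (p + 1) / 2 * (s ^ 2 - 1)) / (p + 1) := by gcongr
  have e2 : (1 + (p + 1) / 2 * (s ^ 2 - 1)) / (p + 1) = 1 / (p + 1) + (s ^ 2 - 1) / 2 := by field_simp
  linarith

lemma TestFn.mul_C1 {V : Set (ℝ × ℝ)} (hV : IsOpen V) {φ g : ℝ × ℝ → ℝ} (hφ : TestFn V φ)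
    (hg : ContDiffOn ℝ 1 g V) : TestFn V (fun x => g x * φ x) := by
  refine TestFn.of_eq_zero ?_ hφ.2.1.isCompact hφ.2.2
    (fun x hx => by rw [image_eq_zero_of_notMem_tsupport hx, mul_zero])
  rw [contDiff_iff_contDiffAt]
  intro x
  by_cases hx : x ∈ V
  · exact (hg.contDiffAt (hV.mem_nhds hx)).mul hφ.1.contDiffAt
  · have : x ∉ tsupport φ := fun h => hx (hφ.2.2 h)
    refine (contDiffAt_const (c := (0:ℝ))).congr_of_eventuallyEq ?_
    have h2 := (isClosed_tsupport φ).isOpen_compl.mem_nhds this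
    filter_upwards [h2] with y hy
    rw [image_eq_zero_of_notMem_tsupport hy, mul_zero]

lemma En_comb_left {k : ℝ} (hk : 0 < k) {a b c : ℝ × ℝ → ℝ} (ha : TestFn Ω a) (hb : TestFn Ω b)
    (hc : TestFn Ω c) (s t : ℝ) :
    En k Ω (fun y => s * a y + t * b y) c = s * En k Ω a c + t * En k Ω b c := by
  unfold En
  rw [← integral_const_mul, ← integral_const_mul,
    ← integral_add ((ha.integrable_form hk hc).integrableOn.const_mul s)
    ((hb.integrable_form hk hc).integrableOn.const_mul t)]
  congr 1; ext x
  rw [grad_add ((ha.diff x).const_mul s) ((hb.diff x).const_mul t), grad_const_mul (ha.diff x),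
    grad_const_mul (hb.diff x)]
  simp only [KHform_add_left, KHform_smul_left]

/-- truncation of `u` -/
def pU (Ω : Set (ℝ × ℝ)) (u : ℝ × ℝ → ℝ) (δ : ℝ) : ℝ × ℝ → ℝ := Ω.indicator (fun x => Gd δ (u x))

/-- `min(u, qL)` approximately -/
def aa (q : ℝ × ℝ → ℝ) (Ω : Set (ℝ × ℝ)) (ε : ℝ) (u : ℝ × ℝ → ℝ) (δ : ℝ) : ℝ × ℝ → ℝ :=
  fun y => 1 * pU Ω u δ y + (-1) * pU Ω (ff q ε u) δ y

def dn (n : ℕ) : ℝ := 1 / ((n : ℝ) + 1)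
lemma dn_pos (n : ℕ) : 0 < dn n := Nat.one_div_pos_of_nat
lemma dn_tendsto : Tendsto dn atTop (𝓝 0) := tendsto_one_div_add_atTop_nhds_zero_nat

namespace Ctx
variable {ε : ℝ} {u : ℝ × ℝ → ℝ}

lemma pU_T (h : Ctx k p q Ω ε u) {δ : ℝ} (hδ : 0 < δ) : TestFn Ω (pU Ω u δ) :=
  (compT h.ho h.u_C1 (Gd_hasDerivAt hδ) (Gd'_continuous hδ) (fun _ ht => Gd_of_le ht) (h.compU hδ)).1

lemma pF_T (h : Ctx k p q Ω ε u) {V : Set (ℝ × ℝ)} (hV : IsOpen V) (hVΩ : V ⊆ Ω)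
    (hc : ∀ δ > 0, IsCompact {x ∈ V | δ ≤ ff q ε u x}) {δ : ℝ} (hδ : 0 < δ) :
    TestFn Ω (pU V (ff q ε u) δ) :=
  (compT hV (h.f_C1.mono hVΩ) (Gd_hasDerivAt hδ) (Gd'_continuous hδ) (fun _ ht => Gd_of_le ht)
    (hc δ hδ)).1.mono hVΩ

lemma compF' (h : Ctx k p q Ω ε u) : ∀ δ > 0, IsCompact {x ∈ Ω | δ ≤ ff q ε u x} :=
  fun _ hδ => h.compF hδ.le

lemma aa_T (h : Ctx k p q Ω ε u) {δ : ℝ} (hδ : 0 < δ) : TestFn Ω (aa q Ω ε u δ) :=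
  ((h.pU_T hδ).const_mul 1).add ((h.pF_T h.ho subset_rfl h.compF' hδ).const_mul (-1))

lemma pF_En (h : Ctx k p q Ω ε u) {V : Set (ℝ × ℝ)} (hV : IsOpen V) (hVΩ : V ⊆ Ω)
    (hc : ∀ δ > 0, IsCompact {x ∈ V | δ ≤ ff q ε u x}) {δ : ℝ} (hδ : 0 < δ) :
    En k Ω (pU V (ff q ε u) δ) (pU V (ff q ε u) δ) ≤ EE p q V ε u := by
  have := En_trunc_le h.hk h.ho hV hVΩ (h.f_C1.mono hVΩ) hδ (hc δ hδ)
    (h.int_of_cont (h.K_cont h.f_C1 h.f_C1) hVΩ)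
  rw [h.id_ff hV hVΩ hc] at this
  exact this

lemma uf_lim (h : Ctx k p q Ω ε u) {V : Set (ℝ × ℝ)} (hV : IsOpen V) (hVΩ : V ⊆ Ω)
    (hc : ∀ δ > 0, IsCompact {x ∈ V | δ ≤ ff q ε u x}) :
    Tendsto (fun n => En k Ω (pU Ω u (dn n)) (pU V (ff q ε u) (dn n))) atTop (𝓝 (EE p q V ε u)) := by
  have := limit_mixed (k := k) h.ho hV hVΩ h.u_C1 (h.f_C1.mono hVΩ) (fun δ hδ => h.compU hδ) hc
    (fun x hx hf => h.u_pos (hVΩ hx) hf) (h.int_of_cont (h.K_cont h.u_C1 h.f_C1) hVΩ) dn_pos dn_tendsto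
  rw [h.id_uf hV hVΩ hc] at this
  exact this

lemma ff_lim (h : Ctx k p q Ω ε u) {V : Set (ℝ × ℝ)} (hV : IsOpen V) (hVΩ : V ⊆ Ω)
    (hc : ∀ δ > 0, IsCompact {x ∈ V | δ ≤ ff q ε u x}) :
    Tendsto (fun n => En k Ω (pU Ω (ff q ε u) (dn n)) (pU V (ff q ε u) (dn n))) atTop
      (𝓝 (EE p q V ε u)) := by
  have := limit_mixed (k := k) h.ho hV hVΩ h.f_C1 (h.f_C1.mono hVΩ) h.compF' hc
    (fun x hx hf => hf) (h.int_of_cont (h.K_cont h.f_C1 h.f_C1) hVΩ) dn_pos dn_tendsto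
  rw [h.id_ff hV hVΩ hc] at this
  exact this

lemma aa_En_le (h : Ctx k p q Ω ε u) {δ : ℝ} (hδ : 0 < δ) :
    En k Ω (aa q Ω ε u δ) (aa q Ω ε u δ) ≤
      2 * EE p q Ω ε u + Real.log (1 / ε) * MM p q Ω ε u
        - 2 * En k Ω (pU Ω u δ) (pU Ω (ff q ε u) δ) := by
  have h1 := En_trunc_le h.hk h.ho h.ho subset_rfl h.u_C1 hδ (h.compU hδ)
    (h.u_int.mono_set (fun x hx => hx.1))
  rw [h.id_u] at h1
  have h2 := h.pF_En h.ho subset_rfl h.compF' hδ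
  unfold aa
  rw [En_comb h.hk (h.pU_T hδ) (h.pF_T h.ho subset_rfl h.compF' hδ)]
  change En k Ω (pU Ω u δ) (pU Ω u δ) ≤ _ at h1
  linarith

lemma aa_ge (h : Ctx k p q Ω ε u) {δ : ℝ} (hδ : 0 < δ) {x : ℝ × ℝ} (hx : x ∈ Ω)
    (hf : 0 ≤ ff q ε u x) : q x * Real.log (1 / ε) - 2 * δ ≤ aa q Ω ε u δ x := by
  unfold aa pU
  rw [indicator_of_mem hx, indicator_of_mem hx]
  have h1 := Gd_ge hδ (u x)
  have h2 := Gd_le hδ (ff q ε u x)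
  rw [max_eq_left hf] at h2
  unfold ff at h2 ⊢
  linarith

lemma EE_pos (h : Ctx k p q Ω ε u) {V : Set (ℝ × ℝ)} (hV : IsOpen V) (hVΩ : V ⊆ Ω)
    (hf : ∀ x ∈ V, 0 < ff q ε u x) (hne : V.Nonempty) : 0 < EE p q V ε u := by
  unfold EE
  rw [setIntegral_pos_iff_support_of_nonneg_ae
    (Eventually.of_forall fun x => mul_nonneg (h.w_nonneg x) (le_max_right _ _))
    (h.wg_int (h.f_cont.sup continuousOn_const) hVΩ)]
  refine lt_of_lt_of_le (hV.measure_pos volume hne) (measure_mono ?_)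
  intro y hy
  refine ⟨?_, hy⟩
  rw [Function.mem_support, max_eq_left (hf y hy).le]
  exact (mul_pos (h.w_pos (hf y hy)) (hf y hy)).ne'

/-- Main estimate for splitting. -/
lemma split_c (h : Ctx k p q Ω ε u) {V : Set (ℝ × ℝ)} (hV : IsOpen V) (hVΩ : V ⊆ Ω)
    (hf : ∀ x ∈ V, 0 < ff q ε u x) (hne : V.Nonempty)
    (hc : ∀ δ > 0, IsCompact {x ∈ V | δ ≤ ff q ε u x}) :
    ceps k p q Ω ε ≤ Real.log (1 / ε) * MM p q Ω ε u / 2 + (1 / 2 - 1 / (p + 1)) * EE p q V ε u := by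
  have hp := h.hp
  have he := h.he
  set L := Real.log (1 / ε) with hLdef
  set M := MM p q Ω ε u with hM
  set E := EE p q Ω ε u with hE
  set E1 := EE p q V ε u with hE1
  have hE1p : 0 < E1 := h.EE_pos hV hVΩ hf hne
  -- choice of S
  obtain ⟨S, hS0, hS⟩ : ∃ S : ℝ, 0 < S ∧ L * M / 2 + (S ^ 2 / 2 - S ^ (p + 1) / (p + 1)) * E1 < 0 := by
    have t1 : Tendsto (fun S : ℝ => S ^ 2 * (1 / 2 - S ^ (p - 1) / (p + 1))) atTop atBot := by
      apply Filter.Tendsto.atTop_mul_atBot₀ (tendsto_pow_atTop (by norm_num))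
      have : Tendsto (fun S : ℝ => S ^ (p - 1) / (p + 1)) atTop atTop :=
        (tendsto_rpow_atTop (by linarith)).atTop_div_const (by linarith)
      exact tendsto_atBot_add_const_left _ _ (tendsto_neg_atTop_atBot.comp this)
    have t2 : Tendsto (fun S : ℝ => L * M / 2 + S ^ 2 * (1 / 2 - S ^ (p - 1) / (p + 1)) * E1) atTop
        atBot := tendsto_atBot_add_const_left _ _ (t1.atBot_mul_const hE1p)
    obtain ⟨S, hS, hS0⟩ := ((t2.eventually (eventually_lt_atBot 0)).and (eventually_gt_atTop 0)).exists
    refine ⟨S, hS0, ?_⟩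
    have : S ^ (p + 1) = S ^ 2 * S ^ (p - 1) := by
      rw [← Real.rpow_natCast, ← Real.rpow_add hS0]; congr 1; push_cast; ring
    rw [this]
    calc _ = L * M / 2 + S ^ 2 * (1 / 2 - S ^ (p - 1) / (p + 1)) * E1 := by ring
      _ < 0 := hS
  set Y := ∫ x in V, (max (ff q ε u x) 0) ^ p with hY
  have hY0 : 0 ≤ Y := integral_nonneg fun x => Real.rpow_nonneg (le_max_right _ _) _
  set UB : ℕ → ℝ := fun n => 2 * E + L * M - 2 * En k Ω (pU Ω u (dn n)) (pU Ω (ff q ε u) (dn n)) with hUB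
  have hUBt : Tendsto UB atTop (𝓝 (L * M)) := by
    have := ((h.uf_lim h.ho subset_rfl h.compF').const_mul 2).const_sub (2 * E + L * M)
    rw [show 2 * E + L * M - 2 * EE p q Ω ε u = L * M by rw [← hE]; ring] at this
    exact this
  set e2 : ℕ → ℝ := fun n => |En k Ω (aa q Ω ε u (dn n)) (pU V (ff q ε u) (dn n))| with he2
  have he2t : Tendsto e2 atTop (𝓝 0) := by
    have h1 : Tendsto (fun n => En k Ω (aa q Ω ε u (dn n)) (pU V (ff q ε u) (dn n))) atTop (𝓝 0) := by
      have := (h.uf_lim hV hVΩ hc).sub (h.ff_lim hV hVΩ hc)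
      rw [sub_self] at this
      refine this.congr fun n => ?_
      unfold aa
      rw [En_comb_left h.hk (h.pU_T (dn_pos n)) (h.pF_T h.ho subset_rfl h.compF' (dn_pos n))
        (h.pF_T hV hVΩ hc (dn_pos n))]
      ring
    simpa using h1.abs
  set KK := (2 * S + 2) * S ^ p * Y / ε ^ 2 with hKK
  -- pointwise bound
  have main : ∀ n, ∀ s ∈ Icc (0:ℝ) S, Ieps k p ε q Ω
      (fun y => 1 * aa q Ω ε u (dn n) y + s * pU V (ff q ε u) (dn n) y) ≤
      (UB n / 2 + S * e2 n + dn n * KK) + (s ^ 2 / 2 - s ^ (p + 1) / (p + 1)) * E1 := by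
    intro n s hs
    have hδ := dn_pos n
    set δ := dn n with hδd
    have haT := h.aa_T hδ
    have hhT := h.pF_T hV hVΩ hc hδ
    set φ := fun y => 1 * aa q Ω ε u δ y + s * pU V (ff q ε u) δ y with hφ
    have hφT : TestFn Ω φ := (haT.const_mul 1).add (hhT.const_mul s)
    have hEn : En k Ω φ φ ≤ UB n + 2 * S * e2 n + s ^ 2 * E1 := by
      rw [hφ, En_comb h.hk haT hhT]
      have h1 := h.aa_En_le hδ
      have h2 := h.pF_En hV hVΩ hc hδ
      have h3 : s * En k Ω (aa q Ω ε u δ) (pU V (ff q ε u) δ) ≤ S * e2 n := by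
          calc s * En k Ω (aa q Ω ε u δ) (pU V (ff q ε u) δ) ≤ s * e2 n :=
                mul_le_mul_of_nonneg_left (le_abs_self _) hs.1
            _ ≤ S * e2 n := mul_le_mul_of_nonneg_right hs.2 (abs_nonneg _)
      have h4 : s ^ 2 * En k Ω (pU V (ff q ε u) δ) (pU V (ff q ε u) δ) ≤ s ^ 2 * E1 := by gcongr
      have h5 : UB n = 2 * E + L * M - 2 * En k Ω (pU Ω u δ) (pU Ω (ff q ε u) δ) := rfl
      rw [h5]
      linarith
    have hlow : s ^ (p + 1) * (ε ^ 2 * E1) - (p + 1) * ((2 * S + 2) * δ) * (S ^ p * Y) ≤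
        ∫ x in Ω, pPart (φ x - q x * L) ^ (p + 1) := by
      have i1 := pp_int h.toDom h.he h.he1 (hφT.memH h.hk h.ho)
      have hsub : ∫ x in V, pPart (φ x - q x * L) ^ (p + 1) ≤ ∫ x in Ω, pPart (φ x - q x * L) ^ (p + 1) :=
        setIntegral_mono_set i1 (Eventually.of_forall fun x => Real.rpow_nonneg (le_max_right _ _) _)
          (LE.le.eventuallyLE hVΩ)
      refine le_trans ?_ hsub
      have j1 := (maxpow_integrableOn' h.ho h.f_cont (h.compF le_rfl)
        (by linarith : 0 < p + 1)).mono_set hVΩ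
      have j2 := (maxpow_integrableOn' h.ho h.f_cont (h.compF le_rfl)
        (by linarith : 0 < p)).mono_set hVΩ
      have e3 : s ^ (p + 1) * (ε ^ 2 * E1) = s ^ (p + 1) * ∫ x in V, (max (ff q ε u x) 0) ^ (p + 1) := by
        rw [hE1, h.EE_pow]; field_simp
      rw [e3]
      have hpt : ∀ x ∈ V, s ^ (p + 1) * (max (ff q ε u x) 0) ^ (p + 1) -
          (p + 1) * ((2 * S + 2) * δ) * (S ^ p * (max (ff q ε u x) 0) ^ p) ≤
          pPart (φ x - q x * L) ^ (p + 1) := by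
        intro x hx
        have hfx := hf x hx
        have b := bern_sub hp (mul_nonneg hs.1 hfx.le) (by positivity : 0 ≤ (2 * S + 2) * δ)
        rw [max_eq_left hfx.le]
        rw [Real.mul_rpow hs.1 hfx.le, Real.mul_rpow hs.1 hfx.le] at b
        have hsp : s ^ p ≤ S ^ p := Real.rpow_le_rpow hs.1 hs.2 (by linarith)
        have hfp : 0 ≤ ff q ε u x ^ p := Real.rpow_nonneg hfx.le _
        have b2 : (max (s * ff q ε u x - (2 * S + 2) * δ) 0) ^ (p + 1) ≤
            pPart (φ x - q x * L) ^ (p + 1) := by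
          apply Real.rpow_le_rpow (le_max_right _ _) _ (by linarith)
          apply max_le_max_right
          have g1 := h.aa_ge hδ (hVΩ hx) hfx.le
          have g2 : ff q ε u x - 2 * δ ≤ pU V (ff q ε u) δ x := by
            unfold pU; rw [indicator_of_mem hx]; exact Gd_ge hδ _
          have g3 : s * (ff q ε u x - 2 * δ) ≤ s * pU V (ff q ε u) δ x :=
            mul_le_mul_of_nonneg_left g2 hs.1
          have g4 : s * δ ≤ S * δ := mul_le_mul_of_nonneg_right hs.2 hδ.le
          simp only [hφ]
          rw [← hLdef] at g1
          linarith
        have b3 : (p + 1) * ((2 * S + 2) * δ) * (s ^ p * ff q ε u x ^ p) ≤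
            (p + 1) * ((2 * S + 2) * δ) * (S ^ p * ff q ε u x ^ p) := by gcongr
        linarith
      have := setIntegral_mono_on (μ := volume) ((j1.const_mul (s ^ (p + 1))).sub
        ((j2.const_mul (S ^ p)).const_mul ((p + 1) * ((2 * S + 2) * δ))))
        (i1.mono_set hVΩ) hV.measurableSet hpt
      rw [integral_sub' (j1.const_mul _) ((j2.const_mul _).const_mul _), integral_const_mul,
        integral_const_mul, integral_const_mul] at this
      exact this
    have hI : Ieps k p ε q Ω φ = 1 / 2 * En k Ω φ φ -
      1 / ((p + 1) * ε ^ 2) * ∫ x in Ω, pPart (φ x - q x * L) ^ (p + 1) := rfl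
    rw [hI]
    have hh : 1 / ((p + 1) * ε ^ 2) * (s ^ (p + 1) * (ε ^ 2 * E1) -
        (p + 1) * ((2 * S + 2) * δ) * (S ^ p * Y)) ≤
        1 / ((p + 1) * ε ^ 2) * ∫ x in Ω, pPart (φ x - q x * L) ^ (p + 1) := by gcongr
    have hh2 : 1 / ((p + 1) * ε ^ 2) * (s ^ (p + 1) * (ε ^ 2 * E1) -
        (p + 1) * ((2 * S + 2) * δ) * (S ^ p * Y)) = s ^ (p + 1) / (p + 1) * E1 - δ * KK := by
      rw [hKK]; field_simp
    rw [hh2] at hh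
    linarith
  have bt : Tendsto (fun n => UB n / 2 + S * e2 n + dn n * KK) atTop (𝓝 (L * M / 2)) := by
    have := ((hUBt.div_const 2).add (he2t.const_mul S)).add (dn_tendsto.mul_const KK)
    simpa using this
  refine ge_of_tendsto (bt.add_const ((1 / 2 - 1 / (p + 1)) * E1)) ?_
  have ev := (bt.add_const ((S ^ 2 / 2 - S ^ (p + 1) / (p + 1)) * E1)).eventually (gt_mem_nhds hS)
  filter_upwards [ev] with n hn
  have haT := h.aa_T (dn_pos n)
  have hhT := h.pF_T hV hVΩ hc (dn_pos n)
  have he20 : 0 ≤ e2 n := abs_nonneg _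
  have hKK0 : 0 ≤ KK := by positivity
  have hth : 0 ≤ (1 / 2 - 1 / (p + 1)) * E1 := by
    have : 1 / (p + 1) ≤ 1 / 2 := one_div_le_one_div_of_le (by norm_num) (by linarith)
    exact mul_nonneg (by linarith) hE1p.le
  refine (path_bound h.toDom h.he h.he1 haT hhT (α := fun t => min (2 * t) 1)
    (β := fun t => S * max (2 * t - 1) 0) (by fun_prop) (by fun_prop) (by simp) (by norm_num) ?_ ?_).2
  · have := main n S ⟨hS0.le, le_rfl⟩
    have e1 : min ((2:ℝ) * 1) 1 = 1 := by norm_num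
    have e3 : S * max ((2:ℝ) * 1 - 1) 0 = S := by norm_num
    simp only [e1, e3]
    linarith
  · intro t ht
    rcases le_or_gt t (1 / 2) with h1 | h1
    · have e1 : min (2 * t) 1 = 2 * t := min_eq_left (by linarith)
      have e3 : S * max (2 * t - 1) 0 = 0 := by rw [max_eq_right (by linarith), mul_zero]
      simp only [e1, e3]
      refine (Ieps_le h.toDom h.he _).trans ?_
      rw [En_comb h.hk haT hhT]
      have h2 := h.aa_En_le (dn_pos n)
      have h3 : 0 ≤ En k Ω (aa q Ω ε u (dn n)) (aa q Ω ε u (dn n)) :=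
        integral_nonneg fun x => KHform_nonneg h.hk _ _
      have h4 : (2 * t) ^ 2 ≤ 1 := by nlinarith [ht.1]
      have h5 : En k Ω (aa q Ω ε u (dn n)) (aa q Ω ε u (dn n)) ≤ UB n := h2
      have h6 := mul_nonneg (dn_pos n).le hKK0
      have h7 := mul_nonneg hS0.le he20
      have h8 : (2 * t) ^ 2 * En k Ω (aa q Ω ε u (dn n)) (aa q Ω ε u (dn n)) ≤ UB n := by nlinarith
      linarith
    · have e1 : min (2 * t) 1 = 1 := min_eq_right (by linarith)
      have hm : max (2 * t - 1) 0 ≤ 1 := max_le (by linarith [ht.2]) (by norm_num)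
      have hm0 : 0 ≤ max (2 * t - 1) 0 := le_max_right _ _
      have hmem : S * max (2 * t - 1) 0 ∈ Icc 0 S := ⟨by positivity, by nlinarith⟩
      have := main n _ hmem
      have b := bern_max hp hmem.1
      simp only [e1]
      have := mul_le_mul_of_nonneg_right b hE1p.le
      linarith

lemma core_preconn (h : Ctx k p q Ω ε u) : IsPreconnected {x ∈ Ω | 0 < ff q ε u x} := by
  set A := {x ∈ Ω | 0 < ff q ε u x} with hA
  have hAo : IsOpen A := isOpen_pos h.ho h.f_cont
  intro U V hU hV hAUV hAU hAV
  by_contra hcon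
  have hdis : ∀ x ∈ A, x ∈ U → x ∈ V → False := fun x h1 h2 h3 => hcon ⟨x, h1, h2, h3⟩
  have s1 : A ∩ U ⊆ Ω := fun x hx => hx.1.1
  have s2 : A ∩ V ⊆ Ω := fun x hx => hx.1.1
  have hc : ∀ δ > 0, IsCompact {x ∈ A ∩ U | δ ≤ ff q ε u x} := by
    intro δ hδ
    have e : {x ∈ A ∩ U | δ ≤ ff q ε u x} = {x ∈ Ω | δ ≤ ff q ε u x} \ V := by
      ext x
      constructor
      · rintro ⟨⟨h1, h2⟩, h3⟩
        exact ⟨⟨h1.1, h3⟩, fun h4 => hdis x h1 h2 h4⟩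
      · rintro ⟨⟨h1, h2⟩, h3⟩
        have hxA : x ∈ A := ⟨h1, lt_of_lt_of_le hδ h2⟩
        exact ⟨⟨hxA, (hAUV hxA).resolve_right h3⟩, h2⟩
    rw [e]
    exact (h.compF hδ.le).diff hV
  have h1 := h.split_c (hAo.inter hU) s1 (fun x hx => hx.1.2) hAU hc
  have h2 := h.c_ge
  have hE2 : 0 < EE p q (A ∩ V) ε u := h.EE_pos (hAo.inter hV) s2 (fun x hx => hx.1.2) hAV
  have hw : ∀ W ⊆ Ω, IntegrableOn (fun x => ww p q ε u x * max (ff q ε u x) 0) W :=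
    fun W hW => h.wg_int (h.f_cont.sup continuousOn_const) hW
  have hsum : EE p q (A ∩ U) ε u + EE p q (A ∩ V) ε u ≤ EE p q Ω ε u := by
    unfold EE
    rw [← setIntegral_union (Set.disjoint_left.mpr fun x h3 h4 => hdis x h3.1 h3.2 h4.2)
      (hAo.inter hV).measurableSet (hw _ s1) (hw _ s2)]
    exact setIntegral_mono_set (hw Ω subset_rfl)
      (Eventually.of_forall fun x => mul_nonneg (h.w_nonneg x) (le_max_right _ _))
      (LE.le.eventuallyLE (union_subset s1 s2))
  have hth : 0 < (1 / 2 - 1 / (p + 1)) := by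
    have : 1 / (p + 1) < 1 / 2 := one_div_lt_one_div_of_lt (by norm_num) (by linarith [h.hp])
    linarith
  nlinarith

end Ctx
end
end

/- Part 9 -/
noncomputable section
section
variable {k p : ℝ} {q : ℝ × ℝ → ℝ} {Ω : Set (ℝ × ℝ)}

/-- the core -/
def core (q : ℝ × ℝ → ℝ) (Ω : Set (ℝ × ℝ)) (ε : ℝ) (u : ℝ × ℝ → ℝ) : Set (ℝ × ℝ) :=
  {x ∈ Ω | 0 < ff q ε u x}

lemma Ctx.core_open {ε : ℝ} {u : ℝ × ℝ → ℝ} (h : Ctx k p q Ω ε u) : IsOpen (core q Ω ε u) :=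
  isOpen_pos h.ho h.f_cont

lemma Ctx.intww {ε : ℝ} {u : ℝ × ℝ → ℝ} (h : Ctx k p q Ω ε u) {c0 : ℝ} (hc : ∀ x ∈ Ω, c0 ≤ q x) :
    c0 * ∫ x in Ω, ww p q ε u x ≤ Ctx.MM p q Ω ε u := by
  unfold Ctx.MM
  rw [← integral_const_mul]
  have h1 : IntegrableOn (fun x => ww p q ε u x) Ω := by
    simpa using h.wg_int (g := fun _ => 1) continuousOn_const subset_rfl
  refine setIntegral_mono_on (h1.const_mul _) (h.wg_int h.hqC1.continuousOn subset_rfl)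
    h.ho.measurableSet (fun x hx => ?_)
  rw [mul_comm]
  exact mul_le_mul_of_nonneg_left (hc x hx) (h.w_nonneg x)

lemma area_lemma (hD : Dom k p q Ω) {B : ℝ} (hB : 0 < B) : ∃ c > 0, ∀ ε u, Ctx k p q Ω ε u →
    Ctx.MM p q Ω ε u ≤ B → (core q Ω ε u).Nonempty → c * ε ^ 2 ≤ volume.real (core q Ω ε u) := by
  obtain ⟨C, hC, hS⟩ := sob_weighted hD.hk hD.hb
  obtain ⟨c0, hc0, hq0⟩ := hD.qmin
  have hp := hD.hp
  set s := (p + 1) / 2 with hs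
  have hs1 : 1 < s := by rw [hs]; linarith
  set K := (C * s ^ 2) ^ p * (B / c0) ^ (p - 1) with hK
  have hCs : 0 < C * s ^ 2 := by positivity
  have hK0 : 0 < K := by positivity
  refine ⟨1 / K, by positivity, fun ε u h hM hne => ?_⟩
  have he := h.he
  have hAm : MeasurableSet (core q Ω ε u) := h.core_open.measurableSet
  have hAΩ : core q Ω ε u ⊆ Ω := fun x hx => hx.1
  have hAf : volume (core q Ω ε u) ≠ ⊤ := ((measure_mono hAΩ).trans_lt hD.hb.measure_lt_top).ne
  have h1 := hS Ω subset_rfl h.ho (ff q ε u) h.f_C1 (h.compF le_rfl) s hs1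
    (h.int_of_cont (h.K_cont h.f_C1 h.f_C1) subset_rfl)
  rw [h.id_ff h.ho subset_rfl h.compF', show 2 * s = p + 1 by rw [hs]; ring,
    show p + 1 - 2 = p - 1 by ring] at h1
  change _ ≤ _ * Ctx.EE p q Ω ε u at h1
  have hE : 0 < Ctx.EE p q Ω ε u := by
    refine lt_of_lt_of_le (h.EE_pos h.core_open hAΩ (fun x hx => hx.2) hne) ?_
    exact setIntegral_mono_set (h.wg_int (h.f_cont.sup continuousOn_const) subset_rfl)
      (Eventually.of_forall fun x => mul_nonneg (h.w_nonneg x) (le_max_right _ _))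
      (LE.le.eventuallyLE hAΩ)
  have h2 := h.EE_pow (V := Ω)
  have h3 : ∫ x in Ω, (max (ff q ε u x) 0) ^ (p + 1) = ε ^ 2 * Ctx.EE p q Ω ε u := by
    rw [h2]; field_simp
  rw [h3] at h1
  have h4 : ε ^ 2 ≤ C * s ^ 2 * ∫ x in Ω, (max (ff q ε u x) 0) ^ (p - 1) :=
    le_of_mul_le_mul_right h1 hE
  have h5 : ∫ x in Ω, (max (ff q ε u x) 0) ^ (p - 1) =
      ∫ x in core q Ω ε u, (max (ff q ε u x) 0) ^ (p - 1) := by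
    refine setIntegral_eq_of_subset_of_forall_sdiff_eq_zero h.ho.measurableSet hAΩ ?_
    rintro x ⟨hx, hx2⟩
    have : ff q ε u x ≤ 0 := by
      by_contra hh; exact hx2 ⟨hx, not_le.mp hh⟩
    rw [max_eq_right this, Real.zero_rpow (by linarith)]
  have hpi := maxpow_integrableOn' h.ho h.f_cont (h.compF le_rfl) (by linarith : 0 < p)
  have h6 := holder_pow hAf (v := fun x => max (ff q ε u x) 0) (fun x => le_max_right _ _)
    (a := p - 1) (b := p) (by linarith) (by linarith)
    (((h.f_cont.sup continuousOn_const).mono hAΩ).aestronglyMeasurable hAm) (hpi.mono_set hAΩ)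
  have h7 : ∫ x in core q Ω ε u, (max (ff q ε u x) 0) ^ p ≤ ε ^ 2 * (B / c0) := by
    have a1 : ∫ x in core q Ω ε u, (max (ff q ε u x) 0) ^ p ≤ ∫ x in Ω, (max (ff q ε u x) 0) ^ p :=
      setIntegral_mono_set hpi (Eventually.of_forall fun x => Real.rpow_nonneg (le_max_right _ _) _)
        (LE.le.eventuallyLE hAΩ)
    have a2 := h.intww (c0 := c0) (fun x hx => hq0 x (subset_closure hx))
    unfold ww at a2
    rw [integral_const_mul] at a2
    have a3 : c0 * (1 / ε ^ 2 * ∫ x in Ω, (max (ff q ε u x) 0) ^ p) ≤ B := a2.trans hM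
    refine a1.trans ?_
    have : ∫ x in Ω, (max (ff q ε u x) 0) ^ p = 
      (c0 * (1 / ε ^ 2 * ∫ x in Ω, (max (ff q ε u x) 0) ^ p)) * (ε ^ 2 / c0) := by field_simp
    rw [this]
    calc _ ≤ B * (ε ^ 2 / c0) := by gcongr
      _ = _ := by ring
  set a := volume.real (core q Ω ε u) with ha
  have ha0 : 0 ≤ a := measureReal_nonneg
  have hZ0 : 0 ≤ ∫ x in core q Ω ε u, (max (ff q ε u x) 0) ^ p :=
    integral_nonneg fun x => Real.rpow_nonneg (le_max_right _ _) _
  have h8 : ε ^ 2 ≤ C * s ^ 2 * ((ε ^ 2 * (B / c0)) ^ ((p - 1) / p) * a ^ (1 / p)) := by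
    refine h4.trans ?_
    rw [h5]
    refine mul_le_mul_of_nonneg_left (h6.trans ?_) hCs.le
    rw [show 1 - (p - 1) / p = 1 / p by field_simp; ring]
    refine mul_le_mul_of_nonneg_right ?_ (by positivity)
    exact Real.rpow_le_rpow hZ0 h7 (div_nonneg (by linarith) (by linarith))
  set e := ε ^ 2 with hedef
  have he0 : 0 < e := by positivity
  have h9 := Real.rpow_le_rpow he0.le h8 (by linarith : 0 ≤ p)
  have hP1 : 0 ≤ (e * (B / c0)) ^ ((p - 1) / p) := by positivity
  have hP2 : 0 ≤ a ^ (1 / p) := by positivity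
  rw [Real.mul_rpow hCs.le (mul_nonneg hP1 hP2), Real.mul_rpow hP1 hP2,
    ← Real.rpow_mul (by positivity), ← Real.rpow_mul ha0, div_mul_cancel₀ _ (by linarith : p ≠ 0),
    div_mul_cancel₀ _ (by linarith : p ≠ 0), Real.rpow_one, Real.mul_rpow he0.le (by positivity)] at h9
  have h10 : e ^ p = e ^ (p - 1) * e := by
    rw [← Real.rpow_add_one he0.ne']; congr 1; ring
  have h11 : e ^ (p - 1) * e ≤ e ^ (p - 1) * (K * a) := by
    rw [← h10]; refine h9.trans (le_of_eq ?_); rw [hK]; ring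
  have h12 : e ≤ K * a := le_of_mul_le_mul_left h11 (by positivity)
  rw [one_div, inv_mul_le_iff₀ hK0]; exact h12

/-- two points far apart -/
lemma two_points {A : Set (ℝ × ℝ)} {r : ℝ} (hr : 0 < r) (hne : A.Nonempty)
    (hA : (2 * r) ^ 2 < volume.real A) : ∃ a ∈ A, ∃ b ∈ A, r < dist a b := by
  obtain ⟨a, ha⟩ := hne
  by_contra hcon
  push Not at hcon
  have hsub : A ⊆ Metric.closedBall a r := fun b hb => by
    rw [Metric.mem_closedBall, dist_comm]; exact hcon a ha b hb
  have h1 : volume.real A ≤ volume.real (Metric.closedBall a r) :=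
    measureReal_mono hsub (isCompact_closedBall a r).measure_lt_top.ne
  have h2 : volume.real (Metric.closedBall a r) = (2 * r) ^ 2 := by
    have : Metric.closedBall a r = Metric.closedBall a.1 r ×ˢ Metric.closedBall a.2 r := by
      rw [closedBall_prod_same]
    rw [this, Measure.volume_eq_prod, measureReal_prod_prod, Measure.real, Measure.real, Real.volume_closedBall, Real.volume_closedBall,
      ENNReal.toReal_ofReal (by linarith)]
    ring
  linarith
end
end

/- Part 10 -/
noncomputable section
section
variable {k p : ℝ} {q : ℝ × ℝ → ℝ} {Ω : Set (ℝ × ℝ)}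

lemma int_supp {F : ℝ × ℝ → ℝ} (hΩ : IsOpen Ω) (hF : ContinuousOn F Ω) {b : ℝ × ℝ → ℝ} (hb : TestFn Ω b)
    (h0 : ∀ x, x ∉ tsupport b → F x = 0) : IntegrableOn F Ω := by
  refine ((hF.mono hb.2.2).integrableOn_compact hb.2.1.isCompact).of_forall_sdiff_eq_zero
    hΩ.measurableSet ?_
  rintro x ⟨_, hx⟩
  exact h0 x hx

lemma detKH_pos (hk : 0 < k) (x : ℝ × ℝ) : 0 < detKH k x := by unfold detKH; positivity

lemma sqrtdet_pos (hk : 0 < k) (x : ℝ × ℝ) : 0 < Real.sqrt (detKH k x) := Real.sqrt_pos.2 (detKH_pos hk x)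

lemma sqrtdet_cont (hk : 0 < k) : Continuous fun x => Real.sqrt (detKH k x) := by
  apply Real.continuous_sqrt.comp
  unfold detKH
  exact continuous_const.div (by fun_prop) (fun x => (den_pos hk x).ne')

/-- weighted energy, conformally invariant -/
def WEn (k : ℝ) (V : Set (ℝ × ℝ)) (b : ℝ × ℝ → ℝ) : ℝ :=
  ∫ x in V, (Real.sqrt (detKH k x))⁻¹ * KHform k x (grad b x) (grad b x)

lemma b_energy (hD : Dom k p q Ω) {L Qm : ℝ} (hL : 0 < L) (hQm : 0 < Qm)
    (hQ : ∀ x ∈ Ω, Qm ≤ Qfun k q x) {φ : ℝ × ℝ → ℝ} (hφ : TestFn Ω φ) :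
    TestFn Ω (fun x => (q x * L)⁻¹ * φ x) ∧
    WEn k Ω (fun x => (q x * L)⁻¹ * φ x) ≤ En k Ω φ φ / (L ^ 2 * Qm) := by
  have hqp : ∀ x ∈ Ω, 0 < q x := fun x hx => hD.hq3 x (subset_closure hx)
  have hg : ContDiffOn ℝ 1 (fun x => (q x * L)⁻¹) Ω :=
    (hD.hqC1.mul contDiffOn_const).inv (fun x hx => (mul_pos (hqp x hx) hL).ne')
  have hb := hφ.mul_C1 hD.ho hg
  refine ⟨hb, ?_⟩
  set b := fun x => (q x * L)⁻¹ * φ x with hbd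
  have hψ : TestFn Ω (fun x => (q x * b x) * b x) := hb.mul_C1 hD.ho (hD.hqC1.mul hb.1.contDiffOn)
  have hz : ∫ x in Ω, KHform k x (grad q x) (grad (fun x => (q x * b x) * b x) x) = 0 := by
    rw [ibp hD.hk hD.ho hD.hq1 hψ]
    rw [setIntegral_congr_fun hD.ho.measurableSet (g := fun _ => (0:ℝ))]
    · simp
    · intro x hx; simp only [hD.hq4 x hx, zero_mul]
  have dq : ∀ x ∈ Ω, DifferentiableAt ℝ q x := fun x hx =>
    (hD.hqC1.differentiableOn one_ne_zero).differentiableAt (hD.ho.mem_nhds hx)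
  have id : ∀ x ∈ Ω, KHform k x (grad φ x) (grad φ x) =
      L ^ 2 * (q x ^ 2 * KHform k x (grad b x) (grad b x)) +
      L ^ 2 * KHform k x (grad q x) (grad (fun x => (q x * b x) * b x) x) := by
    intro x hx
    have e1 : grad φ x = L • (q x • grad b x + b x • grad q x) := by
      rw [← grad_mul (dq x hx) (hb.diff x), ← grad_const_mul ((dq x hx).fun_mul (hb.diff x))]
      apply grad_congr
      filter_upwards [hD.ho.mem_nhds hx] with y hy
      have := hqp y hy
      simp only [hbd]; field_simp
    rw [e1, grad_mul ((dq x hx).fun_mul (hb.diff x)) (hb.diff x), grad_mul (dq x hx) (hb.diff x)]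
    simp only [KHform_smul_left, KHform_smul_right, KHform_add_left, KHform_add_right]
    rw [KHform_comm k x (grad b x) (grad q x)]
    ring
  have hgb := grad_continuousOn hD.ho hb.1.contDiffOn
  have i1 : IntegrableOn (fun x => q x ^ 2 * KHform k x (grad b x) (grad b x)) Ω :=
    int_supp hD.ho ((hD.hqC1.continuousOn.pow 2).mul (KHform_continuousOn hD.hk hgb hgb)) hb
      (fun x hx => by rw [grad_zero_of_notMem hx, KHform_zero_left, mul_zero])
  have i2 : IntegrableOn (fun x => KHform k x (grad q x) (grad (fun x => (q x * b x) * b x) x)) Ω :=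
    int_supp hD.ho (KHform_continuousOn hD.hk (grad_continuousOn hD.ho hD.hqC1)
      (grad_continuousOn hD.ho hψ.1.contDiffOn)) hψ
      (fun x hx => by rw [grad_zero_of_notMem hx, KHform_zero_right])
  have i3 : IntegrableOn (fun x => (Real.sqrt (detKH k x))⁻¹ * KHform k x (grad b x) (grad b x)) Ω :=
    int_supp hD.ho (((sqrtdet_cont hD.hk).inv₀ (fun x => (sqrtdet_pos hD.hk x).ne')).continuousOn.mul
      (KHform_continuousOn hD.hk hgb hgb)) hb
      (fun x hx => by rw [grad_zero_of_notMem hx, KHform_zero_left, mul_zero])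
  have hEn : En k Ω φ φ = L ^ 2 * ∫ x in Ω, q x ^ 2 * KHform k x (grad b x) (grad b x) := by
    unfold En
    rw [setIntegral_congr_fun hD.ho.measurableSet id, integral_add (i1.const_mul _) (i2.const_mul _),
      integral_const_mul, integral_const_mul, hz]
    ring
  have hle : Qm * WEn k Ω b ≤ ∫ x in Ω, q x ^ 2 * KHform k x (grad b x) (grad b x) := by
    unfold WEn
    rw [← integral_const_mul]
    refine setIntegral_mono_on (i3.const_mul _) i1 hD.ho.measurableSet (fun x hx => ?_)
    have h1 := hQ x hx
    have h2 := sqrtdet_pos hD.hk x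
    rw [← mul_assoc]
    refine mul_le_mul_of_nonneg_right ?_ (KHform_nonneg hD.hk x _)
    unfold Qfun at h1
    rw [← div_eq_mul_inv, div_le_iff₀ h2]; exact h1
  rw [le_div_iff₀ (by positivity), hEn]
  calc _ = L ^ 2 * (Qm * WEn k Ω b) := by ring
    _ ≤ _ := by gcongr

lemma Ctx.b_fn {ε : ℝ} {u : ℝ × ℝ → ℝ} (h : Ctx k p q Ω ε u) {Qm : ℝ} (hQm : 0 < Qm)
    (hQ : ∀ x ∈ Ω, Qm ≤ Qfun k q x) {η : ℝ} (hη : 0 < η) :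
    ∃ b, TestFn Ω b ∧ (∀ x ∈ core q Ω ε u, 1 - η ≤ b x) ∧
      WEn k Ω b ≤ Ctx.MM p q Ω ε u / (Real.log (1 / ε) * Qm) + η := by
  have hL := h.L_pos
  set L := Real.log (1 / ε) with hLd
  set M := Ctx.MM p q Ω ε u with hM
  obtain ⟨c0, hc0, hq0⟩ := h.qmin
  have hUBt : Tendsto (fun n => (2 * Ctx.EE p q Ω ε u + L * M -
      2 * En k Ω (pU Ω u (dn n)) (pU Ω (ff q ε u) (dn n))) / (L ^ 2 * Qm)) atTop (𝓝 (M / (L * Qm))) := by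
    have := (((h.uf_lim h.ho subset_rfl h.compF').const_mul 2).const_sub
      (2 * Ctx.EE p q Ω ε u + L * M)).div_const (L ^ 2 * Qm)
    rw [show (2 * Ctx.EE p q Ω ε u + L * M - 2 * Ctx.EE p q Ω ε u) / (L ^ 2 * Qm) = M / (L * Qm) by
      field_simp; ring] at this
    exact this
  have hd : Tendsto (fun n => 2 * dn n / (c0 * L)) atTop (𝓝 0) := by
    simpa using (dn_tendsto.const_mul 2).div_const (c0 * L)
  obtain ⟨n, hn1, hn2⟩ := ((hUBt.eventually (eventually_lt_nhds (b := M / (L * Qm) + η) (by linarith))).and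
    (hd.eventually (eventually_lt_nhds hη))).exists
  obtain ⟨hb, hE⟩ := b_energy h.toDom hL hQm hQ (h.aa_T (dn_pos n))
  refine ⟨_, hb, fun x hx => ?_, hE.trans (le_trans ?_ hn1.le)⟩
  · have h1 := h.aa_ge (dn_pos n) hx.1 hx.2.le
    have h2 := hq0 x (subset_closure hx.1)
    have h3 : 0 < q x * L := mul_pos (by linarith) hL
    rw [← hLd] at h1
    rw [inv_mul_eq_div, le_div_iff₀ h3]
    rw [div_lt_iff₀ (by positivity)] at hn2
    have h4 : η * (c0 * L) ≤ η * (q x * L) := by gcongr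
    linarith
  · gcongr
    exact h.aa_En_le (dn_pos n)
end
end

/- Part 11 -/
noncomputable section

lemma cs_interval {a b : ℝ} (ha : 0 < a) (hab : a ≤ b) {g : ℝ → ℝ} (hg : Continuous g) :
    (∫ r in a..b, g r) ^ 2 ≤ Real.log (b / a) * ∫ r in a..b, r * g r ^ 2 := by
  have hpos : ∀ r ∈ Icc a b, 0 < r := fun r hr => ha.trans_le hr.1
  have hu : uIcc a b = Icc a b := uIcc_of_le hab
  have i1 : IntervalIntegrable (fun r : ℝ => r⁻¹) volume a b := by
    apply ContinuousOn.intervalIntegrable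
    rw [hu]
    exact continuousOn_id.inv₀ (fun r hr => (hpos r hr).ne')
  have i2 : IntervalIntegrable g volume a b := hg.intervalIntegrable _ _
  have i3 : IntervalIntegrable (fun r => r * g r ^ 2) volume a b :=
    (continuous_id.mul (hg.pow 2)).intervalIntegrable _ _
  have hlog : ∫ r in a..b, r⁻¹ = Real.log (b / a) := by
    rw [integral_inv]; rw [hu]; intro h; exact lt_irrefl _ (hpos 0 h)
  have h : ∀ t : ℝ, 0 ≤ Real.log (b / a) * (t * t) + (2 * ∫ r in a..b, g r) * t +
      (∫ r in a..b, r * g r ^ 2) := by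
    intro t
    have h0 : 0 ≤ ∫ r in a..b, (r⁻¹ * (t * t) + g r * (2 * t) + r * g r ^ 2) := by
      apply intervalIntegral.integral_nonneg hab
      intro r hr
      have := hpos r hr
      have e : r⁻¹ * (t * t) + g r * (2 * t) + r * g r ^ 2 = r⁻¹ * (t + r * g r) ^ 2 := by
        field_simp; ring
      rw [e]; positivity
    rw [intervalIntegral.integral_add ((i1.mul_const _).add (i2.mul_const _)) i3,
      intervalIntegral.integral_add (i1.mul_const _) (i2.mul_const _),
      intervalIntegral.integral_mul_const, intervalIntegral.integral_mul_const, hlog] at h0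
    linarith
  have := discrim_le_zero h
  unfold discrim at this
  nlinarith

lemma cs_interval1 {a b : ℝ} (hab : a ≤ b) {g : ℝ → ℝ} (hg : Continuous g) :
    (∫ r in a..b, g r) ^ 2 ≤ (b - a) * ∫ r in a..b, g r ^ 2 := by
  have i2 : IntervalIntegrable g volume a b := hg.intervalIntegrable _ _
  have i3 : IntervalIntegrable (fun r => g r ^ 2) volume a b := (hg.pow 2).intervalIntegrable _ _
  have h : ∀ t : ℝ, 0 ≤ (b - a) * (t * t) + (2 * ∫ r in a..b, g r) * t +
      (∫ r in a..b, g r ^ 2) := by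
    intro t
    have h0 : 0 ≤ ∫ r in a..b, (t * t + g r * (2 * t) + g r ^ 2) := by
      apply intervalIntegral.integral_nonneg hab
      intro r hr
      have e : t * t + g r * (2 * t) + g r ^ 2 = (t + g r) ^ 2 := by ring
      rw [e]; positivity
    rw [intervalIntegral.integral_add ((intervalIntegrable_const).add (i2.mul_const _)) i3,
      intervalIntegral.integral_add (intervalIntegrable_const) (i2.mul_const _),
      intervalIntegral.integral_const, smul_eq_mul, intervalIntegral.integral_mul_const] at h0
    linarith
  have := discrim_le_zero h
  unfold discrim at this
  nlinarith

/-- polar point -/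
def pol (r θ : ℝ) : ℝ × ℝ := (r * Real.cos θ, r * Real.sin θ)

lemma pol_cont : Continuous fun z : ℝ × ℝ => pol z.1 z.2 := by unfold pol; fun_prop
lemma pol_sq (r θ : ℝ) : (pol r θ).1 ^ 2 + (pol r θ).2 ^ 2 = r ^ 2 := by
  unfold pol; simp only; nlinarith [Real.sin_sq_add_cos_sq θ]

/-- polar integration for compactly supported continuous functions -/
lemma polar_int {F : ℝ × ℝ → ℝ} (hF : Continuous F) {R : ℝ} (hR : 0 < R)
    (h0 : ∀ y : ℝ × ℝ, R ^ 2 ≤ y.1 ^ 2 + y.2 ^ 2 → F y = 0) :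
    ∫ y, F y = ∫ r in (0:ℝ)..R, ∫ θ in (-π)..π, r * F (pol r θ) := by
  rw [← integral_comp_polarCoord_symm]
  have hsub : Ioo 0 R ×ˢ Ioo (-π) π ⊆ polarCoord.target := by
    rw [polarCoord_target]
    exact prod_mono (fun r hr => hr.1) subset_rfl
  have e1 : ∫ p in polarCoord.target, p.1 • F (polarCoord.symm p) =
      ∫ p in Ioo 0 R ×ˢ Ioo (-π) π, p.1 • F (polarCoord.symm p) := by
    refine setIntegral_eq_of_subset_of_forall_sdiff_eq_zero ?_ hsub ?_
    · exact polarCoord.open_target.measurableSet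
    · rintro x ⟨hx, hx2⟩
      rw [polarCoord_target] at hx
      have : R ≤ x.1 := by
        by_contra hh
        exact hx2 ⟨⟨hx.1, not_le.mp hh⟩, hx.2⟩
      have e : polarCoord.symm x = pol x.1 x.2 := rfl
      rw [e, h0, smul_zero]
      rw [pol_sq]
      gcongr
  rw [e1]
  have hc : Continuous fun p : ℝ × ℝ => p.1 • F (polarCoord.symm p) :=
    continuous_fst.smul (hF.comp pol_cont)
  have hi : IntegrableOn (fun p : ℝ × ℝ => p.1 • F (polarCoord.symm p)) (Ioo 0 R ×ˢ Ioo (-π) π) :=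
    (hc.continuousOn.integrableOn_compact (isCompact_Icc.prod isCompact_Icc)).mono_set
      (prod_mono Ioo_subset_Icc_self Ioo_subset_Icc_self)
  rw [Measure.volume_eq_prod] at hi ⊢
  rw [setIntegral_prod _ hi, intervalIntegral.integral_of_le hR.le, integral_Ioc_eq_integral_Ioo]
  congr 1; ext r
  rw [intervalIntegral.integral_of_le (by linarith [Real.pi_pos]), integral_Ioc_eq_integral_Ioo]
  rfl

lemma polar_int' {F : ℝ × ℝ → ℝ} (hF : Continuous F) {R : ℝ} (hR : 0 < R)
    (h0 : ∀ y : ℝ × ℝ, R ^ 2 ≤ y.1 ^ 2 + y.2 ^ 2 → F y = 0) :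
    ∫ y, F y = ∫ θ in (-π)..π, ∫ r in (0:ℝ)..R, r * F (pol r θ) := by
  rw [polar_int hF hR h0]
  apply intervalIntegral_intervalIntegral_swap
  have hc : Continuous (Function.uncurry fun (r θ : ℝ) => r * F (pol r θ)) :=
    continuous_fst.mul (hF.comp pol_cont)
  exact (hc.continuousOn.integrableOn_compact (isCompact_uIcc.prod isCompact_uIcc)).mono_set
    (prod_mono uIoc_subset_uIcc uIoc_subset_uIcc)

section
variable {β : ℝ × ℝ → ℝ}

lemma deriv_pol_r (hβ : ContDiff ℝ 1 β) (r θ : ℝ) : HasDerivAt (fun r => β (pol r θ))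
    (Real.cos θ * (grad β (pol r θ)).1 + Real.sin θ * (grad β (pol r θ)).2) r := by
  have h1 : HasFDerivAt β (fderiv ℝ β (pol r θ)) (pol r θ) :=
    (hβ.differentiable one_ne_zero _).hasFDerivAt
  have h2 : HasDerivAt (fun r => pol r θ) (Real.cos θ, Real.sin θ) r := by
    unfold pol
    exact (by simpa using (hasDerivAt_id r).mul_const (Real.cos θ) : HasDerivAt (fun r => r * Real.cos θ) (Real.cos θ) r).prodMk
      (by simpa using (hasDerivAt_id r).mul_const (Real.sin θ) : HasDerivAt (fun r => r * Real.sin θ) (Real.sin θ) r)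
  have h3 := h1.comp_hasDerivAt r h2
  have e : fderiv ℝ β (pol r θ) (Real.cos θ, Real.sin θ) =
      Real.cos θ * (grad β (pol r θ)).1 + Real.sin θ * (grad β (pol r θ)).2 := by
    rw [show ((Real.cos θ, Real.sin θ) : ℝ × ℝ) = Real.cos θ • (1, 0) + Real.sin θ • (0, 1) by simp,
      map_add, map_smul, map_smul]; rfl
  rw [e] at h3; exact h3

lemma deriv_pol_θ (hβ : ContDiff ℝ 1 β) (r θ : ℝ) : HasDerivAt (fun θ => β (pol r θ))
    (r * (-Real.sin θ * (grad β (pol r θ)).1 + Real.cos θ * (grad β (pol r θ)).2)) θ := by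
  have h1 : HasFDerivAt β (fderiv ℝ β (pol r θ)) (pol r θ) :=
    (hβ.differentiable one_ne_zero _).hasFDerivAt
  have h2 : HasDerivAt (fun θ => pol r θ) (r * -Real.sin θ, r * Real.cos θ) θ := by
    unfold pol
    exact ((Real.hasDerivAt_cos θ).const_mul r).prodMk ((Real.hasDerivAt_sin θ).const_mul r)
  have h3 := h1.comp_hasDerivAt θ h2
  have e : fderiv ℝ β (pol r θ) (r * -Real.sin θ, r * Real.cos θ) =
      r * (-Real.sin θ * (grad β (pol r θ)).1 + Real.cos θ * (grad β (pol r θ)).2) := by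
    rw [show ((r * -Real.sin θ, r * Real.cos θ) : ℝ × ℝ) = (r * -Real.sin θ) • (1, 0) + (r * Real.cos θ) • (0, 1) by simp,
      map_add, map_smul, map_smul]
    simp only [smul_eq_mul, grad]; ring
  rw [e] at h3; exact h3

lemma rot_le (θ a b : ℝ) : (Real.cos θ * a + Real.sin θ * b) ^ 2 ≤ a ^ 2 + b ^ 2 := by
  nlinarith [Real.sin_sq_add_cos_sq θ, sq_nonneg (Real.sin θ * a - Real.cos θ * b)]

lemma rot_le' (θ a b : ℝ) : (-Real.sin θ * a + Real.cos θ * b) ^ 2 ≤ a ^ 2 + b ^ 2 := by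
  nlinarith [Real.sin_sq_add_cos_sq θ, sq_nonneg (Real.cos θ * a + Real.sin θ * b)]

lemma sum_sq_le {x y α γ X Y : ℝ} (hα : 0 ≤ α) (hγ : 0 ≤ γ) (hX : 0 ≤ X) (hY : 0 ≤ Y)
    (h1 : x ^ 2 ≤ α * X) (h2 : y ^ 2 ≤ γ * Y) : (x + y) ^ 2 ≤ (α + γ) * (X + Y) := by
  have h3 : (x * y) ^ 2 ≤ ((α * Y + γ * X) / 2) ^ 2 := by
    have : (x * y) ^ 2 ≤ (α * X) * (γ * Y) := by rw [mul_pow]; gcongr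
    nlinarith [sq_nonneg (α * Y - γ * X)]
  have h4 := abs_le.1 (abs_le_of_sq_le_sq h3 (by positivity))
  nlinarith [h4.2, h4.1]

lemma radial_bound (hβ : ContDiff ℝ 1 β) {F : ℝ × ℝ → ℝ} (hF : Continuous F) {R ρ r0 c l : ℝ}
    (hc : 0 < c) (hl : 0 < l) (h0 : 0 < r0) (h1 : r0 ≤ ρ) (h2 : ρ ≤ R)
    (hβR : ∀ y : ℝ × ℝ, R ^ 2 ≤ y.1 ^ 2 + y.2 ^ 2 → β y = 0)
    (hFc : ∀ y, c * ((grad β y).1 ^ 2 + (grad β y).2 ^ 2) ≤ F y)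
    (hFl : ∀ y : ℝ × ℝ, y.1 ^ 2 + y.2 ^ 2 ≤ ρ ^ 2 → l * ((grad β y).1 ^ 2 + (grad β y).2 ^ 2) ≤ F y)
    (θ : ℝ) : β (pol r0 θ) ^ 2 ≤ (Real.log (ρ / r0) / l + Real.log (R / ρ) / c) *
      ∫ r in (0:ℝ)..R, r * F (pol r θ) := by
  have hF0 : ∀ y, 0 ≤ F y := fun y => le_trans (by positivity) (hFc y)
  have hρ : 0 < ρ := h0.trans_le h1
  set g := fun r => Real.cos θ * (grad β (pol r θ)).1 + Real.sin θ * (grad β (pol r θ)).2 with hg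
  have hpc : Continuous fun r => pol r θ := pol_cont.comp (by fun_prop : Continuous fun r : ℝ => (r, θ))
  have hgc : Continuous g := by
    have := (grad_continuous hβ).comp hpc
    exact (continuous_const.mul (continuous_fst.comp this)).add (continuous_const.mul (continuous_snd.comp this))
  have hFr : Continuous fun r => r * F (pol r θ) := continuous_id.mul (hF.comp hpc)
  have ftc : ∀ a b, ∫ r in a..b, g r = β (pol b θ) - β (pol a θ) := fun a b =>
    intervalIntegral.integral_eq_sub_of_hasDerivAt (fun r _ => deriv_pol_r hβ r θ) (hgc.intervalIntegrable _ _)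
  have bnd : ∀ a b w : ℝ, 0 < a → a ≤ b → 0 < w →
      (∀ r ∈ Icc a b, w * ((grad β (pol r θ)).1 ^ 2 + (grad β (pol r θ)).2 ^ 2) ≤ F (pol r θ)) →
      (∫ r in a..b, g r) ^ 2 ≤ (Real.log (b / a) / w) * ∫ r in a..b, r * F (pol r θ) := by
    intro a b w ha hab hw hh
    refine (cs_interval ha hab hgc).trans ?_
    rw [div_mul_eq_mul_div, mul_div_assoc]
    have hlog : 0 ≤ Real.log (b / a) := Real.log_nonneg (by rw [le_div_iff₀ ha]; linarith)
    refine mul_le_mul_of_nonneg_left ?_ hlog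
    rw [le_div_iff₀ hw, ← intervalIntegral.integral_mul_const]
    refine intervalIntegral.integral_mono_on hab
      (((continuous_id.mul (hgc.pow 2)).mul continuous_const).intervalIntegrable _ _) (hFr.intervalIntegrable _ _) ?_
    intro r hr
    have hr0 : 0 ≤ r := ha.le.trans hr.1
    calc r * g r ^ 2 * w = r * (w * g r ^ 2) := by ring
      _ ≤ r * (w * ((grad β (pol r θ)).1 ^ 2 + (grad β (pol r θ)).2 ^ 2)) := by
          gcongr; exact rot_le _ _ _
      _ ≤ _ := by gcongr; exact hh r hr
  have b1 := bnd r0 ρ l h0 h1 hl (fun r hr => hFl _ (by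
    rw [pol_sq]; have := h0.le.trans hr.1; have := hr.2; gcongr))
  have b2 := bnd ρ R c hρ h2 hc (fun r hr => hFc _)
  have nn : ∀ a b : ℝ, 0 ≤ a → a ≤ b → 0 ≤ ∫ r in a..b, r * F (pol r θ) := fun a b ha hab =>
    intervalIntegral.integral_nonneg hab (fun r hr => mul_nonneg (ha.trans hr.1) (hF0 _))
  have b3 := sum_sq_le (div_nonneg (Real.log_nonneg (by rw [le_div_iff₀ h0]; linarith)) hl.le)
    (div_nonneg (Real.log_nonneg (by rw [le_div_iff₀ hρ]; linarith)) hc.le) (nn _ _ h0.le h1) (nn _ _ hρ.le h2) b1 b2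
  have e1 : (∫ r in r0..ρ, g r) + ∫ r in ρ..R, g r = - β (pol r0 θ) := by
    rw [ftc, ftc, hβR (pol R θ) (by rw [pol_sq])]; ring
  rw [e1, neg_sq, intervalIntegral.integral_add_adjacent_intervals (hFr.intervalIntegrable _ _)
    (hFr.intervalIntegrable _ _)] at b3
  refine b3.trans (mul_le_mul_of_nonneg_left ?_ ?_)
  · rw [← intervalIntegral.integral_add_adjacent_intervals (hFr.intervalIntegrable 0 r0) (hFr.intervalIntegrable r0 R)]
    linarith [nn 0 r0 le_rfl h0.le]
  · exact add_nonneg (div_nonneg (Real.log_nonneg (by rw [le_div_iff₀ h0]; linarith)) hl.le)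
      (div_nonneg (Real.log_nonneg (by rw [le_div_iff₀ hρ]; linarith)) hc.le)

/-- good circle -/
lemma good_circle (hβ : ContDiff ℝ 1 β) {F : ℝ × ℝ → ℝ} (hF : Continuous F) {R d c D : ℝ}
    (hc : 0 < c) (hd : 0 < d) (hdR : d ≤ R)
    (hFR : ∀ y : ℝ × ℝ, R ^ 2 ≤ y.1 ^ 2 + y.2 ^ 2 → F y = 0)
    (hFc : ∀ y, c * ((grad β y).1 ^ 2 + (grad β y).2 ^ 2) ≤ F y) (hD : ∫ y, F y ≤ D) :
    ∃ r ∈ Icc (d / 2) d, ∀ θ1 ∈ Icc (-π) π, ∀ θ2 ∈ Icc (-π) π,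
      β (pol r θ1) - Real.sqrt (2 * π * (D / (c * Real.log 2))) ≤ β (pol r θ2) := by
  have hF0 : ∀ y, 0 ≤ F y := fun y => le_trans (by positivity) (hFc y)
  have hR : 0 < R := hd.trans_le hdR
  have hpi := Real.pi_pos
  set g := fun r θ => r * (-Real.sin θ * (grad β (pol r θ)).1 + Real.cos θ * (grad β (pol r θ)).2) with hg
  have hgu : Continuous (Function.uncurry g) := by
    have := (grad_continuous hβ).comp pol_cont
    have h1 : Continuous fun z : ℝ × ℝ => (grad β (pol z.1 z.2)).1 := continuous_fst.comp this
    have h2 : Continuous fun z : ℝ × ℝ => (grad β (pol z.1 z.2)).2 := continuous_snd.comp this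
    change Continuous fun z : ℝ × ℝ => z.1 * (-Real.sin z.2 * (grad β (pol z.1 z.2)).1 + Real.cos z.2 * (grad β (pol z.1 z.2)).2)
    fun_prop
  have hgr : ∀ r, Continuous (g r) := fun r => hgu.comp (by fun_prop : Continuous fun θ : ℝ => (r, θ))
  set G := fun r => ∫ θ in (-π)..π, g r θ ^ 2 with hG
  have hGc : Continuous G := intervalIntegral.continuous_parametric_intervalIntegral_of_continuous'
    (f := fun r θ => g r θ ^ 2) ((continuous_pow 2).comp hgu) _ _
  have hHu : Continuous fun z : ℝ × ℝ => z.1 * F (pol z.1 z.2) := continuous_fst.mul (hF.comp pol_cont)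
  set H := fun r => ∫ θ in (-π)..π, r * F (pol r θ) with hH
  have hHc : Continuous H := intervalIntegral.continuous_parametric_intervalIntegral_of_continuous'
    (f := fun r θ => r * F (pol r θ)) hHu _ _
  have hHr : ∀ r, Continuous fun θ => r * F (pol r θ) := fun r => hHu.comp (by fun_prop : Continuous fun θ : ℝ => (r, θ))
  have hHn : ∀ r, 0 ≤ r → 0 ≤ H r := fun r hr => intervalIntegral.integral_nonneg (by linarith)
    (fun θ _ => mul_nonneg hr (hF0 _))
  have hIntg : ∫ r in (d/2)..d, H r ≤ D := by
    refine le_trans ?_ hD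
    rw [polar_int hF hR hFR]
    exact intervalIntegral.integral_mono_interval (by linarith) (by linarith) hdR
      ((ae_restrict_iff' measurableSet_Ioc).2 (Eventually.of_forall fun r hr => hHn r hr.1.le))
      (hHc.intervalIntegrable _ _)
  have hGH : ∀ r ∈ Icc (d/2) d, c * (G r * r⁻¹) ≤ H r := by
    intro r hr
    have hr0 : 0 < r := by linarith [hr.1]
    have : c * (G r * r⁻¹) = ∫ θ in (-π)..π, (c * r⁻¹) * g r θ ^ 2 := by
      rw [intervalIntegral.integral_const_mul]; ring
    rw [this]
    refine intervalIntegral.integral_mono_on (by linarith) ((continuous_const.mul ((hgr r).pow 2)).intervalIntegrable _ _)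
      ((hHr r).intervalIntegrable _ _) ?_
    intro θ _
    have e : c * r⁻¹ * g r θ ^ 2 = r * (c * (-Real.sin θ * (grad β (pol r θ)).1 + Real.cos θ * (grad β (pol r θ)).2) ^ 2) := by
      simp only [hg]; field_simp
    rw [e]
    refine mul_le_mul_of_nonneg_left (le_trans ?_ (hFc _)) hr0.le
    gcongr; exact rot_le' _ _ _
  have hl2 : 0 < Real.log 2 := Real.log_pos (by norm_num)
  obtain ⟨r, hr, hGr⟩ : ∃ r ∈ Icc (d/2) d, G r ≤ D / (c * Real.log 2) := by
    by_contra hcon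
    push Not at hcon
    have hinv : ∫ r in (d/2)..d, r⁻¹ = Real.log 2 := by
      rw [integral_inv]
      · congr 1; field_simp
      · rw [uIcc_of_le (by linarith)]; intro h; linarith [h.1]
    have hci : ContinuousOn (fun r : ℝ => r⁻¹) (Icc (d/2) d) :=
      continuousOn_id.inv₀ (fun r hr => by have := hr.1; simp only [id]; linarith)
    have : ∫ r in (d/2)..d, (D / (c * Real.log 2) * c) * r⁻¹ < ∫ r in (d/2)..d, H r := by
      refine intervalIntegral.integral_lt_integral_of_continuousOn_of_le_of_exists_lt (by linarith)
        (continuousOn_const.mul hci) hHc.continuousOn ?_ ?_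
      · intro r hr
        have hr' := Ioc_subset_Icc_self hr
        have hr0 : 0 < r := by linarith [hr.1]
        refine le_trans ?_ (hGH r hr')
        have := (hcon r hr').le
        calc _ = c * (D / (c * Real.log 2) * r⁻¹) := by ring
          _ ≤ _ := by gcongr
      · refine ⟨d, ⟨by linarith, le_rfl⟩, lt_of_lt_of_le ?_ (hGH d ⟨by linarith, le_rfl⟩)⟩
        have := hcon d ⟨by linarith, le_rfl⟩
        calc _ = c * (D / (c * Real.log 2) * d⁻¹) := by ring
          _ < _ := by gcongr
    rw [intervalIntegral.integral_const_mul, hinv] at this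
    have e : D / (c * Real.log 2) * c * Real.log 2 = D := by field_simp
    linarith
  refine ⟨r, hr, ?_⟩
  have ftc : ∀ a b, ∫ θ in a..b, g r θ = β (pol r b) - β (pol r a) := fun a b =>
    intervalIntegral.integral_eq_sub_of_hasDerivAt (fun θ _ => deriv_pol_θ hβ r θ) ((hgr r).intervalIntegrable _ _)
  have key : ∀ a b, -π ≤ a → a ≤ b → b ≤ π → (β (pol r b) - β (pol r a)) ^ 2 ≤ 2 * π * (D / (c * Real.log 2)) := by
    intro a b h1 h2 h3
    rw [← ftc]
    refine (cs_interval1 h2 (hgr r)).trans ?_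
    have m : ∫ θ in a..b, g r θ ^ 2 ≤ G r :=
      intervalIntegral.integral_mono_interval h1 h2 h3 (Eventually.of_forall fun θ => sq_nonneg _)
        (((hgr r).pow 2).intervalIntegrable _ _)
    have nn : 0 ≤ ∫ θ in a..b, g r θ ^ 2 := intervalIntegral.integral_nonneg h2 (fun _ _ => sq_nonneg _)
    exact mul_le_mul (by linarith) (m.trans hGr) nn (by linarith)
  intro θ1 h1 θ2 h2
  rcases le_total θ1 θ2 with h | h
  · have := Real.abs_le_sqrt (key θ1 θ2 h1.1 h h2.2)
    linarith [(abs_le.1 this).1]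
  · have := Real.abs_le_sqrt (key θ2 θ1 h2.1 h h1.2)
    linarith [(abs_le.1 this).2]

lemma cap (hβ : ContDiff ℝ 1 β) {F : ℝ × ℝ → ℝ} (hF : Continuous F) {R ρ d c l D m0 m : ℝ}
    (hc : 0 < c) (hl : 0 < l) (hd : 0 < d) (hdρ : d ≤ ρ) (hρR : ρ ≤ R)
    (hβR : ∀ y : ℝ × ℝ, R ^ 2 ≤ y.1 ^ 2 + y.2 ^ 2 → β y = 0)
    (hFR : ∀ y : ℝ × ℝ, R ^ 2 ≤ y.1 ^ 2 + y.2 ^ 2 → F y = 0)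
    (hFc : ∀ y, c * ((grad β y).1 ^ 2 + (grad β y).2 ^ 2) ≤ F y)
    (hFl : ∀ y : ℝ × ℝ, y.1 ^ 2 + y.2 ^ 2 ≤ ρ ^ 2 → l * ((grad β y).1 ^ 2 + (grad β y).2 ^ 2) ≤ F y)
    (hD : ∫ y, F y ≤ D) {A : Set (ℝ × ℝ)} (hA : IsPreconnected A) (h0 : (0, 0) ∈ A) {a : ℝ × ℝ} (ha : a ∈ A)
    (had : d ^ 2 ≤ a.1 ^ 2 + a.2 ^ 2) (hm0 : ∀ y ∈ A, m0 ≤ β y)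
    (hm : m = m0 - Real.sqrt (2 * π * (D / (c * Real.log 2)))) (hmn : 0 ≤ m) :
    2 * π * m ^ 2 ≤ (Real.log (2 * ρ / d) / l + Real.log (R / ρ) / c) * D := by
  have hpi := Real.pi_pos
  have hρ : 0 < ρ := hd.trans_le hdρ
  have hR : 0 < R := hρ.trans_le hρR
  obtain ⟨r, hr, hcirc⟩ := good_circle hβ hF hc hd (hdρ.trans hρR) hFR hFc hD
  have hr0 : 0 < r := by linarith [hr.1]
  -- circle meets A
  obtain ⟨θ0, hθ0, hθA⟩ : ∃ θ ∈ Icc (-π) π, pol r θ ∈ A := by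
    have hcont : ContinuousOn (fun y : ℝ × ℝ => y.1 ^ 2 + y.2 ^ 2) A := by fun_prop
    have := hA.intermediate_value h0 ha hcont
    obtain ⟨y, hy, hyr⟩ := this (show r ^ 2 ∈ Icc _ _ from ⟨by simp; positivity, by
      refine le_trans ?_ had; have := hr.2; gcongr⟩)
    simp only at hyr
    set z : ℂ := ⟨y.1, y.2⟩ with hz
    have hzn : ‖z‖ = r := by
      rw [Complex.norm_def, Complex.normSq_mk, ← sq, ← sq, hyr, Real.sqrt_sq hr0.le]
    refine ⟨Complex.arg z, ⟨(Complex.neg_pi_lt_arg z).le, Complex.arg_le_pi z⟩, ?_⟩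
    have : pol r (Complex.arg z) = y := by
      unfold pol
      rw [← hzn, Complex.norm_mul_cos_arg, Complex.norm_mul_sin_arg]
    rw [this]; exact hy
  have hlow : ∀ θ ∈ Icc (-π) π, m ≤ β (pol r θ) := fun θ hθ => by
    have := hcirc θ0 hθ0 θ hθ
    have := hm0 _ hθA
    linarith
  have hrad := radial_bound hβ hF hc hl hr0 (hr.2.trans hdρ) hρR hβR hFc hFl
  set G := Real.log (ρ / r) / l + Real.log (R / ρ) / c with hG
  have hHu : Continuous fun z : ℝ × ℝ => z.1 * F (pol z.1 z.2) := continuous_fst.mul (hF.comp pol_cont)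
  have hHc : Continuous fun θ => ∫ r in (0:ℝ)..R, r * F (pol r θ) :=
    intervalIntegral.continuous_parametric_intervalIntegral_of_continuous'
    (f := fun θ r => r * F (pol r θ)) (hHu.comp continuous_swap) _ _
  have h1 : ∫ θ in (-π)..π, m ^ 2 ≤ ∫ θ in (-π)..π, G * ∫ r in (0:ℝ)..R, r * F (pol r θ) := by
    refine intervalIntegral.integral_mono_on (by linarith) intervalIntegrable_const
      ((continuous_const.mul hHc).intervalIntegrable _ _) ?_
    intro θ hθ
    refine le_trans ?_ (hrad θ)
    have := hlow θ hθ
    gcongr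
  rw [intervalIntegral.integral_const_mul, ← polar_int' hF hR hFR, intervalIntegral.integral_const, smul_eq_mul] at h1
  have hF0 : ∀ y, 0 ≤ F y := fun y => le_trans (by positivity) (hFc y)
  have hI0 : 0 ≤ ∫ y, F y := integral_nonneg hF0
  have hD0 : 0 ≤ D := hI0.trans hD
  have hGle : G ≤ Real.log (2 * ρ / d) / l + Real.log (R / ρ) / c := by
    rw [hG]
    have : ρ / r ≤ 2 * ρ / d := by
      rw [div_le_div_iff₀ hr0 hd]; nlinarith [hr.1]
    have := Real.log_le_log (by positivity) this
    gcongr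
  have hlog2 : 0 ≤ Real.log (R / ρ) := Real.log_nonneg (by rw [le_div_iff₀ hρ]; linarith)
  have hlog1 : 0 ≤ Real.log (ρ / r) := Real.log_nonneg (by rw [le_div_iff₀ hr0]; linarith [hr.2])
  have hG0 : 0 ≤ G := by positivity
  calc 2 * π * m ^ 2 = (π - -π) * m ^ 2 := by ring
    _ ≤ G * ∫ y, F y := h1
    _ ≤ _ := mul_le_mul hGle hD hI0 (hG0.trans hGle)
end
end

/- Part 12 -/
noncomputable section
section
variable {k p : ℝ} {q : ℝ × ℝ → ℝ} {Ω : Set (ℝ × ℝ)}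

lemma chol (hk : 0 < k) (z : ℝ × ℝ) : ∃ s1 s2 s3 : ℝ, 0 < s1 ∧ 0 < s3 ∧ s1 * s3 = Real.sqrt (detKH k z) ∧
    ∀ v : ℝ × ℝ, KHform k z v v = (s1 * v.1 + s2 * v.2) ^ 2 + (s3 * v.2) ^ 2 := by
  have hden := den_pos hk z
  set A := (k ^ 2 + z.1 ^ 2 + z.2 ^ 2)⁻¹ * (k ^ 2 + z.2 ^ 2) with hA
  set B := (k ^ 2 + z.1 ^ 2 + z.2 ^ 2)⁻¹ * (-(z.1 * z.2)) with hB
  have hA0 : 0 < A := by positivity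
  have hdet := detKH_pos hk z
  refine ⟨Real.sqrt A, B / Real.sqrt A, Real.sqrt (detKH k z / A), Real.sqrt_pos.2 hA0,
    Real.sqrt_pos.2 (by positivity), ?_, ?_⟩
  · rw [← Real.sqrt_mul hA0.le, mul_div_cancel₀ _ hA0.ne']
  · intro v
    have hs : Real.sqrt A ^ 2 = A := Real.sq_sqrt hA0.le
    have hs0 : 0 < Real.sqrt A := Real.sqrt_pos.2 hA0
    have hs3 : Real.sqrt (detKH k z / A) ^ 2 = detKH k z / A := Real.sq_sqrt (by positivity)
    have e : (Real.sqrt A * v.1 + B / Real.sqrt A * v.2) ^ 2 + (Real.sqrt (detKH k z / A) * v.2) ^ 2 =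
        A * v.1 ^ 2 + 2 * B * v.1 * v.2 + (B ^ 2 / A + detKH k z / A) * v.2 ^ 2 := by
      have e1 : (Real.sqrt A * v.1 + B / Real.sqrt A * v.2) ^ 2 =
        Real.sqrt A ^ 2 * v.1 ^ 2 + 2 * B * v.1 * v.2 + B ^ 2 / Real.sqrt A ^ 2 * v.2 ^ 2 := by
        field_simp; ring
      rw [e1, mul_pow (Real.sqrt (detKH k z / A)), hs3, hs]; ring
    rw [e]
    have e2 : B ^ 2 / A + detKH k z / A = (k ^ 2 + z.1 ^ 2 + z.2 ^ 2)⁻¹ * (k ^ 2 + z.1 ^ 2) := by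
      rw [← add_div, div_eq_iff hA0.ne', hA, hB]
      unfold detKH
      field_simp
      ring
    rw [e2]
    unfold KHform
    rw [hA, hB]; ring

/-- lower triangular affine map -/
def Sm (a : ℝ × ℝ) (s1 s2 s3 : ℝ) (y : ℝ × ℝ) : ℝ × ℝ := (a.1 + s1 * y.1, a.2 + (s2 * y.1 + s3 * y.2))
def Si (a : ℝ × ℝ) (s1 s2 s3 : ℝ) (x : ℝ × ℝ) : ℝ × ℝ :=
  ((x.1 - a.1) / s1, ((x.2 - a.2) - s2 * ((x.1 - a.1) / s1)) / s3)

section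
variable {a : ℝ × ℝ} {s1 s2 s3 : ℝ}

lemma Sm_Si (h1 : 0 < s1) (h3 : 0 < s3) (x : ℝ × ℝ) : Sm a s1 s2 s3 (Si a s1 s2 s3 x) = x := by
  unfold Sm Si
  ext
  · simp only; field_simp; ring
  · simp only; field_simp; ring

lemma Si_Sm (h1 : 0 < s1) (h3 : 0 < s3) (y : ℝ × ℝ) : Si a s1 s2 s3 (Sm a s1 s2 s3 y) = y := by
  unfold Sm Si
  ext
  · simp only; field_simp; ring
  · simp only; field_simp; ring

lemma Sm_contDiff : ContDiff ℝ 1 (Sm a s1 s2 s3) := by unfold Sm; fun_prop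
lemma Si_contDiff : ContDiff ℝ 1 (Si a s1 s2 s3) := by
  unfold Si; simp only [div_eq_mul_inv]; fun_prop

def SmL (s1 s2 s3 : ℝ) : ℝ × ℝ →L[ℝ] ℝ × ℝ :=
  LinearMap.toContinuousLinearMap (Matrix.toLin (.finTwoProd ℝ) (.finTwoProd ℝ) !![s1, 0; s2, s3])

lemma SmL_apply (y : ℝ × ℝ) : SmL s1 s2 s3 y = (s1 * y.1, s2 * y.1 + s3 * y.2) := by
  unfold SmL
  rw [LinearMap.coe_toContinuousLinearMap', Matrix.toLin_finTwoProd_apply]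
  simp

lemma SmL_det : (SmL s1 s2 s3).det = s1 * s3 := by
  unfold SmL
  rw [LinearMap.det_toContinuousLinearMap, LinearMap.det_toLin, Matrix.det_fin_two_of]; ring

lemma Sm_hasFDerivAt (y : ℝ × ℝ) : HasFDerivAt (Sm a s1 s2 s3) (SmL s1 s2 s3) y := by
  have : Sm a s1 s2 s3 = fun y => a + SmL s1 s2 s3 y := by
    ext y <;> simp [Sm, SmL_apply]
  rw [this]
  exact (SmL s1 s2 s3).hasFDerivAt.const_add a

lemma grad_Sm {b : ℝ × ℝ → ℝ} (hb : ContDiff ℝ 1 b) (y : ℝ × ℝ) :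
    grad (fun y => b (Sm a s1 s2 s3 y)) y = (s1 * (grad b (Sm a s1 s2 s3 y)).1 + s2 * (grad b (Sm a s1 s2 s3 y)).2,
      s3 * (grad b (Sm a s1 s2 s3 y)).2) := by
  have h := ((hb.differentiable one_ne_zero (Sm a s1 s2 s3 y)).hasFDerivAt.comp y (Sm_hasFDerivAt y)).fderiv
  unfold grad
  change (fderiv ℝ (b ∘ Sm a s1 s2 s3) y _, fderiv ℝ (b ∘ Sm a s1 s2 s3) y _) = _
  rw [h]
  simp only [ContinuousLinearMap.comp_apply, SmL_apply]
  have e : ∀ v : ℝ × ℝ, fderiv ℝ b (Sm a s1 s2 s3 y) v =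
      v.1 * fderiv ℝ b (Sm a s1 s2 s3 y) (1, 0) + v.2 * fderiv ℝ b (Sm a s1 s2 s3 y) (0, 1) := by
    intro v
    conv_lhs => rw [show v = v.1 • ((1, 0) : ℝ × ℝ) + v.2 • ((0, 1) : ℝ × ℝ) by ext <;> simp]
    rw [map_add, map_smul, map_smul]; rfl
  rw [e (s1 * _, _), e (s1 * _, _)]
  simp

lemma Sm_int (h1 : 0 < s1) (h3 : 0 < s3) (G : ℝ × ℝ → ℝ) :
    ∫ y, (s1 * s3) * G (Sm a s1 s2 s3 y) = ∫ x, G x := by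
  have := integral_image_eq_integral_abs_det_fderiv_smul volume MeasurableSet.univ
    (f := Sm a s1 s2 s3) (f' := fun _ => SmL s1 s2 s3) (fun x _ => (Sm_hasFDerivAt x).hasFDerivWithinAt)
    (Function.LeftInverse.injective (Si_Sm h1 h3)).injOn G
  rw [image_univ, (Function.RightInverse.surjective (Sm_Si h1 h3)).range_eq] at this
  simp only [Measure.restrict_univ, SmL_det, smul_eq_mul, abs_of_pos (mul_pos h1 h3)] at this
  exact this.symm
end

lemma KHform_le (hk : 0 < k) (x v : ℝ × ℝ) : KHform k x v v ≤ v.1 ^ 2 + v.2 ^ 2 := by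
  rw [KHform_self, inv_mul_le_iff₀ (den_pos hk x)]
  nlinarith [sq_nonneg (x.1 * v.1 + x.2 * v.2)]

lemma KH_pos_lower (hk : 0 < k) (z v : ℝ × ℝ) : detKH k z * (v.1 ^ 2 + v.2 ^ 2) ≤ KHform k z v v := by
  have := KHform_lower hk z v le_rfl
  unfold detKH
  rw [add_assoc]; exact this

/-- local comparison -/
lemma KH_local (hk : 0 < k) (z : ℝ × ℝ) {δ : ℝ} (hδ : 0 < δ) :
    ∀ᶠ x in 𝓝 z, ∀ v : ℝ × ℝ, (1 - δ) * KHform k z v v ≤ KHform k x v v ∧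
      KHform k x v v ≤ (1 + δ) * KHform k z v v := by
  have hdet := detKH_pos hk z
  have hc : ∀ v : ℝ × ℝ, Continuous fun x => KHform k x v v := by
    intro v
    rw [← continuousOn_univ]
    exact KHform_continuousOn hk continuousOn_const continuousOn_const
  have hc2 : Continuous fun x => KHform k x (1, 0) (0, 1) := by
    rw [← continuousOn_univ]
    exact KHform_continuousOn hk continuousOn_const continuousOn_const
  set τ := δ * detKH k z / 3 with hτ
  have hτ0 : 0 < τ := by positivity
  have e1 := (hc (1, 0)).continuousAt.eventually (Metric.ball_mem_nhds (KHform k z (1, 0) (1, 0)) hτ0)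
  have e2 := (hc (0, 1)).continuousAt.eventually (Metric.ball_mem_nhds (KHform k z (0, 1) (0, 1)) hτ0)
  have e3 := hc2.continuousAt.eventually (Metric.ball_mem_nhds (KHform k z (1, 0) (0, 1)) hτ0)
  filter_upwards [e1, e2, e3] with x h1 h2 h3 v
  have ex : ∀ x, KHform k x v v = v.1 ^ 2 * KHform k x (1, 0) (1, 0) + 2 * (v.1 * v.2) * KHform k x (1, 0) (0, 1)
      + v.2 ^ 2 * KHform k x (0, 1) (0, 1) := by
    intro x; unfold KHform; simp; ring
  rw [Real.dist_eq] at h1 h2 h3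
  have hlow := KH_pos_lower hk z v
  have key : |KHform k x v v - KHform k z v v| ≤ δ * KHform k z v v := by
    have hd : KHform k x v v - KHform k z v v =
        v.1 ^ 2 * (KHform k x (1, 0) (1, 0) - KHform k z (1, 0) (1, 0)) +
        2 * (v.1 * v.2) * (KHform k x (1, 0) (0, 1) - KHform k z (1, 0) (0, 1)) +
        v.2 ^ 2 * (KHform k x (0, 1) (0, 1) - KHform k z (0, 1) (0, 1)) := by
      rw [ex x, ex z]; ring
    have hab : |2 * (v.1 * v.2)| ≤ v.1 ^ 2 + v.2 ^ 2 := by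
      rw [abs_le]; constructor <;> nlinarith [sq_nonneg (v.1 + v.2), sq_nonneg (v.1 - v.2)]
    rw [hd]
    refine (abs_add_three _ _ _).trans ?_
    rw [abs_mul, abs_mul (2 * (v.1 * v.2)), abs_mul (v.2 ^ 2), abs_of_nonneg (sq_nonneg v.1), abs_of_nonneg (sq_nonneg v.2)]
    have b1 : v.1 ^ 2 * |KHform k x (1, 0) (1, 0) - KHform k z (1, 0) (1, 0)| ≤ (v.1 ^ 2 + v.2 ^ 2) * τ :=
      mul_le_mul (by nlinarith) h1.le (abs_nonneg _) (by positivity)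
    have b2 : |2 * (v.1 * v.2)| * |KHform k x (1, 0) (0, 1) - KHform k z (1, 0) (0, 1)| ≤ (v.1 ^ 2 + v.2 ^ 2) * τ :=
      mul_le_mul hab h3.le (abs_nonneg _) (by positivity)
    have b3 : v.2 ^ 2 * |KHform k x (0, 1) (0, 1) - KHform k z (0, 1) (0, 1)| ≤ (v.1 ^ 2 + v.2 ^ 2) * τ :=
      mul_le_mul (by nlinarith) h2.le (abs_nonneg _) (by positivity)
    have : (v.1 ^ 2 + v.2 ^ 2) * τ * 3 = δ * (detKH k z * (v.1 ^ 2 + v.2 ^ 2)) := by rw [hτ]; ring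
    nlinarith
  rw [abs_le] at key
  constructor <;> linarith [key.1, key.2]

lemma sqrtdet_local (hk : 0 < k) (z : ℝ × ℝ) {δ : ℝ} (hδ : 0 < δ) :
    ∀ᶠ x in 𝓝 z, (1 - δ) * (Real.sqrt (detKH k z))⁻¹ ≤ (Real.sqrt (detKH k x))⁻¹ := by
  have hc : ContinuousAt (fun x => (Real.sqrt (detKH k x))⁻¹) z := ((sqrtdet_cont hk).inv₀ (fun x => (sqrtdet_pos hk x).ne')).continuousAt (x := z)
  have hp : 0 < (Real.sqrt (detKH k z))⁻¹ := inv_pos.2 (sqrtdet_pos hk z)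
  exact (hc.eventually (eventually_gt_nhds (by nlinarith : (1 - δ) * (Real.sqrt (detKH k z))⁻¹ < _))).mono
    fun x hx => hx.le

lemma sqrtdet_le_one (hk : 0 < k) (x : ℝ × ℝ) : Real.sqrt (detKH k x) ≤ 1 := by
  refine Real.sqrt_le_iff.2 ⟨by norm_num, ?_⟩
  rw [one_pow]
  unfold detKH
  rw [div_le_one (den_pos hk x)]
  nlinarith [sq_nonneg x.1, sq_nonneg x.2]

lemma capX (hD : Dom k p q Ω) (z : ℝ × ℝ) {l : ℝ} (hl : 0 < l) (hl1 : l < 1) :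
    ∃ c > 0, ∃ R > 0, ∃ ρ > 0, ρ ≤ R ∧ ∀ (b : ℝ × ℝ → ℝ) (D m0 m d : ℝ) (A : Set (ℝ × ℝ)) (a a' : ℝ × ℝ),
      TestFn Ω b → WEn k Ω b ≤ D → IsPreconnected A → A ⊆ Ω → a ∈ A → a' ∈ A → 0 < d →
      d ^ 2 ≤ (a'.1 - a.1) ^ 2 + (a'.2 - a.2) ^ 2 → (∀ x ∈ A, m0 ≤ b x) →
      m = m0 - Real.sqrt (2 * π * (D / (c * Real.log 2))) → 0 ≤ m →
      (d ≤ R → 2 * π * m ^ 2 ≤ (Real.log (2 * R / d) / c) * D) ∧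
      (dist a z < ρ → d ≤ ρ → 2 * π * m ^ 2 ≤ (Real.log (2 * ρ / d) / l + Real.log (R / ρ) / c) * D) := by
  have hk := hD.hk
  obtain ⟨s1, s2, s3, hs1, hs3, hdet, hform⟩ := chol hk z
  obtain ⟨R0, hR0, hR0b⟩ := bounded_sq hD.hb
  have hdz := sqrtdet_pos hk z
  set sd := Real.sqrt (detKH k z) with hsd
  set c := k ^ 2 / (k ^ 2 + R0) * sd with hcdef
  have hc : 0 < c := by positivity
  -- global comparison
  have hglob : ∀ x ∈ Ω, ∀ v : ℝ × ℝ, c * KHform k z v v ≤ sd * ((Real.sqrt (detKH k x))⁻¹ * KHform k x v v) := by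
    intro x hx v
    have h1 := KHform_lower hk x v (hR0b x hx)
    have h2 := KHform_le hk z v
    have h3 : 1 ≤ (Real.sqrt (detKH k x))⁻¹ := (one_le_inv₀ (sqrtdet_pos hk x)).2 (sqrtdet_le_one hk x)
    have h4 := KHform_nonneg hk x v
    have h5 : KHform k x v v ≤ (Real.sqrt (detKH k x))⁻¹ * KHform k x v v := by nlinarith
    calc c * KHform k z v v ≤ c * (v.1 ^ 2 + v.2 ^ 2) := by gcongr
      _ = sd * (k ^ 2 / (k ^ 2 + R0) * (v.1 ^ 2 + v.2 ^ 2)) := by rw [hcdef]; ring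
      _ ≤ _ := mul_le_mul_of_nonneg_left (h1.trans h5) hdz.le
  -- local comparison
  obtain ⟨δ, hδ, hδl⟩ : ∃ δ > 0, l ≤ (1 - δ) * (1 - δ) ∧ δ < 1 := by
    refine ⟨(1 - l) / 2, by linarith, ?_, by linarith⟩
    nlinarith
  obtain ⟨ρ1, hρ1, hloc⟩ := Metric.eventually_nhds_iff.1 ((KH_local hk z hδ).and (sqrtdet_local hk z hδ))
  have hloc' : ∀ x, dist x z < ρ1 → ∀ v : ℝ × ℝ,
      l * KHform k z v v ≤ sd * ((Real.sqrt (detKH k x))⁻¹ * KHform k x v v) := by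
    intro x hx v
    obtain ⟨h1, h2⟩ := hloc hx
    have h3 := (h1 v).1
    have h4 := KHform_nonneg hk z v
    have h5 : 0 ≤ 1 - δ := by linarith [hδl.2]
    have h6 : ((1 - δ) * sd⁻¹) * ((1 - δ) * KHform k z v v) ≤ (Real.sqrt (detKH k x))⁻¹ * KHform k x v v :=
      mul_le_mul h2 h3 (by positivity) (by have := sqrtdet_pos hk x; positivity)
    calc l * KHform k z v v ≤ ((1 - δ) * (1 - δ)) * KHform k z v v := by gcongr; exact hδl.1
      _ = sd * (((1 - δ) * sd⁻¹) * ((1 - δ) * KHform k z v v)) := by field_simp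
      _ ≤ _ := by gcongr
  -- size
  obtain ⟨R1, hR1⟩ : ∃ R1 : ℝ, ∀ a ∈ Ω, ∀ x ∈ Ω, (Si a s1 s2 s3 x).1 ^ 2 + (Si a s1 s2 s3 x).2 ^ 2 ≤ R1 := by
    have hcpt : IsCompact (closure Ω ×ˢ closure Ω) := hD.hb.isCompact_closure.prod hD.hb.isCompact_closure
    have hcont : Continuous fun w : (ℝ × ℝ) × (ℝ × ℝ) => (Si w.1 s1 s2 s3 w.2).1 ^ 2 + (Si w.1 s1 s2 s3 w.2).2 ^ 2 := by
      unfold Si; simp only [div_eq_mul_inv]; fun_prop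
    obtain ⟨C, hC⟩ := hcpt.bddAbove_image hcont.continuousOn
    exact ⟨C, fun a ha x hx => hC ⟨(a, x), ⟨subset_closure ha, subset_closure hx⟩, rfl⟩⟩
  set R := 1 + |R1| + ρ1 with hRdef
  have hRb : ∀ a ∈ Ω, ∀ y : ℝ × ℝ, R ^ 2 ≤ y.1 ^ 2 + y.2 ^ 2 → Sm a s1 s2 s3 y ∉ Ω := by
    intro a ha y hy hmem
    have := hR1 a ha _ hmem
    rw [Si_Sm hs1 hs3] at this
    nlinarith [le_abs_self R1, abs_nonneg R1]
  -- contraction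
  have hcontr : ∀ a y : ℝ × ℝ, ((Sm a s1 s2 s3 y).1 - a.1) ^ 2 + ((Sm a s1 s2 s3 y).2 - a.2) ^ 2 ≤ y.1 ^ 2 + y.2 ^ 2 := by
    intro a y
    set w : ℝ × ℝ := ((Sm a s1 s2 s3 y).1 - a.1, (Sm a s1 s2 s3 y).2 - a.2) with hw
    have hw1 : w.1 = s1 * y.1 := by simp [hw, Sm]
    have hw2 : w.2 = s2 * y.1 + s3 * y.2 := by simp [hw, Sm]
    have h1 : (s1 * w.1 + s2 * w.2) ^ 2 + (s3 * w.2) ^ 2 ≤ w.1 ^ 2 + w.2 ^ 2 := by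
      rw [← hform w]; exact KHform_le hk z w
    have h2 : w.1 ^ 2 + w.2 ^ 2 = y.1 * (s1 * w.1 + s2 * w.2) + y.2 * (s3 * w.2) := by
      have h3 : w.1 ^ 2 + w.2 ^ 2 = w.1 * (s1 * y.1) + w.2 * (s2 * y.1 + s3 * y.2) := by
        rw [← hw1, ← hw2]; ring
      rw [h3]; ring
    change w.1 ^ 2 + w.2 ^ 2 ≤ _
    nlinarith [sq_nonneg (y.1 - (s1 * w.1 + s2 * w.2)), sq_nonneg (y.2 - s3 * w.2)]
  refine ⟨c, hc, R, by positivity, ρ1 / 2, by positivity, by rw [hRdef]; linarith [abs_nonneg R1], ?_⟩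
  intro b D m0 m d A a a' hb hWD hA hAΩ ha ha' hd hda hm0 hm hmn
  have haΩ := hAΩ ha
  set β := fun y => b (Sm a s1 s2 s3 y) with hβ
  set G := fun x => (Real.sqrt (detKH k x))⁻¹ * KHform k x (grad b x) (grad b x) with hG
  set F := fun y => (s1 * s3) * G (Sm a s1 s2 s3 y) with hF
  have hβ1 : ContDiff ℝ 1 β := hb.1.comp Sm_contDiff
  have hGc : Continuous G := by
    have hgb := grad_continuous hb.1
    refine ((sqrtdet_cont hk).inv₀ (fun x => (sqrtdet_pos hk x).ne')).mul ?_
    rw [← continuousOn_univ]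
    exact KHform_continuousOn hk hgb.continuousOn hgb.continuousOn
  have hFc : Continuous F := continuous_const.mul (hGc.comp Sm_contDiff.continuous)
  have hgn : ∀ y, (grad β y).1 ^ 2 + (grad β y).2 ^ 2 =
      KHform k z (grad b (Sm a s1 s2 s3 y)) (grad b (Sm a s1 s2 s3 y)) := by
    intro y
    rw [hβ, grad_Sm hb.1, hform]
  have hFint : ∫ y, F y ≤ D := by
    rw [hF, Sm_int hs1 hs3 G]
    refine le_trans (le_of_eq ?_) hWD
    unfold WEn
    rw [setIntegral_eq_of_tsupport]
    intro x hx
    rw [hb.grad_eq_zero hx, KHform_zero_left, mul_zero]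
  have hβR : ∀ y : ℝ × ℝ, R ^ 2 ≤ y.1 ^ 2 + y.2 ^ 2 → β y = 0 := fun y hy => hb.eq_zero (hRb a haΩ y hy)
  have hFR : ∀ y : ℝ × ℝ, R ^ 2 ≤ y.1 ^ 2 + y.2 ^ 2 → F y = 0 := fun y hy => by
    simp only [hF, hG]
    rw [hb.grad_eq_zero (hRb a haΩ y hy), KHform_zero_left, mul_zero, mul_zero]
  have hFlow : ∀ y, c * ((grad β y).1 ^ 2 + (grad β y).2 ^ 2) ≤ F y := by
    intro y
    rw [hgn]
    simp only [hF, hG, hdet]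
    by_cases hy : Sm a s1 s2 s3 y ∈ Ω
    · exact hglob _ hy _
    · rw [hb.grad_eq_zero hy, KHform_zero_left, KHform_zero_left]; simp
  set A' := Si a s1 s2 s3 '' A with hA'
  have hA'c : IsPreconnected A' := hA.image _ Si_contDiff.continuous.continuousOn
  have h0A : ((0, 0) : ℝ × ℝ) ∈ A' := ⟨a, ha, by simp [Si]⟩
  have haA : Si a s1 s2 s3 a' ∈ A' := ⟨a', ha', rfl⟩
  have hdd : d ^ 2 ≤ (Si a s1 s2 s3 a').1 ^ 2 + (Si a s1 s2 s3 a').2 ^ 2 := by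
    have := hcontr a (Si a s1 s2 s3 a')
    rw [Sm_Si hs1 hs3] at this
    exact hda.trans this
  have hmA : ∀ y ∈ A', m0 ≤ β y := by
    rintro _ ⟨x, hx, rfl⟩
    simp only [hβ]
    rw [Sm_Si hs1 hs3]; exact hm0 x hx
  constructor
  · intro hdR
    have := cap hβ1 hFc hc hc hd hdR le_rfl hβR hFR hFlow (fun y _ => hFlow y) hFint hA'c h0A haA hdd hmA hm hmn
    rw [div_self (by positivity), Real.log_one, zero_div, add_zero] at this
    exact this
  · intro haz hdρ
    refine cap hβ1 hFc hc hl hd hdρ (by rw [hRdef]; linarith [abs_nonneg R1]) hβR hFR hFlow ?_ hFint hA'c h0A haA hdd hmA hm hmn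
    intro y hy
    rw [hgn]
    simp only [hF, hG, hdet]
    apply hloc'
    have h1 := (hcontr a y).trans hy
    have h2 : dist (Sm a s1 s2 s3 y) a ≤ ρ1 / 2 := by
      rw [Prod.dist_eq, max_le_iff, Real.dist_eq, Real.dist_eq]
      constructor
      · exact abs_le_of_sq_le_sq (by nlinarith [sq_nonneg ((Sm a s1 s2 s3 y).2 - a.2)]) (by positivity)
      · exact abs_le_of_sq_le_sq (by nlinarith [sq_nonneg ((Sm a s1 s2 s3 y).1 - a.1)]) (by positivity)
    linarith [dist_triangle (Sm a s1 s2 s3 y) a z]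
end
end

/- Part 13 -/
noncomputable section
section
variable {k p : ℝ} {q : ℝ × ℝ → ℝ} {Ω : Set (ℝ × ℝ)}

lemma chi_exists {d ρ : ℝ} (hd : 0 < d) (hρ : 0 < ρ) :
    ∃ χ : ℝ × ℝ → ℝ, ContDiff ℝ 1 χ ∧ (∀ y : ℝ × ℝ, d ^ 2 ≤ y.1 ^ 2 + y.2 ^ 2 → χ y = 0) ∧
      (∀ y : ℝ × ℝ, y.1 ^ 2 + y.2 ^ 2 ≤ ρ ^ 2 → Real.log ((d ^ 2 + ρ ^ 2) / ρ ^ 2) - 3 ≤ χ y) ∧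
      ∫ y, ((grad χ y).1 ^ 2 + (grad χ y).2 ^ 2) ≤ 4 * π * Real.log ((d ^ 2 + ρ ^ 2) / ρ ^ 2) := by
  set N : ℝ × ℝ → ℝ := fun y => y.1 ^ 2 + y.2 ^ 2 + ρ ^ 2 with hN
  have hNp : ∀ y, 0 < N y := fun y => by simp only [hN]; positivity
  set g : ℝ × ℝ → ℝ := fun y => Real.log (d ^ 2 + ρ ^ 2) - Real.log (N y) with hg
  have hNC : ContDiff ℝ 1 N := by simp only [hN]; fun_prop
  have hgC : ContDiff ℝ 1 g := contDiff_const.sub (hNC.log fun y => (hNp y).ne')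
  have hGC : ContDiff ℝ 1 (Gd 1) := by
    rw [contDiff_one_iff_deriv]
    refine ⟨fun t => (Gd_hasDerivAt one_pos t).differentiableAt, ?_⟩
    have : deriv (Gd 1) = Gd' 1 := funext fun t => (Gd_hasDerivAt one_pos t).deriv
    rw [this]; exact Gd'_continuous one_pos
  set χ := fun y => Gd 1 (g y) with hχ
  have hχC : ContDiff ℝ 1 χ := hGC.comp hgC
  have hgle : ∀ y : ℝ × ℝ, d ^ 2 ≤ y.1 ^ 2 + y.2 ^ 2 → g y ≤ 0 := by
    intro y hy
    simp only [hg, hN]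
    have := Real.log_le_log (by positivity : 0 < d ^ 2 + ρ ^ 2) (by linarith : d ^ 2 + ρ ^ 2 ≤ y.1 ^ 2 + y.2 ^ 2 + ρ ^ 2)
    linarith
  have hgN : ∀ y, grad N y = (2 * y.1, 2 * y.2) := by
    intro y
    have h1 : HasFDerivAt (fun y : ℝ × ℝ => y.1) (ContinuousLinearMap.fst ℝ ℝ ℝ) y := hasFDerivAt_fst
    have h2 : HasFDerivAt (fun y : ℝ × ℝ => y.2) (ContinuousLinearMap.snd ℝ ℝ ℝ) y := hasFDerivAt_snd
    have h := ((h1.pow 2).add (h2.pow 2)).add_const (ρ ^ 2)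
    have h' : HasFDerivAt N _ y := h
    unfold grad
    rw [h'.fderiv]
    simp
  have hgr : ∀ y, grad χ y = (-(Gd' 1 (g y) / N y) * (2 * y.1), -(Gd' 1 (g y) / N y) * (2 * y.2)) := by
    intro y
    have hd1 : HasDerivAt (fun t => Gd 1 (Real.log (d ^ 2 + ρ ^ 2) - Real.log t)) (Gd' 1 (g y) * (-(N y)⁻¹)) (N y) := by
      have h1 := ((Real.hasDerivAt_log (hNp y).ne').const_sub (Real.log (d ^ 2 + ρ ^ 2)))
      exact (Gd_hasDerivAt one_pos (g y)).comp (N y) h1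
    have := grad_comp (hNC.differentiable one_ne_zero y) hd1
    have e : (fun x => (fun t => Gd 1 (Real.log (d ^ 2 + ρ ^ 2) - Real.log t)) (N x)) = χ := rfl
    rw [e] at this
    rw [this, hgN]
    simp only [Prod.smul_mk, smul_eq_mul, div_eq_mul_inv]
    ext <;> simp only <;> ring
  have hsq : ∀ y, (grad χ y).1 ^ 2 + (grad χ y).2 ^ 2 ≤ 4 / N y := by
    intro y
    rw [hgr]
    simp only
    have h1 := Gd'_le 1 (g y)
    have h0 := Gd'_nonneg one_pos (g y)
    have h2 : (Gd' 1 (g y)) ^ 2 ≤ 1 := by nlinarith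
    have e : (-(Gd' 1 (g y) / N y) * (2 * y.1)) ^ 2 + (-(Gd' 1 (g y) / N y) * (2 * y.2)) ^ 2 =
      4 * ((Gd' 1 (g y)) ^ 2 * (y.1 ^ 2 + y.2 ^ 2)) / N y ^ 2 := by
      have := (hNp y).ne'
      field_simp; ring
    rw [e, div_le_div_iff₀ (by have := hNp y; positivity) (hNp y)]
    have h3 : (Gd' 1 (g y)) ^ 2 * (y.1 ^ 2 + y.2 ^ 2) ≤ N y := by
      have : y.1 ^ 2 + y.2 ^ 2 ≤ N y := by simp only [hN]; nlinarith
      nlinarith [sq_nonneg y.1, sq_nonneg y.2]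
    have := hNp y
    nlinarith [mul_le_mul_of_nonneg_right h3 this.le]
  have hF0 : ∀ y : ℝ × ℝ, d ^ 2 ≤ y.1 ^ 2 + y.2 ^ 2 → (grad χ y).1 ^ 2 + (grad χ y).2 ^ 2 = 0 := by
    intro y hy
    rw [hgr, Gd'_of_le one_pos (by linarith [hgle y hy])]
    simp
  refine ⟨χ, hχC, ?_, ?_, ?_⟩
  · intro y hy
    exact Gd_of_le (by linarith [hgle y hy])
  · intro y hy
    have h1 := Gd_ge one_pos (g y)
    have h2 : Real.log (N y) ≤ Real.log 2 + Real.log (ρ ^ 2) := by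
      rw [← Real.log_mul (by norm_num) (by positivity)]
      exact Real.log_le_log (hNp y) (by simp only [hN]; linarith)
    rw [Real.log_div (by positivity) (by positivity)]
    have h3 : Real.log 2 ≤ 1 := by linarith [Real.log_two_lt_d9]
    have h4 : g y = Real.log (d ^ 2 + ρ ^ 2) - Real.log (N y) := rfl
    simp only [hχ]; linarith
  · have hgc := grad_continuous hχC
    have hFc : Continuous fun y => (grad χ y).1 ^ 2 + (grad χ y).2 ^ 2 := by fun_prop
    rw [polar_int hFc hd hF0]
    have hin : ∀ r ∈ Icc (0:ℝ) d, (∫ θ in (-π)..π, r * ((grad χ (pol r θ)).1 ^ 2 + (grad χ (pol r θ)).2 ^ 2)) ≤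
        4 * π * (2 * r / (r ^ 2 + ρ ^ 2)) := by
      intro r hr
      have hpc : Continuous fun θ => pol r θ := pol_cont.comp (by fun_prop : Continuous fun θ : ℝ => (r, θ))
      have hc1 : Continuous fun θ => r * ((grad χ (pol r θ)).1 ^ 2 + (grad χ (pol r θ)).2 ^ 2) :=
        continuous_const.mul (hFc.comp hpc)
      have := intervalIntegral.integral_mono_on (μ := volume) (a := -π) (b := π) (by linarith [Real.pi_pos]) (hc1.intervalIntegrable _ _)
        (continuous_const.intervalIntegrable _ _) (g := fun _ => r * (4 / (r ^ 2 + ρ ^ 2))) (fun θ _ => by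
          have h1 := hsq (pol r θ)
          have h2 : N (pol r θ) = r ^ 2 + ρ ^ 2 := by simp only [hN]; rw [pol_sq]
          rw [h2] at h1
          exact mul_le_mul_of_nonneg_left h1 hr.1)
      refine this.trans (le_of_eq ?_)
      rw [intervalIntegral.integral_const, smul_eq_mul]; ring
    have hder : ∀ r : ℝ, HasDerivAt (fun r => 4 * π * Real.log (r ^ 2 + ρ ^ 2)) (4 * π * (2 * r / (r ^ 2 + ρ ^ 2))) r := by
      intro r
      have h1 : HasDerivAt (fun r : ℝ => r ^ 2 + ρ ^ 2) (2 * r) r := by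
        simpa using (hasDerivAt_pow 2 r).add_const (ρ ^ 2)
      exact (h1.log (by positivity)).const_mul _
    have hc2 : Continuous fun r : ℝ => 4 * π * (2 * r / (r ^ 2 + ρ ^ 2)) := by
      have : ∀ r : ℝ, r ^ 2 + ρ ^ 2 ≠ 0 := fun r => by positivity
      fun_prop (disch := assumption)
    have hc3 : Continuous fun r => ∫ θ in (-π)..π, r * ((grad χ (pol r θ)).1 ^ 2 + (grad χ (pol r θ)).2 ^ 2) := by
      apply intervalIntegral.continuous_parametric_intervalIntegral_of_continuous'
      exact continuous_fst.mul (hFc.comp pol_cont)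
    have := intervalIntegral.integral_mono_on (μ := volume) hd.le (hc3.intervalIntegrable 0 d) (hc2.intervalIntegrable 0 d) hin
    refine this.trans (le_of_eq ?_)
    rw [intervalIntegral.integral_eq_sub_of_hasDerivAt (fun r _ => hder r) (hc2.intervalIntegrable _ _),
      Real.log_div (by positivity) (by positivity)]
    simp; ring

lemma Sm_contr (hk : 0 < k) (z : ℝ × ℝ) {s1 s2 s3 : ℝ}
    (hform : ∀ v : ℝ × ℝ, KHform k z v v = (s1 * v.1 + s2 * v.2) ^ 2 + (s3 * v.2) ^ 2) (a y : ℝ × ℝ) :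
    ((Sm a s1 s2 s3 y).1 - a.1) ^ 2 + ((Sm a s1 s2 s3 y).2 - a.2) ^ 2 ≤ y.1 ^ 2 + y.2 ^ 2 := by
  set w : ℝ × ℝ := ((Sm a s1 s2 s3 y).1 - a.1, (Sm a s1 s2 s3 y).2 - a.2) with hw
  have hw1 : w.1 = s1 * y.1 := by simp [hw, Sm]
  have hw2 : w.2 = s2 * y.1 + s3 * y.2 := by simp [hw, Sm]
  have h1 : (s1 * w.1 + s2 * w.2) ^ 2 + (s3 * w.2) ^ 2 ≤ w.1 ^ 2 + w.2 ^ 2 := by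
    rw [← hform w]; exact KHform_le hk z w
  have h2 : w.1 ^ 2 + w.2 ^ 2 = y.1 * (s1 * w.1 + s2 * w.2) + y.2 * (s3 * w.2) := by
    have h3 : w.1 ^ 2 + w.2 ^ 2 = w.1 * (s1 * y.1) + w.2 * (s2 * y.1 + s3 * y.2) := by
      rw [← hw1, ← hw2]; ring
    rw [h3]; ring
  change w.1 ^ 2 + w.2 ^ 2 ≤ _
  nlinarith [sq_nonneg (y.1 - (s1 * w.1 + s2 * w.2)), sq_nonneg (y.2 - s3 * w.2)]

lemma test_exists (hD : Dom k p q Ω) {x0 : ℝ × ℝ} (hx0 : x0 ∈ Ω) {δ : ℝ} (hδ : 0 < δ) :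
    ∃ d > 0, ∀ ρ, 0 < ρ → ρ ≤ d → ∃ φ, TestFn Ω φ ∧
      En k Ω φ φ ≤ (1 + δ) * Real.sqrt (detKH k x0) * (4 * π * Real.log ((d ^ 2 + ρ ^ 2) / ρ ^ 2)) ∧
      ∃ S, MeasurableSet S ∧ S ⊆ Ω ∧ volume.real S = Real.sqrt (detKH k x0) * ρ ^ 2 ∧
        ∀ x ∈ S, Real.log ((d ^ 2 + ρ ^ 2) / ρ ^ 2) - 3 ≤ φ x ∧ q x ≤ (1 + δ) * q x0 := by
  have hk := hD.hk
  obtain ⟨s1, s2, s3, hs1, hs3, hdet, hform⟩ := chol hk x0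
  have hq0 := hD.hq3 x0 (subset_closure hx0)
  have hqc : ContinuousAt q x0 := (hD.hqC1.continuousOn).continuousAt (hD.ho.mem_nhds hx0)
  have ev1 := hqc.eventually (eventually_lt_nhds (by nlinarith : q x0 < (1 + δ) * q x0))
  obtain ⟨r, hr, hloc⟩ := Metric.eventually_nhds_iff.1 (((KH_local hk x0 hδ).and ev1).and (hD.ho.mem_nhds hx0))
  refine ⟨r / 2, by positivity, ?_⟩
  intro ρ hρ hρd
  set d := r / 2 with hd
  have hd0 : 0 < d := by positivity
  obtain ⟨χ, hχ1, hχ0, hχρ, hχE⟩ := chi_exists hd0 hρ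
  have hnear : ∀ y : ℝ × ℝ, y.1 ^ 2 + y.2 ^ 2 ≤ d ^ 2 → dist (Sm x0 s1 s2 s3 y) x0 < r := by
    intro y hy
    have h1 := (Sm_contr hk x0 hform x0 y).trans hy
    have h2 : dist (Sm x0 s1 s2 s3 y) x0 ≤ d := by
      rw [Prod.dist_eq, max_le_iff, Real.dist_eq, Real.dist_eq]
      constructor
      · exact abs_le_of_sq_le_sq (by nlinarith [sq_nonneg ((Sm x0 s1 s2 s3 y).2 - x0.2)]) hd0.le
      · exact abs_le_of_sq_le_sq (by nlinarith [sq_nonneg ((Sm x0 s1 s2 s3 y).1 - x0.1)]) hd0.le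
    linarith
  have hnear' : ∀ x : ℝ × ℝ, (Si x0 s1 s2 s3 x).1 ^ 2 + (Si x0 s1 s2 s3 x).2 ^ 2 ≤ d ^ 2 → dist x x0 < r := by
    intro x hx
    have := hnear _ hx
    rwa [Sm_Si hs1 hs3] at this
  set φ := fun x => χ (Si x0 s1 s2 s3 x) with hφ
  have hφ1 : ContDiff ℝ 1 φ := hχ1.comp Si_contDiff
  have hT0 : TestFn (Metric.ball x0 r) φ := by
    have hcl : IsCompact (Sm x0 s1 s2 s3 '' {y : ℝ × ℝ | y.1 ^ 2 + y.2 ^ 2 ≤ d ^ 2}) := by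
      refine IsCompact.image ?_ Sm_contDiff.continuous
      refine Metric.isCompact_of_isClosed_isBounded ?_ ?_
      · exact isClosed_le (by fun_prop) continuous_const
      · refine (Metric.isBounded_closedBall (x := (0 : ℝ × ℝ)) (r := d)).subset ?_
        intro y hy
        change y.1 ^ 2 + y.2 ^ 2 ≤ d ^ 2 at hy
        rw [mem_closedBall_zero_iff, Prod.norm_def, max_le_iff, Real.norm_eq_abs, Real.norm_eq_abs]
        constructor
        · exact abs_le_of_sq_le_sq (by nlinarith [sq_nonneg y.2]) hd0.le
        · exact abs_le_of_sq_le_sq (by nlinarith [sq_nonneg y.1]) hd0.le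
    refine TestFn.of_eq_zero hφ1 hcl ?_ ?_
    · rintro _ ⟨y, hy, rfl⟩
      exact hnear y hy
    · intro x hx
      apply hχ0
      by_contra hcon
      push Not at hcon
      exact hx ⟨Si x0 s1 s2 s3 x, hcon.le, Sm_Si hs1 hs3 x⟩
  have hT : TestFn Ω φ := hT0.mono fun x hx => (hloc hx).2
  refine ⟨φ, hT, ?_, ?_⟩
  · have hgc := grad_continuous hφ1
    have hcomp : (fun y => φ (Sm x0 s1 s2 s3 y)) = χ := by
      funext y; simp only [hφ]; rw [Si_Sm hs1 hs3]
    have hgn : ∀ y, (grad χ y).1 ^ 2 + (grad χ y).2 ^ 2 =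
        KHform k x0 (grad φ (Sm x0 s1 s2 s3 y)) (grad φ (Sm x0 s1 s2 s3 y)) := by
      intro y
      rw [← hcomp, grad_Sm hφ1, hform]
    have hK0 : Continuous fun x => KHform k x0 (grad φ x) (grad φ x) := by
      have : (fun x => KHform k x0 (grad φ x) (grad φ x)) =
          fun x => (s1 * (grad φ x).1 + s2 * (grad φ x).2) ^ 2 + (s3 * (grad φ x).2) ^ 2 := funext fun x => hform _
      rw [this]; fun_prop
    have hK0i : Integrable fun x => KHform k x0 (grad φ x) (grad φ x) := by
      refine hK0.integrable_of_hasCompactSupport (HasCompactSupport.intro hT.2.1 ?_)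
      intro x hx
      rw [grad_zero_of_notMem hx, KHform_zero_left]
    have h1 : En k Ω φ φ ≤ ∫ x, (1 + δ) * KHform k x0 (grad φ x) (grad φ x) := by
      unfold En
      rw [setIntegral_eq_of_tsupport (fun x hx => by rw [hT.grad_eq_zero hx, KHform_zero_left])]
      refine integral_mono (hT.integrable_form hk hT) (hK0i.const_mul _) ?_
      intro x
      by_cases hx : x ∈ Metric.ball x0 r
      · exact ((hloc hx).1.1 _).2
      · simp only
        rw [hT0.grad_eq_zero hx, KHform_zero_left, KHform_zero_left, mul_zero]
    rw [integral_const_mul, ← Sm_int hs1 hs3 (a := x0) (s2 := s2), integral_const_mul, hdet] at h1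
    simp only [← hgn] at h1
    refine h1.trans ?_
    rw [mul_assoc]
    have := sqrtdet_pos hk x0
    gcongr
  · set sq : Set (ℝ × ℝ) := Icc (-(ρ / 2)) (ρ / 2) ×ˢ Icc (-(ρ / 2)) (ρ / 2) with hsq
    have hsqm : MeasurableSet sq := measurableSet_Icc.prod measurableSet_Icc
    have hSm : MeasurableSet (Si x0 s1 s2 s3 ⁻¹' sq) := Si_contDiff.continuous.measurable hsqm
    have hsqle : ∀ y ∈ sq, y.1 ^ 2 + y.2 ^ 2 ≤ ρ ^ 2 := by
      rintro y ⟨⟨h1, h2⟩, h3, h4⟩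
      nlinarith
    have hρd2 : ρ ^ 2 ≤ d ^ 2 := by gcongr
    refine ⟨Si x0 s1 s2 s3 ⁻¹' sq, hSm, ?_, ?_, ?_⟩
    · intro x hx
      exact (hloc (hnear' x ((hsqle _ hx).trans hρd2))).2
    · have h1 := Sm_int hs1 hs3 (a := x0) (s2 := s2) ((Si x0 s1 s2 s3 ⁻¹' sq).indicator fun _ => (1:ℝ))
      have h2 : ∀ y, (Si x0 s1 s2 s3 ⁻¹' sq).indicator (fun _ => (1:ℝ)) (Sm x0 s1 s2 s3 y) = sq.indicator (fun _ => (1:ℝ)) y := by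
        intro y
        simp only [indicator, mem_preimage, Si_Sm hs1 hs3]
      simp only [h2] at h1
      rw [integral_const_mul, integral_indicator hsqm, integral_indicator hSm, setIntegral_const, setIntegral_const,
        smul_eq_mul, smul_eq_mul, mul_one, mul_one, hdet] at h1
      rw [← h1]
      congr 1
      rw [hsq, Measure.volume_eq_prod, measureReal_prod_prod, Real.volume_real_Icc_of_le (by linarith)]
      ring
    · intro x hx
      exact ⟨hχρ _ (hsqle _ hx), (hloc (hnear' x ((hsqle _ hx).trans hρd2))).1.2.le⟩
end
end

/- Part 14 -/
noncomputable section
section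
variable {k p : ℝ} {q : ℝ × ℝ → ℝ} {Ω : Set (ℝ × ℝ)}

lemma tendsto_L : Tendsto (fun ε : ℝ => Real.log (1 / ε)) (𝓝[>] 0) atTop := by
  simp only [one_div]
  exact Real.tendsto_log_atTop.comp tendsto_inv_nhdsGT_zero

set_option maxHeartbeats 1600000 in
lemma upper_pt (hD : Dom k p q Ω) {x0 : ℝ × ℝ} (hx0 : x0 ∈ Ω) {η : ℝ} (hη : 0 < η) :
    ∀ᶠ ε in 𝓝[>] (0:ℝ), (cset k p q Ω ε).Nonempty ∧ ceps k p q Ω ε ≤ (π * Qfun k q x0 + η) * Real.log (1 / ε) := by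
  have hk := hD.hk
  have hp := hD.hp
  have hq0 := hD.hq3 x0 (subset_closure hx0)
  have hs0 := sqrtdet_pos hk x0
  set s0 := Real.sqrt (detKH k x0) with hs0def
  set Q := Qfun k q x0 with hQ
  have hQ0 : 0 < Q := by rw [hQ]; unfold Qfun; positivity
  obtain ⟨δ, hδ, hδ2, hδQ⟩ : ∃ δ > 0, δ < 1 / 2 ∧ π * Q * (1 + δ) ^ 5 / (1 - 2 * δ) < π * Q + η := by
    have hc : ContinuousAt (fun δ : ℝ => π * Q * (1 + δ) ^ 5 / (1 - 2 * δ)) 0 := by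
      apply ContinuousAt.div
      · fun_prop
      · fun_prop
      · norm_num
    have h1 := hc.eventually (eventually_lt_nhds (by simp; exact hη : (fun δ : ℝ => π * Q * (1 + δ) ^ 5 / (1 - 2 * δ)) 0 < π * Q + η))
    have h2 : ∀ᶠ δ : ℝ in 𝓝 0, δ < 1 / 2 := eventually_lt_nhds (by norm_num)
    obtain ⟨δ, h3, h4⟩ := (((h1.and h2).filter_mono nhdsWithin_le_nhds).and (self_mem_nhdsWithin (s := Ioi (0:ℝ)))).exists
    exact ⟨δ, h4, h3.2, h3.1⟩
  obtain ⟨d, hd, hT⟩ := test_exists hD hx0 hδ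
  have hLt := tendsto_L
  have hδ' : 0 < 1 - 2 * δ := by linarith
  -- scalar conditions
  have c1 : ∀ᶠ L : ℝ in atTop, 0 < L := eventually_gt_atTop 0
  have c2 : ∀ᶠ L : ℝ in atTop, Real.exp (-((1 - δ) * L)) ≤ d := by
    have : Tendsto (fun L : ℝ => Real.exp (-((1 - δ) * L))) atTop (𝓝 0) :=
      Real.tendsto_exp_neg_atTop_nhds_zero.comp (tendsto_id.const_mul_atTop (by linarith))
    exact this.eventually (eventually_le_nhds hd)
  have c3 : ∀ᶠ L : ℝ in atTop, 3 - 2 * Real.log d ≤ 2 * δ * L :=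
    (tendsto_id.const_mul_atTop (by positivity)).eventually (eventually_ge_atTop _)
  have c4 : ∀ᶠ L : ℝ in atTop, 2 * π * Q * (1 + δ) ^ 5 * (1 / (2 * (1 - 2 * δ)) + 3 / (4 * (1 - 2 * δ) ^ 2) * L⁻¹) < π * Q + η := by
    have : Tendsto (fun L : ℝ => 2 * π * Q * (1 + δ) ^ 5 * (1 / (2 * (1 - 2 * δ)) + 3 / (4 * (1 - 2 * δ) ^ 2) * L⁻¹)) atTop
        (𝓝 (2 * π * Q * (1 + δ) ^ 5 * (1 / (2 * (1 - 2 * δ)) + 3 / (4 * (1 - 2 * δ) ^ 2) * 0))) :=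
      (((tendsto_inv_atTop_zero).const_mul _).const_add _).const_mul _
    refine this.eventually (eventually_lt_nhds ?_)
    refine lt_of_eq_of_lt ?_ hδQ
    field_simp; ring
  have c5 : ∀ᶠ L : ℝ in atTop, 1 ≤ δ * ((1 + δ) * q x0) * L :=
    (tendsto_id.const_mul_atTop (by positivity)).eventually (eventually_ge_atTop _)
  have c6 : ∀ᶠ L : ℝ in atTop, (π * Q + η) * L < s0 / (p + 1) * Real.exp (2 * δ * L) := by
    have : Tendsto (fun L : ℝ => L ^ 1 * Real.exp (-(2 * δ) * L)) atTop (𝓝 0) := by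
      have := _root_.tendsto_rpow_mul_exp_neg_mul_atTop_nhds_zero 1 (2 * δ) (by positivity)
      simpa using this
    have h1 : 0 < s0 / (p + 1) / (π * Q + η) := by positivity
    filter_upwards [this.eventually (eventually_lt_nhds h1)] with L hL
    have e : Real.exp (-(2 * δ) * L) * Real.exp (2 * δ * L) = 1 := by rw [← Real.exp_add]; simp
    have h2 := mul_lt_mul_of_pos_right hL (Real.exp_pos (2 * δ * L))
    rw [mul_assoc, e, mul_one, pow_one, div_mul_eq_mul_div, lt_div_iff₀ (by positivity)] at h2
    linarith
  have hev := hLt.eventually (c1.and (c2.and (c3.and (c4.and (c5.and c6)))))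
  have hlt1 : ∀ᶠ ε : ℝ in 𝓝[>] 0, ε < 1 := (eventually_lt_nhds one_pos).filter_mono nhdsWithin_le_nhds
  filter_upwards [hev, hlt1, self_mem_nhdsWithin] with ε hε hε1 hε0
  change 0 < ε at hε0
  obtain ⟨hL0, hρd, h3, h4, h5, h6⟩ := hε
  set L := Real.log (1 / ε) with hL
  set ρ := Real.exp (-((1 - δ) * L)) with hρ
  have hρ0 : 0 < ρ := Real.exp_pos _
  obtain ⟨φ, hφT, hφE, S, hSm, hSΩ, hSv, hSφ⟩ := hT ρ hρ0 hρd
  set Λ := Real.log ((d ^ 2 + ρ ^ 2) / ρ ^ 2) with hΛ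
  set X := Λ - 3 with hX
  have hlogρ : Real.log ρ = -((1 - δ) * L) := by rw [hρ, Real.log_exp]
  have hΛge : 2 * (1 - δ) * L + 2 * Real.log d ≤ Λ := by
    rw [hΛ, Real.log_div (by positivity) (by positivity), Real.log_pow, hlogρ]
    have : Real.log (d ^ 2) ≤ Real.log (d ^ 2 + ρ ^ 2) := Real.log_le_log (by positivity) (by nlinarith)
    rw [Real.log_pow] at this
    push_cast at this ⊢
    linarith
  have hXge : 2 * (1 - 2 * δ) * L ≤ X := by rw [hX]; nlinarith
  have hX0 : 0 < X := lt_of_lt_of_le (by positivity) hXge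
  set qb := (1 + δ) * q x0 with hqb
  have hqb0 : 0 < qb := by positivity
  set τ := (1 + δ) * qb * L / X with hτ
  have hτ0 : 0 < τ := by positivity
  set ψ := fun x => τ * φ x with hψ
  have hψT : TestFn Ω ψ := hφT.const_mul τ
  have hψE : En k Ω ψ ψ = τ ^ 2 * En k Ω φ φ := by
    unfold En
    rw [← integral_const_mul]
    congr 1; funext x
    rw [hψ, grad_const_mul (hφT.diff x), KHform_smul_left, KHform_smul_right]; ring
  have hQe : Q = q x0 ^ 2 * s0 := rfl
  have hEle : 1 / 2 * En k Ω ψ ψ ≤ (π * Q + η) * L := by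
    have b1 : 1 / 2 * En k Ω ψ ψ ≤ 1 / 2 * (τ ^ 2 * ((1 + δ) * s0 * (4 * π * Λ))) := by
      rw [hψE]; gcongr
    have b2 : 1 / 2 * (τ ^ 2 * ((1 + δ) * s0 * (4 * π * Λ))) =
        (2 * π * Q * (1 + δ) ^ 5) * L ^ 2 * (1 / X + 3 / X ^ 2) := by
      have : Λ = X + 3 := by rw [hX]; ring
      rw [this, hτ, hqb, hQe]
      field_simp
      norm_num
    have b3 : 1 / X + 3 / X ^ 2 ≤ 1 / (2 * (1 - 2 * δ) * L) + 3 / (2 * (1 - 2 * δ) * L) ^ 2 := by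
      gcongr
    have b4 : (2 * π * Q * (1 + δ) ^ 5) * L ^ 2 * (1 / (2 * (1 - 2 * δ) * L) + 3 / (2 * (1 - 2 * δ) * L) ^ 2) =
        2 * π * Q * (1 + δ) ^ 5 * (1 / (2 * (1 - 2 * δ)) + 3 / (4 * (1 - 2 * δ) ^ 2) * L⁻¹) * L := by
      field_simp; ring
    calc _ ≤ _ := b1
      _ = _ := b2
      _ ≤ (2 * π * Q * (1 + δ) ^ 5) * L ^ 2 * (1 / (2 * (1 - 2 * δ) * L) + 3 / (2 * (1 - 2 * δ) * L) ^ 2) := by gcongr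
      _ = _ := b4
      _ ≤ _ := by gcongr
  have hneg : Ieps k p ε q Ω ψ < 0 := by
    have hpos : volume.real S ≤ ∫ x in Ω, pPart (ψ x - q x * L) ^ (p + 1) := by
      have hcont : ContinuousOn (fun x => pPart (ψ x - q x * L) ^ (p + 1)) (closure Ω) := by
        have h1 : ContinuousOn (fun x => ψ x - q x * L) (closure Ω) :=
          hψT.1.continuous.continuousOn.sub (hD.hqc.mul continuousOn_const)
        exact (h1.sup continuousOn_const).rpow_const (fun x _ => Or.inr (by linarith))
      have hIntg : IntegrableOn (fun x => pPart (ψ x - q x * L) ^ (p + 1)) Ω :=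
        (hcont.integrableOn_compact hD.hb.isCompact_closure).mono_set subset_closure
      have hnn : ∀ x, 0 ≤ pPart (ψ x - q x * L) ^ (p + 1) := fun x => Real.rpow_nonneg (le_max_right _ _) _
      have hSfin : volume S ≠ ⊤ := (measure_mono hSΩ).trans_lt hD.hb.measure_lt_top |>.ne
      calc volume.real S = ∫ x in S, (1:ℝ) := by rw [setIntegral_const]; simp
        _ ≤ ∫ x in S, pPart (ψ x - q x * L) ^ (p + 1) := by
          refine setIntegral_mono_on (integrableOn_const hSfin) (hIntg.mono_set hSΩ) hSm ?_
          intro x hx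
          obtain ⟨g1, g2⟩ := hSφ x hx
          apply Real.one_le_rpow _ (by linarith)
          refine le_trans ?_ (le_max_left _ _)
          have g3 : τ * X ≤ ψ x := mul_le_mul_of_nonneg_left g1 hτ0.le
          have g4 : τ * X = (1 + δ) * qb * L := by rw [hτ]; field_simp
          have g5 : q x * L ≤ qb * L := mul_le_mul_of_nonneg_right g2 hL0.le
          nlinarith
        _ ≤ _ := setIntegral_mono_set hIntg (ae_of_all _ hnn) hSΩ.eventuallyLE
    unfold Ieps
    have hε2 : 0 < 1 / ((p + 1) * ε ^ 2) := by positivity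
    have h7 : 1 / ((p + 1) * ε ^ 2) * volume.real S = s0 / (p + 1) * Real.exp (2 * δ * L) := by
      have hεL : ε = Real.exp (-L) := by
        rw [hL, one_div, Real.log_inv, neg_neg, Real.exp_log hε0]
      rw [hSv, hρ, hεL, ← Real.exp_nat_mul, ← Real.exp_nat_mul]
      have e1 : Real.exp (((2:ℕ):ℝ) * -((1 - δ) * L)) = Real.exp (2 * δ * L) * Real.exp (((2:ℕ):ℝ) * -L) := by
        rw [← Real.exp_add]; congr 1; push_cast; ring
      rw [e1]; field_simp; rfl
    have h8 := mul_le_mul_of_nonneg_left hpos hε2.le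
    have h9 : 1 / 2 * (∫ x in Ω, KHform k x (grad ψ x) (grad ψ x)) ≤ (π * Q + η) * L := hEle
    linarith
  obtain ⟨r1, r2⟩ := ray_bound hD hε0 hε1 hψT hneg
  exact ⟨r1, r2.trans hEle⟩

lemma Qfun_cont (hD : Dom k p q Ω) : ContinuousOn (Qfun k q) (closure Ω) := by
  unfold Qfun
  exact (hD.hqc.pow 2).mul (sqrtdet_cont hD.hk).continuousOn

lemma upper (hD : Dom k p q Ω) {x : ℝ × ℝ} (hx : x ∈ closure Ω) {η : ℝ} (hη : 0 < η) :
    ∀ᶠ ε in 𝓝[>] (0:ℝ), (cset k p q Ω ε).Nonempty ∧ ceps k p q Ω ε ≤ (π * Qfun k q x + η) * Real.log (1 / ε) := by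
  have hc := (Qfun_cont hD x hx).mono subset_closure
  have h1 : ∀ᶠ y in 𝓝[Ω] x, Qfun k q y < Qfun k q x + η / (2 * π) :=
    hc.eventually (eventually_lt_nhds (by have := Real.pi_pos; linarith [div_pos hη (by positivity : 0 < 2 * π)]))
  have : (𝓝[Ω] x).NeBot := mem_closure_iff_nhdsWithin_neBot.1 hx
  obtain ⟨y, hy1, hy⟩ := (h1.and self_mem_nhdsWithin).exists
  have hlt1 : ∀ᶠ ε : ℝ in 𝓝[>] 0, ε < 1 := (eventually_lt_nhds one_pos).filter_mono nhdsWithin_le_nhds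
  filter_upwards [upper_pt hD hy (half_pos hη), hlt1, self_mem_nhdsWithin] with ε hε hε1 hε0
  refine ⟨hε.1, hε.2.trans ?_⟩
  have := log_pos' hε0 hε1
  refine mul_le_mul_of_nonneg_right ?_ this.le
  have e : π * (η / (2 * π)) = η / 2 := by field_simp
  nlinarith [Real.pi_pos]
end
end

/- Part 15 -/
noncomputable section
section
variable {k p : ℝ} {q : ℝ × ℝ → ℝ} {Ω : Set (ℝ × ℝ)}

lemma dist_sq_le (a b : ℝ × ℝ) : dist a b ^ 2 ≤ (b.1 - a.1) ^ 2 + (b.2 - a.2) ^ 2 := by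
  rw [Prod.dist_eq, Real.dist_eq, Real.dist_eq]
  rcases max_choice |a.1 - b.1| |a.2 - b.2| with h | h <;> rw [h, sq_abs] <;>
    nlinarith [sq_nonneg (b.1 - a.1), sq_nonneg (b.2 - a.2)]

lemma ev_lt_one : ∀ᶠ ε : ℝ in 𝓝[>] 0, ε < 1 := (eventually_lt_nhds one_pos).filter_mono nhdsWithin_le_nhds

section
variable {u : ℝ → ℝ × ℝ → ℝ} {xs : ℝ × ℝ}

lemma ev_ctx (hD : Dom k p q Ω) (hu : ∀ ε ∈ Set.Ioo (0:ℝ) 1, IsMPSolution k p ε q Ω (u ε)) :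
    ∀ᶠ ε in 𝓝[>] (0:ℝ), Ctx k p q Ω ε (u ε) := by
  filter_upwards [ev_lt_one, self_mem_nhdsWithin] with ε h1 h0
  exact { toDom := hD, he := h0, he1 := h1, hs := hu ε ⟨h0, h1⟩ }

lemma Qs_pos (hD : Dom k p q Ω) (hx1 : xs ∈ closure Ω) : 0 < Qfun k q xs := by
  have := hD.hq3 xs hx1
  have := sqrtdet_pos hD.hk xs
  unfold Qfun; positivity

lemma M_up (hD : Dom k p q Ω) (hu : ∀ ε ∈ Set.Ioo (0:ℝ) 1, IsMPSolution k p ε q Ω (u ε))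
    (hx1 : xs ∈ closure Ω) {η : ℝ} (hη : 0 < η) :
    ∀ᶠ ε in 𝓝[>] (0:ℝ), Ctx.MM p q Ω ε (u ε) ≤ 2 * π * Qfun k q xs + η ∧ (core q Ω ε (u ε)).Nonempty := by
  filter_upwards [ev_ctx hD hu, upper hD hx1 (half_pos hη)] with ε hC hε
  refine ⟨?_, hC.core_nonempty hε.1⟩
  have h1 := hC.c_ge'.trans hε.2
  have hL := hC.L_pos
  have h2 : Real.log (1 / ε) * Ctx.MM p q Ω ε (u ε) ≤ Real.log (1 / ε) * (2 * π * Qfun k q xs + η) := by linarith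
  exact le_of_mul_le_mul_left h2 hL

/-- energy bound used in the capacity estimate -/
def DD (p Qm : ℝ) (q : ℝ × ℝ → ℝ) (Ω : Set (ℝ × ℝ)) (u : ℝ → ℝ × ℝ → ℝ) (ε : ℝ) : ℝ :=
  Ctx.MM p q Ω ε (u ε) / (Real.log (1 / ε) * Qm) + (Real.log (1 / ε))⁻¹ ^ 2

def mm (p Qm c : ℝ) (q : ℝ × ℝ → ℝ) (Ω : Set (ℝ × ℝ)) (u : ℝ → ℝ × ℝ → ℝ) (ε : ℝ) : ℝ :=
  (1 - (Real.log (1 / ε))⁻¹ ^ 2) - Real.sqrt (2 * π * (DD p Qm q Ω u ε / (c * Real.log 2)))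

lemma Linv : Tendsto (fun ε : ℝ => (Real.log (1 / ε))⁻¹) (𝓝[>] 0) (𝓝 0) := tendsto_inv_atTop_zero.comp tendsto_L

lemma DD_tendsto (hD : Dom k p q Ω) (hu : ∀ ε ∈ Set.Ioo (0:ℝ) 1, IsMPSolution k p ε q Ω (u ε))
    (hx1 : xs ∈ closure Ω) : Tendsto (DD p (Qfun k q xs) q Ω u) (𝓝[>] 0) (𝓝 0) := by
  have hQ := Qs_pos hD hx1
  set Qm := Qfun k q xs
  have h1 : Tendsto (fun ε : ℝ => (2 * π * Qm + 1) / Qm * (Real.log (1 / ε))⁻¹ + (Real.log (1 / ε))⁻¹ ^ 2) (𝓝[>] 0)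
      (𝓝 ((2 * π * Qm + 1) / Qm * 0 + 0 ^ 2)) := (Linv.const_mul _).add (Linv.pow 2)
  norm_num at h1
  have h1' : Tendsto (fun ε : ℝ => (2 * π * Qm + 1) / Qm * (Real.log (1 / ε))⁻¹ + (Real.log (1 / ε))⁻¹ ^ 2) (𝓝[>] 0) (𝓝 0) := by
    simpa using h1
  refine tendsto_of_tendsto_of_tendsto_of_le_of_le' tendsto_const_nhds h1' ?_ ?_
  · filter_upwards [ev_ctx hD hu] with ε hC
    have := hC.L_pos
    have := hC.MM_nonneg
    unfold DD; positivity
  · filter_upwards [ev_ctx hD hu, M_up hD hu hx1 one_pos] with ε hC hM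
    have := hC.L_pos
    unfold DD
    have e : (2 * π * Qm + 1) / Qm * (Real.log (1 / ε))⁻¹ = (2 * π * Qm + 1) / (Real.log (1 / ε) * Qm) := by
      field_simp
    rw [e]
    have := hM.1
    gcongr

lemma mm_tendsto (hD : Dom k p q Ω) (hu : ∀ ε ∈ Set.Ioo (0:ℝ) 1, IsMPSolution k p ε q Ω (u ε))
    (hx1 : xs ∈ closure Ω) (c : ℝ) : Tendsto (mm p (Qfun k q xs) c q Ω u) (𝓝[>] 0) (𝓝 1) := by
  have h1 := (((DD_tendsto hD hu hx1).div_const (c * Real.log 2)).const_mul (2 * π)).sqrt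
  have h2 := ((Linv.pow 2).const_sub 1).sub h1
  have e : (1 - (0:ℝ) ^ 2) - Real.sqrt (2 * π * (0 / (c * Real.log 2))) = 1 := by simp
  rw [e] at h2
  exact h2

lemma diam_small (hD : Dom k p q Ω) (hu : ∀ ε ∈ Set.Ioo (0:ℝ) 1, IsMPSolution k p ε q Ω (u ε))
    (hx1 : xs ∈ closure Ω) (hxmin : ∀ y ∈ closure Ω, Qfun k q xs ≤ Qfun k q y) {d0 : ℝ} (hd0 : 0 < d0) :
    ∀ᶠ ε in 𝓝[>] (0:ℝ), ∀ a ∈ core q Ω ε (u ε), ∀ b ∈ core q Ω ε (u ε), dist a b < d0 := by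
  have hQ := Qs_pos hD hx1
  obtain ⟨c, hc, R, hR, ρ, hρ, hρR, hcap⟩ := capX hD xs (l := 1 / 2) (by norm_num) (by norm_num)
  set d := min d0 R with hd
  have hdp : 0 < d := lt_min hd0 hR
  have hm := mm_tendsto hD hu hx1 c
  have hDD := DD_tendsto hD hu hx1
  have t1 : Tendsto (fun ε => 2 * π * mm p (Qfun k q xs) c q Ω u ε ^ 2 - (Real.log (2 * R / d) / c) * DD p (Qfun k q xs) q Ω u ε)
      (𝓝[>] 0) (𝓝 (2 * π * 1 ^ 2 - (Real.log (2 * R / d) / c) * 0)) := ((hm.pow 2).const_mul _).sub (hDD.const_mul _)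
  have e1 := t1.eventually (eventually_gt_nhds (by have := Real.pi_pos; linarith : (0:ℝ) < _))
  have e2 := hm.eventually (eventually_gt_nhds one_pos)
  filter_upwards [e1, e2, ev_ctx hD hu] with ε h1 h2 hC a ha b hb
  by_contra hcon
  push Not at hcon
  have hL := hC.L_pos
  obtain ⟨bf, hbT, hbc, hbE⟩ := hC.b_fn hQ (fun x hx => hxmin x (subset_closure hx))
    (η := (Real.log (1 / ε))⁻¹ ^ 2) (by positivity)
  have h3 := (hcap bf _ _ _ d _ a b hbT hbE hC.core_preconn (fun x hx => hx.1) ha hb hdp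
    ((pow_le_pow_left₀ hdp.le ((min_le_left _ _).trans hcon) 2).trans (dist_sq_le a b)) hbc rfl h2.le).1 (min_le_right _ _)
  change 2 * π * mm p (Qfun k q xs) c q Ω u ε ^ 2 ≤ (Real.log (2 * R / d) / c) * DD p (Qfun k q xs) q Ω u ε at h3
  linarith

lemma dist_le_dE (a b : ℝ × ℝ) : dist a b ≤ dE a b := by
  unfold dE
  apply Real.le_sqrt_of_sq_le
  have := dist_sq_le b a
  rwa [dist_comm] at this

lemma core_near (hD : Dom k p q Ω) (hu : ∀ ε ∈ Set.Ioo (0:ℝ) 1, IsMPSolution k p ε q Ω (u ε))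
    (hx1 : xs ∈ closure Ω) (hxmin : ∀ y ∈ closure Ω, Qfun k q xs ≤ Qfun k q y)
    (hconc : Tendsto (fun ε => distE (vcore q Ω ε (u ε)) {xs}) (𝓝[>] (0:ℝ)) (𝓝 0)) {d0 : ℝ} (hd0 : 0 < d0) :
    ∀ᶠ ε in 𝓝[>] (0:ℝ), ∀ a ∈ core q Ω ε (u ε), dist a xs < d0 := by
  filter_upwards [diam_small hD hu hx1 hxmin (half_pos hd0), hconc.eventually (eventually_lt_nhds (half_pos hd0)),
    M_up hD hu hx1 one_pos] with ε h1 h2 h3 a ha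
  obtain ⟨y, hy⟩ := h3.2
  have hvc : ∀ x, x ∈ vcore q Ω ε (u ε) ↔ x ∈ core q Ω ε (u ε) := by
    intro x
    unfold vcore core ff
    simp only [Set.mem_ofPred_eq, sub_pos]
  unfold distE at h2
  have hne : {d | ∃ a ∈ vcore q Ω ε (u ε), ∃ b ∈ ({xs} : Set (ℝ × ℝ)), d = dE a b}.Nonempty :=
    ⟨_, y, (hvc y).2 hy, xs, rfl, rfl⟩
  obtain ⟨_, ⟨a0, ha0, b0, hb0, rfl⟩, hlt⟩ := exists_lt_of_csInf_lt hne h2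
  rw [mem_singleton_iff] at hb0
  subst hb0
  have h4 := h1 a ha a0 ((hvc a0).1 ha0)
  have h5 := dist_le_dE a0 b0
  linarith [dist_triangle a a0 b0]

lemma M_low (hD : Dom k p q Ω) (hu : ∀ ε ∈ Set.Ioo (0:ℝ) 1, IsMPSolution k p ε q Ω (u ε))
    (hx1 : xs ∈ closure Ω) (hxmin : ∀ y ∈ closure Ω, Qfun k q xs ≤ Qfun k q y)
    (hconc : Tendsto (fun ε => distE (vcore q Ω ε (u ε)) {xs}) (𝓝[>] (0:ℝ)) (𝓝 0)) {l : ℝ} (hl : 0 < l) (hl1 : l < 1)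
    {A : ℝ} (hA : A < 2 * π * Qfun k q xs * l) :
    ∀ᶠ ε in 𝓝[>] (0:ℝ), A < Ctx.MM p q Ω ε (u ε) := by
  have hQ := Qs_pos hD hx1
  obtain ⟨c, hc, R, hR, ρ, hρ, hρR, hcap⟩ := capX hD xs hl hl1
  have hB0 : 0 < 2 * π * Qfun k q xs + 1 := by positivity
  obtain ⟨c', hc', harea⟩ := area_lemma hD hB0
  set r0 := Real.sqrt c' / 4 with hr0
  have hr00 : 0 < r0 := by have := Real.sqrt_pos.2 hc'; positivity
  have hr0c : (2 * r0) ^ 2 < c' := by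
    have : (2 * r0) ^ 2 = Real.sqrt c' ^ 2 / 4 := by rw [hr0]; ring
    rw [this, Real.sq_sqrt hc'.le]; linarith
  have hm := mm_tendsto hD hu hx1 c
  set C1 := Real.log (2 * ρ / r0) with hC1
  set C2 := Real.log (R / ρ) / c with hC2
  set g : ℝ → ℝ := fun ε => (1 + C1 * (Real.log (1 / ε))⁻¹) / l + C2 * (Real.log (1 / ε))⁻¹ with hg
  have hgt : Tendsto g (𝓝[>] 0) (𝓝 ((1 + C1 * 0) / l + C2 * 0)) :=
    (((Linv.const_mul _).const_add _).div_const _).add (Linv.const_mul _)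
  have hgl : (1 + C1 * 0) / l + C2 * 0 = 1 / l := by ring
  rw [hgl] at hgt
  have ht : Tendsto (fun ε => Qfun k q xs * (2 * π * mm p (Qfun k q xs) c q Ω u ε ^ 2 / g ε - (Real.log (1 / ε))⁻¹)) (𝓝[>] 0)
      (𝓝 (Qfun k q xs * (2 * π * 1 ^ 2 / (1 / l) - 0))) :=
    ((((hm.pow 2).const_mul _).div hgt (by positivity)).sub Linv).const_mul _
  have e1 := ht.eventually (eventually_gt_nhds (lt_of_lt_of_eq hA (by field_simp; ring)))
  have e2 := hm.eventually (eventually_gt_nhds one_pos)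
  have e3 := hgt.eventually (eventually_gt_nhds (by positivity : 0 < 1 / l))
  have e4 : ∀ᶠ ε : ℝ in 𝓝[>] 0, r0 * ε < ρ := by
    have : Tendsto (fun ε : ℝ => r0 * ε) (𝓝[>] 0) (𝓝 (r0 * 0)) := (tendsto_id.mono_left nhdsWithin_le_nhds).const_mul _
    exact this.eventually (eventually_lt_nhds (by simpa using hρ))
  filter_upwards [e1, e2, e3, e4, ev_ctx hD hu, M_up hD hu hx1 one_pos, core_near hD hu hx1 hxmin hconc hρ]
    with ε h1 h2 h3 h4 hC hM hnear
  have hL := hC.L_pos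
  have he := hC.he
  have har := harea ε (u ε) hC hM.1 hM.2
  obtain ⟨a, ha, b, hb, hab⟩ := two_points (A := core q Ω ε (u ε)) (r := r0 * ε) (by positivity) hM.2
    (lt_of_lt_of_le (by have : 0 < ε ^ 2 := by positivity
                        nlinarith) har)
  obtain ⟨bf, hbT, hbc, hbE⟩ := hC.b_fn hQ (fun x hx => hxmin x (subset_closure hx))
    (η := (Real.log (1 / ε))⁻¹ ^ 2) (by positivity)
  have h5 := (hcap bf _ _ _ (r0 * ε) _ a b hbT hbE hC.core_preconn (fun x hx => hx.1) ha hb (by positivity)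
    ((pow_le_pow_left₀ (by positivity) hab.le 2).trans (dist_sq_le a b)) hbc rfl h2.le).2 (hnear a ha) h4.le
  change 2 * π * mm p (Qfun k q xs) c q Ω u ε ^ 2 ≤ (Real.log (2 * ρ / (r0 * ε)) / l + C2) * DD p (Qfun k q xs) q Ω u ε at h5
  have h6 : Real.log (2 * ρ / (r0 * ε)) = Real.log (1 / ε) + C1 := by
    rw [hC1, ← Real.log_mul (by positivity) (by positivity)]
    congr 1; field_simp
  rw [h6] at h5
  refine lt_of_lt_of_le h1 ?_
  set L := Real.log (1 / ε) with hLdef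
  set M := Ctx.MM p q Ω ε (u ε) with hMdef
  have h7 : ((L + C1) / l + C2) * DD p (Qfun k q xs) q Ω u ε = g ε * (M / Qfun k q xs + L⁻¹) := by
    simp only [hg, DD]
    rw [← hLdef, ← hMdef]
    field_simp
  rw [h7] at h5
  have h8 : 2 * π * mm p (Qfun k q xs) c q Ω u ε ^ 2 / g ε ≤ M / Qfun k q xs + L⁻¹ := by
    rw [div_le_iff₀ h3]; linarith
  have h9 : Qfun k q xs * (M / Qfun k q xs) = M := by field_simp
  nlinarith

lemma M_tendsto (hD : Dom k p q Ω) (hu : ∀ ε ∈ Set.Ioo (0:ℝ) 1, IsMPSolution k p ε q Ω (u ε))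
    (hx1 : xs ∈ closure Ω) (hxmin : ∀ y ∈ closure Ω, Qfun k q xs ≤ Qfun k q y)
    (hconc : Tendsto (fun ε => distE (vcore q Ω ε (u ε)) {xs}) (𝓝[>] (0:ℝ)) (𝓝 0)) :
    Tendsto (fun ε => Ctx.MM p q Ω ε (u ε)) (𝓝[>] 0) (𝓝 (2 * π * Qfun k q xs)) := by
  rw [tendsto_order]
  constructor
  · intro A hA
    have hc : Tendsto (fun l : ℝ => 2 * π * Qfun k q xs * l) (𝓝[<] 1) (𝓝 (2 * π * Qfun k q xs * 1)) :=
      (tendsto_id.mono_left nhdsWithin_le_nhds).const_mul _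
    have h1 := hc.eventually (eventually_gt_nhds (by rwa [mul_one]))
    have h2 : ∀ᶠ l : ℝ in 𝓝[<] 1, 0 < l := (eventually_gt_nhds one_pos).filter_mono nhdsWithin_le_nhds
    obtain ⟨l, ⟨hl1, hl2⟩, hl3⟩ := ((h1.and h2).and self_mem_nhdsWithin).exists
    exact M_low hD hu hx1 hxmin hconc hl2 hl3 hl1
  · intro A hA
    filter_upwards [M_up hD hu hx1 (half_pos (sub_pos.2 hA))] with ε hε
    linarith [hε.1]

lemma kappa_tendsto (hD : Dom k p q Ω) (hu : ∀ ε ∈ Set.Ioo (0:ℝ) 1, IsMPSolution k p ε q Ω (u ε))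
    (hx1 : xs ∈ closure Ω) (hxmin : ∀ y ∈ closure Ω, Qfun k q xs ≤ Qfun k q y)
    (hconc : Tendsto (fun ε => distE (vcore q Ω ε (u ε)) {xs}) (𝓝[>] (0:ℝ)) (𝓝 0)) :
    Tendsto (fun ε => ∫ x in Ω, ww p q ε (u ε) x) (𝓝[>] 0) (𝓝 (2 * π * q xs * Real.sqrt (detKH k xs))) := by
  have hM := M_tendsto hD hu hx1 hxmin hconc
  have hqs := hD.hq3 xs hx1
  have hQ := Qs_pos hD hx1
  obtain ⟨c0, hc0, hq0⟩ := hD.qmin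
  have hB : 0 < 2 * π * Qfun k q xs + 1 := by positivity
  have hdiff : Tendsto (fun ε => Ctx.MM p q Ω ε (u ε) - q xs * ∫ x in Ω, ww p q ε (u ε) x) (𝓝[>] 0) (𝓝 0) := by
    rw [Metric.tendsto_nhds]
    intro τ hτ
    set σ := τ * c0 / (2 * (2 * π * Qfun k q xs + 1)) with hσ
    have hσ0 : 0 < σ := by positivity
    obtain ⟨d0, hd0, hqd⟩ := Metric.continuousWithinAt_iff.1 (hD.hqc xs hx1) σ hσ0
    filter_upwards [ev_ctx hD hu, M_up hD hu hx1 one_pos, core_near hD hu hx1 hxmin hconc hd0] with ε hC hMε hn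
    have i1 : IntegrableOn (fun x => ww p q ε (u ε) x) Ω := by
      simpa using hC.wg_int (g := fun _ => 1) continuousOn_const subset_rfl
    have i2 : IntegrableOn (fun x => ww p q ε (u ε) x * q x) Ω := hC.wg_int hC.hqC1.continuousOn subset_rfl
    have hk1 := hC.intww (fun x hx => hq0 x (subset_closure hx))
    rw [Real.dist_eq, sub_zero]
    have e : Ctx.MM p q Ω ε (u ε) - q xs * ∫ x in Ω, ww p q ε (u ε) x =
        ∫ x in Ω, (ww p q ε (u ε) x * q x - q xs * ww p q ε (u ε) x) := by
      rw [integral_sub i2 (i1.const_mul _), integral_const_mul]; rfl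
    have b1 : |∫ x in Ω, (ww p q ε (u ε) x * q x - q xs * ww p q ε (u ε) x)| ≤ ∫ x in Ω, σ * ww p q ε (u ε) x := by
      rw [← Real.norm_eq_abs]
      refine norm_integral_le_of_norm_le (i1.const_mul _) ?_
      refine (ae_restrict_iff' hD.ho.measurableSet).2 (ae_of_all _ fun x hx => ?_)
      have hw := hC.w_nonneg x
      rcases le_or_gt (ff q ε (u ε) x) 0 with hf | hf
      · rw [hC.w_zero hf]; simp
      · have h1 := hqd (subset_closure hx) (hn x ⟨hx, hf⟩)
        rw [Real.dist_eq] at h1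
        have e2 : ww p q ε (u ε) x * q x - q xs * ww p q ε (u ε) x = (q x - q xs) * ww p q ε (u ε) x := by ring
        rw [e2, norm_mul, Real.norm_eq_abs, Real.norm_eq_abs, abs_of_nonneg hw]
        exact mul_le_mul_of_nonneg_right h1.le hw
    rw [integral_const_mul] at b1
    rw [e]
    have hk2 : ∫ x in Ω, ww p q ε (u ε) x ≤ (2 * π * Qfun k q xs + 1) / c0 := by
      rw [le_div_iff₀ hc0]; linarith [hMε.1]
    have b2 : σ * ∫ x in Ω, ww p q ε (u ε) x ≤ σ * ((2 * π * Qfun k q xs + 1) / c0) := by gcongr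
    have b3 : σ * ((2 * π * Qfun k q xs + 1) / c0) = τ / 2 := by rw [hσ]; field_simp
    linarith
  have h := (hM.sub hdiff).div_const (q xs)
  have e : (2 * π * Qfun k q xs - 0) / q xs = 2 * π * q xs * Real.sqrt (detKH k xs) := by
    unfold Qfun; field_simp; ring
  rw [e] at h
  refine h.congr ?_
  intro ε
  field_simp; ring
end
end
end

/-- Lemma 3.7: the circulation
`κ(w_ε) = ∫_Ω ε⁻²(u_ε - q ln(1/ε))₊ᵖ` converges to `2π q(x*)√(det K_H(x*))`, where
`x*` is the minimum point of `q²√(det K_H)` to which `A_ε` concentrates. -/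
theorem statement15 (k p : ℝ) (hk : 0 < k) (hp : 1 < p)
    (Ω : Set (ℝ × ℝ)) (hΩo : IsOpen Ω) (hΩc : IsConnected Ω)
    (hΩb : Bornology.IsBounded Ω) (hΩsc : SimplyConnectedSpace ↥Ω)
    (q : ℝ × ℝ → ℝ) (hq1 : ContDiffOn ℝ 2 q Ω) (hq2 : ContDiffOn ℝ 1 q (closure Ω))
    (hq3 : ∀ x ∈ closure Ω, 0 < q x) (hq4 : ∀ x ∈ Ω, LH k q x = 0)
    (hmin : ∃ x0 ∈ closure Ω, x0.2 = 0 ∧ ∀ y ∈ closure Ω, Qfun k q x0 ≤ Qfun k q y)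
    (u : ℝ → ℝ × ℝ → ℝ)
    (hu : ∀ ε ∈ Set.Ioo (0:ℝ) 1, IsMPSolution k p ε q Ω (u ε))
    (xstar : ℝ × ℝ) (hx1 : xstar ∈ closure Ω)
    (hxmin : ∀ y ∈ closure Ω, Qfun k q xstar ≤ Qfun k q y)
    (hconc : Tendsto (fun ε => distE (vcore q Ω ε (u ε)) {xstar}) (𝓝[>] (0:ℝ)) (𝓝 0)) :
    Tendsto (fun ε => ∫ x in Ω, (1 / ε ^ 2) * pPart (u ε x - q x * Real.log (1 / ε)) ^ p)
      (𝓝[>] (0:ℝ)) (𝓝 (2 * π * q xstar * Real.sqrt (detKH k xstar))) := by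
  have hD : Dom k p q Ω :=
    { hk := hk, hp := hp, ho := hΩo, hb := hΩb, hne := hΩc.nonempty, hq1 := hq1, hqc := hq2.continuousOn,
      hq3 := hq3, hq4 := hq4 }
  exact kappa_tendsto hD hu hx1 hxmin hconc
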